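/- Every triangle-free planar graph G contains an independent set X with |X| ≥ |V(G)|/3 such that G is f-choosable, where f(v) = 3 for v ∈ X and f(v) = 4 otherwise. Consequently, every triangle-free planar graph is (3 + 2/3)-choosable. -/

import Mathlib

structure PlaneEmbedding {V : Type} (G : SimpleGraph V) where
  pos : V → ℝ × ℝ
  arc : V → V → Set.Icc (0:ℝ) 1 → ℝ × ℝ
  pos_inj : Function.Injective pos
  arc_cont : ∀ u v, G.Adj u v → Continuous (arc u v)
  arc_inj : ∀ u v, G.Adj u v → Function.Injective (arc u v)
  arc_start : ∀ u v, G.Adj u v → arc u v ⟨0, by norm_num⟩ = pos u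
  arc_end : ∀ u v, G.Adj u v → arc u v ⟨1, by norm_num⟩ = pos v
  arc_symm : ∀ u v, G.Adj u v → Set.range (arc u v) = Set.range (arc v u)
  arc_avoid : ∀ u v w, G.Adj u v → w ≠ u → w ≠ v → pos w ∉ Set.range (arc u v)
  arcs_meet_only_at_endpoints : ∀ u v x y, G.Adj u v → G.Adj x y →
    ({u, v} : Set V) ≠ {x, y} →
    Set.range (arc u v) ∩ Set.range (arc x y) ⊆ pos '' (({u, v} : Set V) ∩ {x, y})

/-- A graph is planar if it admits a drawing in the plane. -/
def SimpleGraph.IsPlanar {V : Type} (G : SimpleGraph V) : Prop := Nonempty (PlaneEmbedding G)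
/-- A proper colouring of `G` from the lists `L`. -/
def ProperListColoring {V : Type} (G : SimpleGraph V) (L : V → Finset ℕ) (φ : V → ℕ) : Prop :=
  (∀ v, φ v ∈ L v) ∧ ∀ u v, G.Adj u v → φ u ≠ φ v

open Finset

/-- The neighbours of `u` inside the finite vertex set `S`. -/
noncomputable def SimpleGraph.nbrIn {V : Type*} (G : SimpleGraph V) (S : Finset V) (u : V) :
    Finset V := by
  classical exact {v ∈ S | G.Adj u v}

/-- The number of darts (twice the number of edges) of the subgraph induced on `S`. -/
noncomputable def SimpleGraph.dartsIn {V : Type*} (G : SimpleGraph V) (S : Finset V) : ℕ :=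
  ∑ u ∈ S, #(G.nbrIn S u)

/-- The subgraph induced on `S` is `3`-colourable. -/
def SimpleGraph.ThreeColOn {V : Type*} (G : SimpleGraph V) (S : Finset V) : Prop :=
  ∃ f : V → Fin 3, ∀ u ∈ S, ∀ v ∈ S, G.Adj u v → f u ≠ f v

@[simp] lemma SimpleGraph.mem_nbrIn {V : Type*} {G : SimpleGraph V} {S : Finset V} {u v : V} :
    v ∈ G.nbrIn S u ↔ v ∈ S ∧ G.Adj u v := by
  simp [SimpleGraph.nbrIn]

/-- A local form of Hall's theorem: if the items meeting `B` number at most the total capacity of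
`B`, then for some nonempty `H ⊆ B` all items meeting `H` can be served from `H`. -/
lemma exists_subset_assignment {ι V : Type*} [DecidableEq V] (I : Finset ι) (N : ι → Finset V)
    (cap : V → ℕ) (B : Finset V) (hB : B.Nonempty)
    (hcard : #{i ∈ I | (N i ∩ B).Nonempty} ≤ ∑ v ∈ B, cap v) :
    ∃ H ⊆ B, H.Nonempty ∧ ∃ a : ι → V, (∀ i ∈ I, (N i ∩ H).Nonempty → a i ∈ N i ∩ H) ∧
      ∀ v, #{i ∈ I | (N i ∩ H).Nonempty ∧ a i = v} ≤ cap v := by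
  classical
  let P : Finset V → Prop := fun H => H ⊆ B ∧ H.Nonempty ∧
    #{i ∈ I | (N i ∩ H).Nonempty} ≤ ∑ v ∈ H, cap v
  obtain ⟨H, hHB, hH⟩ := exists_minimal_le_of_wellFoundedLT P B ⟨Subset.rfl, hB, hcard⟩
  obtain ⟨⟨-, hHne, hHc⟩, hmin⟩ := hH
  let J := {i ∈ I | (N i ∩ H).Nonempty}
  let t : J → Finset (Σ _ : V, ℕ) := fun i => (N i ∩ H).sigma fun v => range (cap v)
  have hall : ∀ s : Finset J, #s ≤ #(s.biUnion t) := by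
    intro s
    let N' := s.biUnion fun i => N i ∩ H
    have hN'H : N' ⊆ H := by
      intro v hv
      simp only [N', mem_biUnion, mem_inter] at hv
      obtain ⟨i, -, -, h⟩ := hv
      exact h
    have ht : s.biUnion t = N'.sigma fun v => range (cap v) := by
      ext ⟨v, k⟩
      simp only [t, N', mem_biUnion, mem_sigma]
      tauto
    rw [ht, card_sigma]
    simp only [card_range]
    let H' := H \ N'
    have hs : #s ≤ #J := by simpa using card_le_univ s
    have hsum : ∑ v ∈ H', cap v + ∑ v ∈ N', cap v = ∑ v ∈ H, cap v :=
      sum_sdiff hN'H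
    by_cases hH' : H'.Nonempty
    · by_cases hHH : H' = H
      · have : N' = ∅ := by
          have h1 : Disjoint H N' := by exact (_root_.sdiff_eq_self_iff_disjoint.1 hHH).symm
          exact (disjoint_of_subset_left hN'H h1).eq_bot_of_self
        have hs0 : s = ∅ := by
          by_contra hne
          obtain ⟨i, hi⟩ := nonempty_iff_ne_empty.2 hne
          obtain ⟨v, hv⟩ := (mem_filter.1 i.2).2
          have : v ∈ N' := mem_biUnion.2 ⟨i, hi, hv⟩
          simp_all
        simp [hs0]
      · have hlt : ¬ #{i ∈ I | (N i ∩ H').Nonempty} ≤ ∑ v ∈ H', cap v := by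
          intro hle
          exact hHH (Subset.antisymm sdiff_subset
            (hmin ⟨sdiff_subset.trans hHB, hH', hle⟩ sdiff_subset))
        have hdis : Disjoint (s.map (Function.Embedding.subtype _))
            {i ∈ I | (N i ∩ H').Nonempty} := by
          rw [disjoint_left]
          intro i hi hi'
          simp only [mem_map, Function.Embedding.coe_subtype, Subtype.exists, exists_and_right,
            exists_eq_right] at hi
          obtain ⟨hiJ, his⟩ := hi
          obtain ⟨v, hv⟩ := (mem_filter.1 hi').2
          have h1 := (mem_inter.1 hv)
          have h2 := mem_sdiff.1 h1.2
          exact h2.2 (mem_biUnion.2 ⟨_, his, mem_inter.2 ⟨h1.1, h2.1⟩⟩)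
        have hle : #(s.map (Function.Embedding.subtype _)) + #{i ∈ I | (N i ∩ H').Nonempty}
            ≤ #J := by
          rw [← card_union_of_disjoint hdis]
          apply card_le_card
          apply union_subset
          · intro i hi
            simp only [mem_map, Function.Embedding.coe_subtype, Subtype.exists, exists_and_right,
              exists_eq_right] at hi
            exact hi.1
          · intro i hi
            obtain ⟨h1, v, hv⟩ := mem_filter.1 hi
            refine mem_filter.2 ⟨h1, v, ?_⟩
            have h1 := (mem_inter.1 hv)
            exact mem_inter.2 ⟨h1.1, (mem_sdiff.1 h1.2).1⟩
        rw [card_map] at hle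
        simp only [J] at hle
        omega
    · have : H' = ∅ := not_nonempty_iff_eq_empty.1 hH'
      rw [this] at hsum
      simp only [sum_empty, zero_add] at hsum
      rw [hsum]
      exact hs.trans hHc
  obtain ⟨f, hf, hft⟩ := (all_card_le_biUnion_card_iff_exists_injective t).1 hall
  refine ⟨H, hHB, hHne, fun i => if h : i ∈ J then (f ⟨i, h⟩).1 else hHne.choose, ?_, ?_⟩
  · intro i hi hne
    have hiJ : i ∈ J := mem_filter.2 ⟨hi, hne⟩
    simp only [hiJ, dif_pos]
    exact (mem_sigma.1 (hft ⟨i, hiJ⟩)).1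
  · intro v
    rw [← card_range (cap v)]
    apply card_le_card_of_injOn (fun i => if h : i ∈ J then (f ⟨i, h⟩).2 else 0)
    · intro i hi
      simp only [coe_filter, Set.mem_ofPred_eq] at hi
      have hiJ : i ∈ J := mem_filter.2 ⟨hi.1, hi.2.1⟩
      have h2 := hi.2.2
      simp only [hiJ, dif_pos] at h2 ⊢
      have := (mem_sigma.1 (hft ⟨i, hiJ⟩)).2
      rw [h2] at this
      exact this
    · intro i hi j hj hij
      simp only [coe_filter, Set.mem_ofPred_eq] at hi hj
      have hiJ : i ∈ J := mem_filter.2 ⟨hi.1, hi.2.1⟩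
      have hjJ : j ∈ J := mem_filter.2 ⟨hj.1, hj.2.1⟩
      have hi2 := hi.2.2
      have hj2 := hj.2.2
      simp only [hiJ, hjJ, dif_pos] at hi2 hj2 hij
      have : f ⟨i, hiJ⟩ = f ⟨j, hjJ⟩ := Sigma.ext (hi2.trans hj2.symm) (heq_of_eq hij)
      simpa using hf this

/-- Kernels exist in orientations where an independent set `X` meets bidirected edges only off
itself. -/
lemma exists_kernel {V : Type*} (G : SimpleGraph V) (X : V → Prop) (D : V → V → Prop)
    (hX : ∀ u v, X u → X v → ¬ G.Adj u v)
    (hB : ∀ u v, ¬ X u → ¬ X v → G.Adj u v → D u v)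
    (hXB : ∀ u v, X u → ¬ X v → G.Adj u v → D u v ∨ D v u) (U : Finset V) :
    ∃ K ⊆ U, (∀ u ∈ K, ∀ v ∈ K, ¬ G.Adj u v) ∧ ∀ v ∈ U, v ∉ K → ∃ w ∈ K, G.Adj v w ∧ D v w := by
  classical
  induction U using Finset.strongInduction with
  | H U ih =>
    by_cases h : ∃ b ∈ U, ¬ X b ∧ ∀ a ∈ U, X a → G.Adj b a → ¬ D b a
    · obtain ⟨b, hbU, hb, hba⟩ := h
      obtain ⟨K, hKU, hK, hKk⟩ := ih ({v ∈ U | v ≠ b ∧ ¬ (G.Adj v b ∧ D v b)})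
        (filter_ssubset.2 ⟨b, hbU, by simp⟩)
      have hKb : ∀ v ∈ K, ¬ G.Adj v b := by
        intro v hv hadj
        obtain ⟨hvU, hvb, hD⟩ := mem_filter.1 (hKU hv)
        apply hD
        refine ⟨hadj, ?_⟩
        by_cases hXv : X v
        · exact (hXB v b hXv hb hadj).resolve_right (hba v hvU hXv hadj.symm)
        · exact hB v b hXv hb hadj
      refine ⟨insert b K, ?_, ?_, ?_⟩
      · exact insert_subset hbU (hKU.trans (filter_subset _ _))
      · intro u hu v hv
        rcases mem_insert.1 hu with hu | hu <;> rcases mem_insert.1 hv with hv | hv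
        · rw [hu, hv]; exact G.loopless.irrefl _
        · rw [hu]; exact fun h => hKb v hv h.symm
        · rw [hv]; exact hKb u hu
        · exact hK u hu v hv
      · intro v hv hvK
        simp only [mem_insert, not_or] at hvK
        by_cases hD : G.Adj v b ∧ D v b
        · exact ⟨b, mem_insert_self _ _, hD⟩
        · obtain ⟨w, hw, h⟩ := hKk v (mem_filter.2 ⟨hv, hvK.1, hD⟩) hvK.2
          exact ⟨w, mem_insert_of_mem hw, h⟩
    · push Not at h
      refine ⟨{v ∈ U | X v}, filter_subset _ _, ?_, ?_⟩
      · intro u hu v hv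
        exact hX u v (mem_filter.1 hu).2 (mem_filter.1 hv).2
      · intro v hv hvK
        have hXv : ¬ X v := fun h => hvK (mem_filter.2 ⟨hv, h⟩)
        obtain ⟨a, ha, hXa, h1, h2⟩ := h v hv hXv
        exact ⟨a, mem_filter.2 ⟨ha, hXa⟩, h1, h2⟩

lemma exists_listColouring_of_kernels {V : Type*} (G : SimpleGraph V) (D : V → V → Prop)
    (hker : ∀ U : Finset V, ∃ K ⊆ U, (∀ u ∈ K, ∀ v ∈ K, ¬ G.Adj u v) ∧
      ∀ v ∈ U, v ∉ K → ∃ w ∈ K, G.Adj v w ∧ D v w) (n : ℕ) :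
    ∀ (U : Finset V) (L : V → Finset ℕ), #U = n →
    (∀ v ∈ U, ∀ Q : Finset V, (∀ w ∈ Q, w ∈ U ∧ G.Adj v w ∧ D v w) → #Q < #(L v)) →
    ∃ φ : V → ℕ, (∀ v ∈ U, φ v ∈ L v) ∧ ∀ u ∈ U, ∀ v ∈ U, G.Adj u v → φ u ≠ φ v := by
  classical
  induction n using Nat.strong_induction_on with
  | _ n ih =>
    intro U L hUn hL
    rcases U.eq_empty_or_nonempty with rfl | ⟨v0, hv0⟩
    · exact ⟨fun _ => 0, by simp, by simp⟩
    have : (L v0).Nonempty := by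
      rw [← card_pos]; simpa using hL v0 hv0 ∅ (by simp)
    obtain ⟨k, hk⟩ := this
    obtain ⟨K, hKU, hK, hKk⟩ := hker {v ∈ U | k ∈ L v}
    have hKne : K.Nonempty := by
      by_contra hne
      rw [not_nonempty_iff_eq_empty] at hne
      subst hne
      obtain ⟨w, hw, -⟩ := hKk v0 (mem_filter.2 ⟨hv0, hk⟩) (by simp)
      simp at hw
    have hKU' : K ⊆ U := hKU.trans (filter_subset _ _)
    obtain ⟨φ, hφL, hφ⟩ := ih (#(U \ K))
      (by rw [← hUn, card_sdiff_of_subset hKU']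
          have := card_pos.2 hKne
          have := card_le_card hKU'
          omega) (U \ K) (fun v => (L v).erase k) rfl (by
        intro v hv Q hQ
        obtain ⟨hvU, hvK⟩ := mem_sdiff.1 hv
        by_cases hkv : k ∈ L v
        · obtain ⟨w, hw, hw2⟩ := hKk v (mem_filter.2 ⟨hvU, hkv⟩) hvK
          have hwQ : w ∉ Q := fun h => (mem_sdiff.1 (hQ w h).1).2 hw
          have := hL v hvU (insert w Q) (by
            intro x hx
            rcases mem_insert.1 hx with rfl | hx
            · exact ⟨hKU' hw, hw2⟩
            · exact ⟨(mem_sdiff.1 (hQ x hx).1).1, (hQ x hx).2⟩)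
          rw [card_insert_of_notMem hwQ] at this
          rw [card_erase_of_mem hkv]
          omega
        · rw [erase_eq_of_notMem hkv]
          exact hL v hvU Q fun x hx => ⟨(mem_sdiff.1 (hQ x hx).1).1, (hQ x hx).2⟩)
    refine ⟨fun v => if v ∈ K then k else φ v, ?_, ?_⟩
    · intro v hv
      by_cases hvK : v ∈ K
      · simp only [hvK, if_true]; exact (mem_filter.1 (hKU hvK)).2
      · simp only [hvK, if_false]; exact (mem_erase.1 (hφL v (mem_sdiff.2 ⟨hv, hvK⟩))).2
    · intro u hu v hv huv
      by_cases huK : u ∈ K <;> by_cases hvK : v ∈ K <;> simp only [huK, hvK, if_true, if_false]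
      · exact absurd huv (hK u huK v hvK)
      · exact (mem_erase.1 (hφL v (mem_sdiff.2 ⟨hv, hvK⟩))).1.symm
      · exact (mem_erase.1 (hφL u (mem_sdiff.2 ⟨hu, huK⟩))).1
      · exact hφ u (mem_sdiff.2 ⟨hu, huK⟩) v (mem_sdiff.2 ⟨hv, hvK⟩) huv

/-- `f` has degree at most `n` and its coefficients in degree `n` are nonnegative. -/
def NonnegTop {σ : Type*} (n : ℕ) (f : MvPolynomial σ ℚ) : Prop :=
  f.totalDegree ≤ n ∧ ∀ k : σ →₀ ℕ, k.degree = n → 0 ≤ f.coeff k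

/-- `f` has nonnegative coefficients in its top degree, and a positive coefficient at the top-degree
monomial `m`. -/
def PosTop {σ : Type*} (m : σ →₀ ℕ) (f : MvPolynomial σ ℚ) : Prop :=
  NonnegTop m.degree f ∧ 0 < f.coeff m

namespace NonnegTop
open MvPolynomial
variable {σ : Type*} {n n' : ℕ} {f g : MvPolynomial σ ℚ}

lemma coeff_eq_zero (h : NonnegTop n f) {k : σ →₀ ℕ} (hk : n < k.degree) : f.coeff k = 0 := by
  apply coeff_eq_zero_of_totalDegree_lt
  exact h.1.trans_lt hk

lemma of_totalDegree_lt (h : f.totalDegree < n) : NonnegTop n f :=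
  ⟨h.le, fun k hk => by
    rw [coeff_eq_zero_of_totalDegree_lt (by rw [← hk] at h; exact h)]⟩

lemma add (hf : NonnegTop n f) (hg : NonnegTop n g) : NonnegTop n (f + g) :=
  ⟨(totalDegree_add _ _).trans (max_le hf.1 hg.1), fun k hk => by
    rw [coeff_add]; exact add_nonneg (hf.2 k hk) (hg.2 k hk)⟩

lemma C_mul (hf : NonnegTop n f) {r : ℚ} (hr : 0 ≤ r) : NonnegTop n (C r * f) :=
  ⟨(totalDegree_mul _ _).trans (by simpa using hf.1), fun k hk => by
    rw [coeff_C_mul]; exact mul_nonneg hr (hf.2 k hk)⟩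

lemma mul (hf : NonnegTop n f) (hg : NonnegTop n' g) : NonnegTop (n + n') (f * g) := by
  classical
  refine ⟨(totalDegree_mul _ _).trans (add_le_add hf.1 hg.1), fun k hk => ?_⟩
  rw [coeff_mul]
  refine sum_nonneg fun p hp => ?_
  have hp : p.1 + p.2 = k := by simpa using hp
  have hd : p.1.degree + p.2.degree = n + n' := by rw [← hk, ← hp, map_add]
  rcases lt_trichotomy n p.1.degree with h | h | h
  · rw [hf.coeff_eq_zero h, zero_mul]
  · exact mul_nonneg (hf.2 _ h.symm) (hg.2 _ (by omega))
  · rw [hg.coeff_eq_zero (by omega), mul_zero]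

end NonnegTop

namespace PosTop
open MvPolynomial
variable {σ : Type*} {m m' : σ →₀ ℕ} {f g : MvPolynomial σ ℚ}

lemma X (v : σ) : PosTop (Finsupp.single v 1) (MvPolynomial.X v) := by
  classical
  refine ⟨⟨by simp, fun k hk => ?_⟩, ?_⟩
  · rw [coeff_X]; split_ifs <;> norm_num
  · simp

lemma one : PosTop (0 : σ →₀ ℕ) 1 := by
  classical
  refine ⟨⟨by simp, fun k hk => ?_⟩, ?_⟩
  · rw [coeff_one]; split_ifs <;> norm_num
  · simp

lemma add (hf : PosTop m f) (hg : NonnegTop m.degree g) : PosTop m (f + g) :=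
  ⟨hf.1.add hg, by rw [coeff_add]; exact add_pos_of_pos_of_nonneg hf.2 (hg.2 _ rfl)⟩

lemma C_mul (hf : PosTop m f) {r : ℚ} (hr : 0 < r) : PosTop m (C r * f) :=
  ⟨hf.1.C_mul hr.le, by rw [coeff_C_mul]; exact mul_pos hr hf.2⟩

lemma mul (hf : PosTop m f) (hg : PosTop m' g) : PosTop (m + m') (f * g) := by
  classical
  refine ⟨by rw [map_add]; exact hf.1.mul hg.1, ?_⟩
  rw [coeff_mul]
  refine sum_pos' (fun p hp => ?_) ⟨(m, m'), by simp, mul_pos hf.2 hg.2⟩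
  have hp : p.1 + p.2 = m + m' := by simpa using hp
  have hd : p.1.degree + p.2.degree = m.degree + m'.degree := by rw [← map_add, hp, map_add]
  rcases lt_trichotomy m.degree p.1.degree with h | h | h
  · rw [hf.1.coeff_eq_zero h, zero_mul]
  · exact mul_nonneg (hf.1.2 _ h.symm) (hg.1.2 _ (by omega))
  · rw [hg.1.coeff_eq_zero (by omega), mul_zero]

lemma prod {ι : Type*} (s : Finset ι) (m : ι → σ →₀ ℕ) (f : ι → MvPolynomial σ ℚ)
    (h : ∀ i ∈ s, PosTop (m i) (f i)) : PosTop (∑ i ∈ s, m i) (∏ i ∈ s, f i) := by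
  classical
  induction s using Finset.induction_on with
  | empty => simpa using one
  | insert a s ha ih =>
    rw [sum_insert ha, prod_insert ha]
    exact (h a (mem_insert_self _ _)).mul (ih fun i hi => h i (mem_insert_of_mem hi))

lemma exists_eval_ne_zero [Finite σ] (hf : PosTop m f) (S : σ → Finset ℚ)
    (hS : ∀ i, m i < #(S i)) : ∃ s : σ → ℚ, (∀ i, s i ∈ S i) ∧ eval s f ≠ 0 := by
  refine combinatorial_nullstellensatz_exists_eval_nonzero f m hf.2.ne' ?_ S hS
  refine le_antisymm hf.1.1 ?_
  exact le_totalDegree (mem_support_iff.2 hf.2.ne')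

end PosTop

section Gadget
open MvPolynomial
variable {σ : Type*} [DecidableEq σ]

/-- The variable of `v` if `v ∈ H`, and the constant `k v` otherwise. -/
noncomputable def varOrConst (H : Finset σ) (k : σ → ℚ) (v : σ) : MvPolynomial σ ℚ :=
  if v ∈ H then MvPolynomial.X v else C (k v)

lemma varOrConst_nonnegTop (H : Finset σ) (k : σ → ℚ) (v : σ) : NonnegTop 1 (varOrConst H k v) := by
  unfold varOrConst
  split_ifs with h
  · simpa using (PosTop.X v).1
  · exact NonnegTop.of_totalDegree_lt (by simp)

lemma varOrConst_posTop {H : Finset σ} (k : σ → ℚ) {v : σ} (hv : v ∈ H) :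
    PosTop (Finsupp.single v 1) (varOrConst H k v) := by
  unfold varOrConst
  rw [if_pos hv]
  exact PosTop.X v

/-- The quadratic polynomial vanishing when the values at `u`, `u'`, `w` are three colours with
first and second elementary symmetric functions `s` and `t`. -/
noncomputable def gadgetPoly (H : Finset σ) (k : σ → ℚ) (e e' s t : ℚ) (u u' w : σ) :
    MvPolynomial σ ℚ :=
  (C e * varOrConst H k u + C e * varOrConst H k u') *
    (C e * varOrConst H k u + C e * varOrConst H k u' + C e' * varOrConst H k w - C s) -
  C (1 - e * e' / 2) * (C e * varOrConst H k u * (C e * varOrConst H k u') +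
    C e * varOrConst H k u * (C e' * varOrConst H k w) +
    C e * varOrConst H k u' * (C e' * varOrConst H k w) - C t)

lemma gadgetPoly_symm (H : Finset σ) (k : σ → ℚ) (e e' s t : ℚ) (u u' w : σ) :
    gadgetPoly H k e e' s t u u' w = gadgetPoly H k e e' s t u' u w := by
  unfold gadgetPoly; ring

lemma gadgetPoly_eq (H : Finset σ) (k : σ → ℚ) {e e' : ℚ} (s t : ℚ) (he : e * e = 1)
    (he' : e' * e' = 1) (u u' w : σ) :
    gadgetPoly H k e e' s t u u' w = varOrConst H k u * varOrConst H k u +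
      varOrConst H k u' * varOrConst H k u' +
      C (1 + e * e' / 2) * (varOrConst H k u * varOrConst H k u') +
      C (1 / 2) * (varOrConst H k w * varOrConst H k u) +
      C (1 / 2) * (varOrConst H k w * varOrConst H k u') +
      (C (-s * e) * varOrConst H k u + C (-s * e) * varOrConst H k u' +
        C ((1 - e * e' / 2) * t)) := by
  unfold gadgetPoly
  generalize varOrConst H k u = a
  generalize varOrConst H k u' = b
  generalize varOrConst H k w = c
  have h1 : (C e : MvPolynomial σ ℚ) * C e = 1 := by rw [← C_mul, he, C_1]
  have h2 : (C e' : MvPolynomial σ ℚ) * C e' = 1 := by rw [← C_mul, he', C_1]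
  have h3 : (C (1 - e * e' / 2) : MvPolynomial σ ℚ) = 1 - C (1/2) * C e * C e' := by
    rw [← C_mul, ← C_mul, ← C_1, ← C_sub]; congr 1; ring
  have h4 : (C (1 + e * e' / 2) : MvPolynomial σ ℚ) = 1 + C (1/2) * C e * C e' := by
    rw [← C_mul, ← C_mul, ← C_1, ← C_add]; congr 1; ring
  have h5 : (C (-s * e) : MvPolynomial σ ℚ) = - C s * C e := by
    rw [← C_neg, ← C_mul]
  rw [C_mul (a := 1 - e * e' / 2), h3, h4, h5]
  linear_combination (a ^ 2 + b ^ 2 + a * b * (1 + C (1 / 2) * C e * C e') +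
    C (1 / 2) * C e' * C e' * c * (a + b)) * h1 + (C (1 / 2) * c * (a + b)) * h2

lemma gadgetPoly_posTop_aux (H : Finset σ) (k : σ → ℚ) {e e' : ℚ} (s t : ℚ) (he : e * e = 1)
    (he' : e' * e' = 1) (u u' w : σ) (hu : u ∈ H) (q : σ) (hq : q ∈ H)
    (hq' : q = u ∨ q = u' ∨ q = w) :
    PosTop (Finsupp.single u 1 + Finsupp.single q 1) (gadgetPoly H k e e' s t u u' w) := by
  rw [gadgetPoly_eq H k s t he he']
  have hlam : 0 < 1 + e * e' / 2 := by
    have : (e * e') * (e * e') = 1 := by linear_combination he + e * e * he'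
    nlinarith
  have hN := varOrConst_nonnegTop H k
  have hlow : NonnegTop 2 (C (-s * e) * varOrConst H k u + C (-s * e) * varOrConst H k u' +
        C ((1 - e * e' / 2) * t)) := by
    apply NonnegTop.of_totalDegree_lt
    have h : ∀ (r : ℚ) v, (C r * varOrConst H k v).totalDegree ≤ 1 := fun r v =>
      (totalDegree_mul _ _).trans (by simpa using (hN v).1)
    refine lt_of_le_of_lt (totalDegree_add _ _) ?_
    refine max_lt (lt_of_le_of_lt (totalDegree_add _ _) (max_lt ?_ ?_))
      (by rw [totalDegree_C]; norm_num)
    · exact (h _ _).trans_lt (by norm_num)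
    · exact (h _ _).trans_lt (by norm_num)
  have hd : (Finsupp.single u 1 + Finsupp.single q 1 : σ →₀ ℕ).degree = 2 := by
    simp [map_add]
  have hP := varOrConst_posTop k hu
  have n1 : NonnegTop 2 (varOrConst H k u * varOrConst H k u) := (hN u).mul (hN u)
  have n2 : NonnegTop 2 (varOrConst H k u' * varOrConst H k u') := (hN u').mul (hN u')
  have n3 : NonnegTop 2 (C (1 + e * e' / 2) * (varOrConst H k u * varOrConst H k u')) :=
    ((hN u).mul (hN u')).C_mul hlam.le
  have n4 : NonnegTop 2 (C (1 / 2) * (varOrConst H k w * varOrConst H k u)) :=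
    ((hN w).mul (hN u)).C_mul (by norm_num)
  have n5 : NonnegTop 2 (C (1 / 2) * (varOrConst H k w * varOrConst H k u')) :=
    ((hN w).mul (hN u')).C_mul (by norm_num)
  have key : ∀ f g, PosTop (Finsupp.single u 1 + Finsupp.single q 1) f → NonnegTop 2 g →
      PosTop (Finsupp.single u 1 + Finsupp.single q 1) (f + g) :=
    fun f g hf hg => hf.add (hd ▸ hg)
  have key' : ∀ f g, PosTop (Finsupp.single u 1 + Finsupp.single q 1) g → NonnegTop 2 f →
      PosTop (Finsupp.single u 1 + Finsupp.single q 1) (f + g) :=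
    fun f g hf hg => by rw [add_comm f g]; exact key _ _ hf hg
  rcases hq' with rfl | rfl | rfl
  · exact key _ _ (key _ _ (key _ _ (key _ _ (key _ _ (hP.mul hP) n2) n3) n4) n5) hlow
  · exact key _ _ (key _ _ (key _ _ (key' _ _
      ((hP.mul (varOrConst_posTop k hq)).C_mul hlam) (n1.add n2)) n4) n5) hlow
  · refine key _ _ (key _ _ (key' _ _ ?_ ((n1.add n2).add n3)) n5) hlow
    rw [mul_comm (varOrConst H k q)]
    exact (hP.mul (varOrConst_posTop k hq)).C_mul (by norm_num)

lemma gadgetPoly_posTop (H : Finset σ) (k : σ → ℚ) {e e' : ℚ} (s t : ℚ) (he : e * e = 1)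
    (he' : e' * e' = 1) (u u' w p q : σ) (hp : p ∈ H) (hp' : p = u ∨ p = u') (hq : q ∈ H)
    (hq' : q = u ∨ q = u' ∨ q = w) :
    PosTop (Finsupp.single p 1 + Finsupp.single q 1) (gadgetPoly H k e e' s t u u' w) := by
  rcases hp' with rfl | rfl
  · exact gadgetPoly_posTop_aux H k s t he he' p u' w hp q hq hq'
  · rw [gadgetPoly_symm]
    exact gadgetPoly_posTop_aux H k s t he he' p u w hp q hq (by tauto)

/-- If the gadget polynomial does not vanish then some colour of the list avoids the three
values. -/
lemma exists_mem_list_of_eval_gadgetPoly (H : Finset σ) (k : σ → ℚ) (e e' : ℚ) (Λ : Finset ℕ)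
    (hΛ : #Λ = 3) (u u' w : σ) (z : σ → ℚ) (col : σ → ℕ)
    (hu : e * eval z (varOrConst H k u) = col u) (hu' : e * eval z (varOrConst H k u') = col u')
    (hw : e' * eval z (varOrConst H k w) = col w)
    (hne : eval z (gadgetPoly H k e e' (∑ i ∈ Λ, (i : ℚ))
      (((∑ i ∈ Λ, (i : ℚ)) ^ 2 - ∑ i ∈ Λ, (i : ℚ) ^ 2) / 2) u u' w) ≠ 0) :
    ∃ i ∈ Λ, i ≠ col u ∧ i ≠ col u' ∧ i ≠ col w := by
  by_contra! hcon
  apply hne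
  have hsub : Λ ⊆ {col u, col u', col w} := by
    intro i hi
    have := hcon i hi
    simp only [mem_insert, mem_singleton]
    tauto
  have heq : Λ = {col u, col u', col w} :=
    eq_of_subset_of_card_le hsub (by rw [hΛ]; exact card_le_three)
  have h3 : #({col u, col u', col w} : Finset ℕ) = 3 := heq ▸ hΛ
  have hd1 : col u ≠ col u' := by
    intro h
    rw [h, insert_eq_of_mem (mem_insert_self _ _)] at h3
    exact absurd (h3 ▸ card_le_two) (by norm_num)
  have hd2 : col u' ≠ col w := by
    intro h
    rw [h, pair_eq_singleton] at h3
    exact absurd (h3 ▸ card_le_two) (by norm_num)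
  have hd3 : col u ≠ col w := by
    intro h
    rw [h, insert_eq_of_mem (by simp)] at h3
    exact absurd (h3 ▸ card_le_two) (by norm_num)
  have hs : ∀ f : ℕ → ℚ, ∑ i ∈ Λ, f i = f (col u) + f (col u') + f (col w) := by
    intro f
    rw [heq, sum_insert (by simp [hd1, hd3]), sum_insert (by simp [hd2]), sum_singleton, add_assoc]
  rw [hs, hs]
  unfold gadgetPoly
  simp only [map_sub, map_mul, map_add, eval_C, hu, hu', hw]
  ring

end Gadget

/-- The subgraph induced on `S` can be properly coloured from the lists `L`. -/
def SimpleGraph.ListColOn {V : Type*} (G : SimpleGraph V) (L : V → Finset ℕ) (S : Finset V) :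
    Prop :=
  ∃ φ : V → ℕ, (∀ v ∈ S, φ v ∈ L v) ∧ ∀ u ∈ S, ∀ v ∈ S, G.Adj u v → φ u ≠ φ v

section
variable {V : Type*} [DecidableEq V] {G : SimpleGraph V} {c : V → Fin 3}

lemma listColOn_of_few_darts (hc : ∀ u v, G.Adj u v → c u ≠ c v) {L : V → Finset ℕ}
    (hL3 : ∀ v, c v = 0 → #(L v) = 3) (hL4 : ∀ v, c v ≠ 0 → #(L v) = 4) {S : Finset V}
    (hS : S.Nonempty) (ih : ∀ T ⊂ S, G.ListColOn L T)
    (hq : ∑ b ∈ S with c b ≠ 0, #(G.nbrIn S b) ≤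
      2 * #{v ∈ S | c v = 0} + 3 * #{v ∈ S | c v ≠ 0}) : G.ListColOn L S := by
  classical
  let I : Finset (Σ _ : V, V) := {b ∈ S | c b ≠ 0}.sigma fun b => G.nbrIn S b
  let N : (Σ _ : V, V) → Finset V := fun p => if c p.2 = 0 then {p.1, p.2} else {p.1}
  let cap : V → ℕ := fun v => if c v = 0 then 2 else 3
  have hcap : ∑ v ∈ S, cap v = 2 * #{v ∈ S | c v = 0} + 3 * #{v ∈ S | c v ≠ 0} := by
    simp only [cap, sum_ite, sum_const, smul_eq_mul]
    ring
  obtain ⟨H, hHS, hHne, asg, hasg, hload⟩ := exists_subset_assignment I N cap S hS (by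
    rw [hcap]
    refine (card_filter_le _ _).trans ?_
    rw [card_sigma]; exact hq)
  obtain ⟨φ₀, hφ₀L, hφ₀⟩ := ih (S \ H) (sdiff_ssubset hHS hHne)
  let D : V → V → Prop := fun u v => (c u ≠ 0 ∧ c v ≠ 0) ∨ (c u = 0 ∧ asg ⟨v, u⟩ = u) ∨
    (c u ≠ 0 ∧ c v = 0 ∧ asg ⟨u, v⟩ ≠ v)
  obtain ⟨φ₁, hφ₁L, hφ₁⟩ := exists_listColouring_of_kernels G D
    (exists_kernel G (fun v => c v = 0) D
      (fun u v hu hv h => hc u v h (hu.trans hv.symm))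
      (fun u v hu hv _ => Or.inl ⟨hu, hv⟩)
      (fun u v hu hv _ => by
        by_cases h : asg ⟨v, u⟩ = u
        · exact Or.inl (Or.inr (Or.inl ⟨hu, h⟩))
        · exact Or.inr (Or.inr (Or.inr ⟨hv, hu, h⟩))))
    _ H (fun v => L v \ (G.nbrIn (S \ H) v).image φ₀) rfl (by
      intro v hv Q hQ
      have hdis : Disjoint Q (G.nbrIn (S \ H) v) := by
        rw [disjoint_left]
        intro w hw hw'
        exact (mem_sdiff.1 (SimpleGraph.mem_nbrIn.1 hw').1).2 (hQ w hw).1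
      have hQ' : #(Q ∪ G.nbrIn (S \ H) v) ≤ cap v := by
        refine le_trans ?_ (hload v)
        apply card_le_card_of_injOn (fun w => if c v = 0 then ⟨w, v⟩ else ⟨v, w⟩)
        · intro w hw
          have hw1 : w ∈ S ∧ G.Adj v w ∧ (w ∈ H → D v w) := by
            rcases mem_union.1 hw with h | h
            · exact ⟨hHS (hQ w h).1, (hQ w h).2.1, fun _ => (hQ w h).2.2⟩
            · obtain ⟨h1, h2⟩ := SimpleGraph.mem_nbrIn.1 h
              exact ⟨(mem_sdiff.1 h1).1, h2, fun h => absurd h (mem_sdiff.1 h1).2⟩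
          obtain ⟨hwS, hadj, hD⟩ := hw1
          have hcvw := hc v w hadj
          simp only [coe_filter, Set.mem_ofPred_eq]
          by_cases hv0 : c v = 0
          · have hw0 : c w ≠ 0 := fun h => hcvw (hv0.trans h.symm)
            simp only [hv0, if_true]
            have hmem : (⟨w, v⟩ : Σ _ : V, V) ∈ I := by
              simp [I, hwS, hw0, hHS hv, hadj.symm]
            have hmeet : (N ⟨w, v⟩ ∩ H).Nonempty := ⟨v, by simp [N, hv0, hv]⟩
            refine ⟨hmem, hmeet, ?_⟩
            have := hasg _ hmem hmeet
            simp only [N, hv0, if_true, mem_inter, mem_insert, mem_singleton] at this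
            rcases this with ⟨h | h, hH⟩
            · have := hD (h ▸ hH)
              simpa [D, hv0] using this
            · exact h
          · simp only [hv0, if_false]
            have hmem : (⟨v, w⟩ : Σ _ : V, V) ∈ I := by
              simp [I, hwS, hv0, hHS hv, hadj]
            have hmeet : (N ⟨v, w⟩ ∩ H).Nonempty := ⟨v, by
              by_cases hw0 : c w = 0 <;> simp [N, hw0, hv]⟩
            refine ⟨hmem, hmeet, ?_⟩
            have := hasg _ hmem hmeet
            by_cases hw0 : c w = 0
            · simp only [N, hw0, if_true, mem_inter, mem_insert, mem_singleton] at this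
              rcases this with ⟨h | h, hH⟩
              · exact h
              · have := hD (h ▸ hH)
                simp only [D, hv0, hw0] at this
                tauto
            · simp only [N, hw0, if_false, mem_inter, mem_singleton] at this
              exact this.1
        · intro w _ w' _ h
          by_cases hv0 : c v = 0
          · simp only [hv0, if_true] at h
            exact congrArg Sigma.fst h
          · simp only [hv0, if_false] at h
            exact congrArg (fun p : Σ _ : V, V => p.2) h
      rw [card_union_of_disjoint hdis] at hQ'
      have h1 := le_card_sdiff ((G.nbrIn (S \ H) v).image φ₀) (L v)
      have h2 : #((G.nbrIn (S \ H) v).image φ₀) ≤ _ := card_image_le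
      have h3 : #(L v) = cap v + 1 := by
        by_cases hv0 : c v = 0
        · simp [cap, hv0, hL3 v hv0]
        · simp [cap, hv0, hL4 v hv0]
      omega)
  have hmix : ∀ u ∈ H, ∀ v ∈ S \ H, G.Adj u v → φ₁ u ≠ φ₀ v := by
    intro u hu v hv huv h
    exact (mem_sdiff.1 (hφ₁L u hu)).2
      (mem_image.2 ⟨v, SimpleGraph.mem_nbrIn.2 ⟨hv, huv⟩, h.symm⟩)
  refine ⟨fun v => if v ∈ H then φ₁ v else φ₀ v, ?_, ?_⟩
  · intro v hv
    by_cases hvH : v ∈ H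
    · simp only [hvH, if_true]; exact (mem_sdiff.1 (hφ₁L v hvH)).1
    · simp only [hvH, if_false]; exact hφ₀L v (mem_sdiff.2 ⟨hv, hvH⟩)
  · intro u hu v hv huv
    by_cases huH : u ∈ H <;> by_cases hvH : v ∈ H <;> simp only [huH, hvH, if_true, if_false]
    · exact hφ₁ u huH v hvH huv
    · exact hmix u huH v (mem_sdiff.2 ⟨hv, hvH⟩) huv
    · exact (hmix v hvH u (mem_sdiff.2 ⟨hu, huH⟩) huv.symm).symm
    · exact hφ₀ u (mem_sdiff.2 ⟨hu, huH⟩) v (mem_sdiff.2 ⟨hv, hvH⟩) huv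

/-- Among three neighbours of a vertex of colour `0`, two have the same colour. -/
lemma exists_repeated_colour (hc : ∀ u v, G.Adj u v → c u ≠ c v) {S : Finset V} {a : V}
    (ha : c a = 0) (h3 : #(G.nbrIn S a) = 3) :
    ∃ u u' w, G.nbrIn S a = {u, u', w} ∧ u ≠ u' ∧ c u = c u' := by
  obtain ⟨x, y, z, hxy, hxz, hyz, h⟩ := card_eq_three.1 h3
  have hne : ∀ v ∈ G.nbrIn S a, c v ≠ 0 := fun v hv h' =>
    hc a v (SimpleGraph.mem_nbrIn.1 hv).2 (ha.trans h'.symm)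
  have hx := hne x (by simp [h])
  have hy := hne y (by simp [h])
  have hz := hne z (by simp [h])
  have : c x = c y ∨ c x = c z ∨ c y = c z := by omega
  rcases this with e | e | e
  · exact ⟨x, y, z, h, hxy, e⟩
  · exact ⟨x, z, y, by rw [h, pair_comm y z], hxz, e⟩
  · exact ⟨y, z, x, by rw [h]; ext; simp; tauto, hyz, e⟩

end

section
variable {V : Type*} [DecidableEq V] {G : SimpleGraph V} {c : V → Fin 3}

open MvPolynomial in
lemma listColOn_of_few_edges [Finite V] (hc : ∀ u v, G.Adj u v → c u ≠ c v) {L : V → Finset ℕ}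
    (hL3 : ∀ v, c v = 0 → #(L v) = 3) (hL4 : ∀ v, c v ≠ 0 → #(L v) = 4) {S : Finset V}
    (hS : {v ∈ S | c v ≠ 0}.Nonempty) (ih : ∀ T ⊂ S, G.ListColOn L T)
    (hq : ∑ y ∈ S with c y = 1, #{z ∈ G.nbrIn S y | c z = 2} +
      (∑ a ∈ S with c a = 0 ∧ #(G.nbrIn S a) ≠ 3, #(G.nbrIn S a) +
        2 * #{a ∈ S | c a = 0 ∧ #(G.nbrIn S a) = 3}) ≤ 3 * #{v ∈ S | c v ≠ 0}) :
    G.ListColOn L S := by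
  classical
  set A3 := {a ∈ S | c a = 0 ∧ #(G.nbrIn S a) = 3} with hA3
  have hex : ∀ a, ∃ u u' w, a ∈ A3 → G.nbrIn S a = {u, u', w} ∧ u ≠ u' ∧ c u = c u' := by
    intro a
    by_cases ha : a ∈ A3
    · obtain ⟨-, h1, h2⟩ := mem_filter.1 ha
      obtain ⟨u, u', w, h⟩ := exists_repeated_colour hc h1 h2
      exact ⟨u, u', w, fun _ => h⟩
    · exact ⟨a, a, a, fun h => absurd h ha⟩
  choose u u' w huw using hex
  let I1 : Finset (Σ _ : V, V) := {y ∈ S | c y = 1}.sigma fun y => {z ∈ G.nbrIn S y | c z = 2}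
  let I2 : Finset (Σ _ : V, V) :=
    {a ∈ S | c a = 0 ∧ #(G.nbrIn S a) ≠ 3}.sigma fun a => G.nbrIn S a
  let I3 : Finset (V × Bool) := A3 ×ˢ univ
  let I := I1.disjSum (I2.disjSum I3)
  let N : (Σ _ : V, V) ⊕ ((Σ _ : V, V) ⊕ (V × Bool)) → Finset V :=
    Sum.elim (fun p => {p.1, p.2}) (Sum.elim (fun p => {p.2})
      (fun p => if p.2 then {u p.1, u' p.1, w p.1} else {u p.1, u' p.1}))
  obtain ⟨H, hHB, hHne, asg, hasg, hload⟩ := exists_subset_assignment I N (fun _ => 3)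
    {v ∈ S | c v ≠ 0} hS (by
    refine (card_filter_le _ _).trans ?_
    simp only [I, card_disjSum, I1, I2, I3, card_sigma, card_product, sum_const, smul_eq_mul]
    simp only [card_univ, Fintype.card_bool]
    omega)
  have hHS : H ⊆ S := hHB.trans (filter_subset _ _)
  have hH0 : ∀ v ∈ H, c v ≠ 0 := fun v hv => (mem_filter.1 (hHB hv)).2
  set AH := {a ∈ A3 | u a ∈ H ∨ u' a ∈ H} with hAH
  obtain ⟨φ₀, hφ₀L, hφ₀⟩ := ih ((S \ H) \ AH)
    (sdiff_subset.trans_ssubset (sdiff_ssubset hHS hHne))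
  let e : V → ℚ := fun v => if c v = 1 then 1 else -1
  have he : ∀ v, e v * e v = 1 := by
    intro v; simp only [e]; split_ifs <;> norm_num
  let k : V → ℚ := fun v => e v * φ₀ v
  let f1 : (Σ _ : V, V) → MvPolynomial V ℚ := fun p =>
    if p.1 ∈ H ∨ p.2 ∈ H then varOrConst H k p.1 + varOrConst H k p.2 else 1
  let lin : V → V → MvPolynomial V ℚ := fun a b =>
    if b ∈ H then MvPolynomial.X b - C (e b * φ₀ a) else 1
  let gad : V → MvPolynomial V ℚ := fun a => gadgetPoly H k (e (u a)) (e (w a))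
    (∑ i ∈ L a, (i : ℚ)) (((∑ i ∈ L a, (i : ℚ)) ^ 2 - ∑ i ∈ L a, (i : ℚ) ^ 2) / 2)
    (u a) (u' a) (w a)
  let h : V → MvPolynomial V ℚ := fun a =>
    if u a ∈ H ∨ u' a ∈ H then gad a else lin a (w a)
  let M : (Σ _ : V, V) ⊕ ((Σ _ : V, V) ⊕ (V × Bool)) → V →₀ ℕ := fun i =>
    if (N i ∩ H).Nonempty then Finsupp.single (asg i) 1 else 0
  have hMpos : ∀ i ∈ I, (N i ∩ H).Nonempty →
      M i = Finsupp.single (asg i) 1 ∧ asg i ∈ N i ∧ asg i ∈ H := by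
    intro i hi hne
    refine ⟨by simp only [M, hne, if_true], ?_⟩
    have := hasg i hi hne
    simpa using this
  have hMzero : ∀ i, ¬ (N i ∩ H).Nonempty → M i = 0 := by
    intro i hne
    simp only [M, hne, if_false]
  have hlin : ∀ a b, b ∈ H → PosTop (Finsupp.single b 1) (lin a b) := by
    intro a b hb
    simp only [lin, hb, if_true, sub_eq_add_neg]
    refine (PosTop.X b).add (NonnegTop.of_totalDegree_lt ?_)
    rw [totalDegree_neg, totalDegree_C]; simp
  have hf1 : ∀ p ∈ I1, PosTop (M (Sum.inl p)) (f1 p) := by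
    rintro ⟨y, z⟩ hp
    have hpI : Sum.inl ⟨y, z⟩ ∈ I := inl_mem_disjSum.2 hp
    by_cases hm : y ∈ H ∨ z ∈ H
    · have hne : (N (Sum.inl ⟨y, z⟩) ∩ H).Nonempty := by
        rcases hm with hm | hm
        · exact ⟨y, by simp [N, hm]⟩
        · exact ⟨z, by simp [N, hm]⟩
      obtain ⟨h1, h2, h3⟩ := hMpos _ hpI hne
      simp only [f1, hm, if_true]
      rw [h1]
      simp only [N, Sum.elim_inl, mem_insert, mem_singleton] at h2
      have hy := varOrConst_nonnegTop H k y
      have hz := varOrConst_nonnegTop H k z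
      rcases h2 with h2 | h2 <;> rw [h2] at h3 ⊢
      · exact (varOrConst_posTop k h3).add (by simpa using hz)
      · rw [add_comm]; exact (varOrConst_posTop k h3).add (by simpa using hy)
    · rw [hMzero]
      · simp only [f1, hm, if_false]; exact PosTop.one
      · rintro ⟨x, hx⟩
        simp only [N, Sum.elim_inl, mem_inter, mem_insert, mem_singleton] at hx
        rcases hx with ⟨rfl | rfl, hx⟩
        · exact hm (Or.inl hx)
        · exact hm (Or.inr hx)
  have hf2 : ∀ p ∈ I2, PosTop (M (Sum.inr (Sum.inl p))) (lin p.1 p.2) := by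
    rintro ⟨a, b⟩ hp
    have hpI : Sum.inr (Sum.inl ⟨a, b⟩) ∈ I := inr_mem_disjSum.2 (inl_mem_disjSum.2 hp)
    by_cases hb : b ∈ H
    · obtain ⟨h1, h2, h3⟩ := hMpos _ hpI ⟨b, by simp [N, hb]⟩
      rw [h1]
      simp only [N, Sum.elim_inl, Sum.elim_inr, mem_singleton] at h2
      rw [h2]
      exact hlin a b hb
    · rw [hMzero]
      · simp only [lin, hb, if_false]; exact PosTop.one
      · rintro ⟨x, hx⟩
        simp only [N, Sum.elim_inl, Sum.elim_inr, mem_inter, mem_singleton] at hx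
        exact hb (hx.1 ▸ hx.2)
  have hh : ∀ a ∈ A3, PosTop (∑ b : Bool, M (Sum.inr (Sum.inr (a, b)))) (h a) := by
    intro a ha
    have hpI : ∀ b, Sum.inr (Sum.inr (a, b)) ∈ I := fun b =>
      inr_mem_disjSum.2 (inr_mem_disjSum.2 (by simp [I3, ha]))
    rw [Fintype.sum_bool, add_comm]
    by_cases hm : u a ∈ H ∨ u' a ∈ H
    · simp only [h, hm, if_true]
      obtain ⟨h1, h2, h3⟩ := hMpos _ (hpI false) (by
        rcases hm with hm | hm
        · exact ⟨u a, by simp [N, hm]⟩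
        · exact ⟨u' a, by simp [N, hm]⟩)
      obtain ⟨h1', h2', h3'⟩ := hMpos _ (hpI true) (by
        rcases hm with hm | hm
        · exact ⟨u a, by simp [N, hm]⟩
        · exact ⟨u' a, by simp [N, hm]⟩)
      rw [h1, h1']
      refine gadgetPoly_posTop H k _ _ (he _) (he _) _ _ _ _ _ h3 ?_ h3' ?_
      · simpa [N] using h2
      · simpa [N] using h2'
    · simp only [h, hm, if_false]
      rw [hMzero (Sum.inr (Sum.inr (a, false))), zero_add]
      · by_cases hw : w a ∈ H
        · obtain ⟨h1', h2', h3'⟩ := hMpos _ (hpI true) ⟨w a, by simp [N, hw]⟩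
          rw [h1']
          have : asg (Sum.inr (Sum.inr (a, true))) = w a := by
            simp only [N, Sum.elim_inr, if_true, mem_insert, mem_singleton] at h2'
            rcases h2' with h | h | h
            · exact absurd (Or.inl (h ▸ h3')) hm
            · exact absurd (Or.inr (h ▸ h3')) hm
            · exact h
          rw [this]
          exact hlin a _ hw
        · rw [hMzero]
          · simp only [lin, hw, if_false]; exact PosTop.one
          · rintro ⟨x, hx⟩
            simp only [N, Sum.elim_inr, if_true, mem_inter, mem_insert, mem_singleton] at hx
            rcases hx with ⟨rfl | rfl | rfl, hx⟩
            · exact hm (Or.inl hx)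
            · exact hm (Or.inr hx)
            · exact hw hx
      · rintro ⟨x, hx⟩
        simp only [N, Sum.elim_inr, mem_inter] at hx
        simp only [Bool.false_eq_true, if_false, mem_insert, mem_singleton] at hx
        rcases hx with ⟨rfl | rfl, hx⟩
        · exact hm (Or.inl hx)
        · exact hm (Or.inr hx)
  have hF : PosTop (∑ i ∈ I, M i)
      ((∏ p ∈ I1, f1 p) * ((∏ p ∈ I2, lin p.1 p.2) * ∏ a ∈ A3, h a)) := by
    simp only [I, sum_disjSum]
    refine (PosTop.prod _ _ _ hf1).mul ((PosTop.prod _ _ _ hf2).mul ?_)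
    simp only [I3, sum_product]
    exact PosTop.prod _ _ _ hh
  have hMv : ∀ v, (∑ i ∈ I, M i) v = #{i ∈ I | (N i ∩ H).Nonempty ∧ asg i = v} := by
    intro v
    rw [Finsupp.finsetSum_apply, card_filter]
    refine sum_congr rfl fun i _ => ?_
    simp only [M]
    by_cases h1 : (N i ∩ H).Nonempty <;> by_cases h2 : asg i = v <;> simp [h1, h2]
  have hMH : ∀ v, v ∉ H → (∑ i ∈ I, M i) v = 0 := by
    intro v hv
    rw [hMv, card_eq_zero, filter_eq_empty_iff]
    rintro i hi ⟨h1, h2⟩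
    exact hv (h2 ▸ (hMpos i hi h1).2.2)
  have hinj : ∀ v, Function.Injective fun n : ℕ => e v * (n : ℚ) := by
    intro v a b hab
    have hab : e v * (a : ℚ) = e v * b := hab
    have : (a : ℚ) = b := by linear_combination e v * hab - (a - b) * he v
    exact_mod_cast this
  obtain ⟨z, hz, hne⟩ := hF.exists_eval_ne_zero
    (fun v => (L v).image fun n : ℕ => e v * (n : ℚ)) (by
      intro v
      rw [card_image_of_injective _ (hinj v)]
      by_cases hv : v ∈ H
      · rw [hL4 v (hH0 v hv), hMv]
        exact Nat.lt_succ_of_le (hload v)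
      · rw [hMH v hv]
        by_cases h0 : c v = 0
        · rw [hL3 v h0]; norm_num
        · rw [hL4 v h0]; norm_num)
  have hz' : ∀ v, ∃ n ∈ L v, e v * (n : ℚ) = z v := fun v => by simpa using hz v
  choose φ₁ hφ₁L hφ₁ using hz'
  simp only [map_mul, map_prod, mul_ne_zero_iff, prod_ne_zero_iff] at hne
  obtain ⟨hn1, hn2, hn3⟩ := hne
  let col : V → ℕ := fun v => if v ∈ H then φ₁ v else φ₀ v
  have hcol : ∀ v, eval z (varOrConst H k v) = e v * col v := by
    intro v
    by_cases hv : v ∈ H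
    · simp [varOrConst, col, hv, hφ₁]
    · simp [varOrConst, col, hv, k]
  have hcol' : ∀ v, e v * eval z (varOrConst H k v) = col v := by
    intro v
    rw [hcol, ← mul_assoc, he, one_mul]
  have hlinne : ∀ a b, b ∈ H → eval z (lin a b) ≠ 0 → φ₀ a ≠ φ₁ b := by
    intro a b hb h0 heq
    apply h0
    simp only [lin, hb, if_true, map_sub, eval_X, eval_C, ← hφ₁, heq, sub_self]
  have hnew : ∀ a, ∃ i, a ∈ AH → i ∈ L a ∧ ∀ v ∈ G.nbrIn S a, i ≠ col v := by
    intro a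
    by_cases ha : a ∈ AH
    · obtain ⟨ha3, hm⟩ := mem_filter.1 ha
      obtain ⟨-, ha0, -⟩ := mem_filter.1 ha3
      have h1 := hn3 a ha3
      simp only [h, hm, if_true] at h1
      have heu : e (u' a) = e (u a) := by simp only [e, (huw a ha3).2.2]
      obtain ⟨i, hi, h1, h2, h3⟩ := exists_mem_list_of_eval_gadgetPoly H k _ _ (L a) (hL3 a ha0)
        (u a) (u' a) (w a) z col (hcol' _) (by rw [← heu]; exact hcol' _) (hcol' _) h1
      refine ⟨i, fun _ => ⟨hi, fun v hv => ?_⟩⟩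
      rw [(huw a ha3).1] at hv
      simp only [mem_insert, mem_singleton] at hv
      rcases hv with rfl | rfl | rfl <;> assumption
    · exact ⟨0, fun h => absurd h ha⟩
  choose new hnewL using hnew
  have hAH0 : ∀ a ∈ AH, c a = 0 := fun a ha => (mem_filter.1 (mem_filter.1 ha).1).2.1
  let φ : V → ℕ := fun v => if v ∈ AH then new v else col v
  have hφAH : ∀ v, v ∈ AH → φ v = new v := fun v hv => by simp only [φ, hv, if_true]
  have hφcol : ∀ v, v ∉ AH → φ v = col v := fun v hv => by simp only [φ, hv, if_false]
  have hφB : ∀ v, c v ≠ 0 → φ v = col v := fun v hv => hφcol v fun h => hv (hAH0 v h)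
  have hcolH : ∀ v, v ∈ H → col v = φ₁ v := fun v hv => by simp only [col, hv, if_true]
  have hcolW : ∀ v, v ∉ H → col v = φ₀ v := fun v hv => by simp only [col, hv, if_false]
  have hXB : ∀ a ∈ S, ∀ b ∈ S, G.Adj a b → c a = 0 → φ a ≠ φ b := by
    intro a ha b hb hab ha0
    have hb0 : c b ≠ 0 := fun h => hc a b hab (ha0.trans h.symm)
    have haH : a ∉ H := fun h => hH0 a h ha0
    rw [hφB b hb0]
    by_cases haA : a ∈ AH
    · rw [hφAH a haA]
      exact (hnewL a haA).2 b (SimpleGraph.mem_nbrIn.2 ⟨hb, hab⟩)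
    · rw [hφcol a haA, hcolW a haH]
      by_cases hbH : b ∈ H
      · rw [hcolH b hbH]
        apply hlinne a b hbH
        by_cases ha3 : #(G.nbrIn S a) = 3
        · have haA3 : a ∈ A3 := mem_filter.2 ⟨ha, ha0, ha3⟩
          have hnm : ¬ (u a ∈ H ∨ u' a ∈ H) := fun hm => haA (mem_filter.2 ⟨haA3, hm⟩)
          have hbm : b ∈ G.nbrIn S a := SimpleGraph.mem_nbrIn.2 ⟨hb, hab⟩
          have h1 := hn3 a haA3
          simp only [h, hnm, if_false] at h1
          rw [(huw a haA3).1] at hbm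
          simp only [mem_insert, mem_singleton] at hbm
          rcases hbm with rfl | rfl | rfl
          · exact absurd (Or.inl hbH) hnm
          · exact absurd (Or.inr hbH) hnm
          · exact h1
        · exact hn2 ⟨a, b⟩ (mem_sigma.2 ⟨mem_filter.2 ⟨ha, ha0, ha3⟩,
            SimpleGraph.mem_nbrIn.2 ⟨hb, hab⟩⟩)
      · rw [hcolW b hbH]
        refine hφ₀ a ?_ b ?_ hab
        · exact mem_sdiff.2 ⟨mem_sdiff.2 ⟨ha, haH⟩, haA⟩
        · exact mem_sdiff.2 ⟨mem_sdiff.2 ⟨hb, hbH⟩, fun h => hb0 (hAH0 b h)⟩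
  have hYZ : ∀ y ∈ S, ∀ x ∈ S, G.Adj y x → c y = 1 → c x = 2 → φ y ≠ φ x := by
    intro y hy x hx hyx hcy hcx
    have hy0 : c y ≠ 0 := by rw [hcy]; decide
    have hx0 : c x ≠ 0 := by rw [hcx]; decide
    rw [hφB y hy0, hφB x hx0]
    by_cases hm : y ∈ H ∨ x ∈ H
    · have h1 := hn1 ⟨y, x⟩ (mem_sigma.2 ⟨mem_filter.2 ⟨hy, hcy⟩, mem_filter.2
        ⟨SimpleGraph.mem_nbrIn.2 ⟨hx, hyx⟩, hcx⟩⟩)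
      simp only [f1, hm, if_true, map_add, hcol] at h1
      intro heq
      apply h1
      have e1 : e y = 1 := by simp [e, hcy]
      have e2 : e x = -1 := by simp [e, hcx]
      rw [e1, e2, heq]; ring
    · push Not at hm
      rw [hcolW y hm.1, hcolW x hm.2]
      refine hφ₀ y ?_ x ?_ hyx
      · exact mem_sdiff.2 ⟨mem_sdiff.2 ⟨hy, hm.1⟩, fun h => hy0 (hAH0 y h)⟩
      · exact mem_sdiff.2 ⟨mem_sdiff.2 ⟨hx, hm.2⟩, fun h => hx0 (hAH0 x h)⟩
  refine ⟨φ, ?_, ?_⟩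
  · intro v hv
    by_cases hvA : v ∈ AH
    · rw [hφAH v hvA]; exact (hnewL v hvA).1
    · rw [hφcol v hvA]
      by_cases hvH : v ∈ H
      · rw [hcolH v hvH]; exact hφ₁L v
      · rw [hcolW v hvH]; exact hφ₀L v (mem_sdiff.2 ⟨mem_sdiff.2 ⟨hv, hvH⟩, hvA⟩)
  · intro x hx y hy hxy
    have hne := hc x y hxy
    by_cases hx0 : c x = 0
    · exact hXB x hx y hy hxy hx0
    by_cases hy0 : c y = 0
    · exact (hXB y hy x hx hxy.symm hy0).symm
    have : (c x = 1 ∧ c y = 2) ∨ (c y = 1 ∧ c x = 2) := by omega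
    rcases this with ⟨h1, h2⟩ | ⟨h1, h2⟩
    · exact hYZ x hx y hy hxy h1 h2
    · exact (hYZ y hy x hx hxy.symm h1 h2).symm

end

lemma sum_card_nbrIn_filter_comm {V : Type*} (G : SimpleGraph V) (S : Finset V) (P Q : V → Prop)
    [DecidablePred P] [DecidablePred Q] :
    ∑ u ∈ S with P u, #{v ∈ G.nbrIn S u | Q v} = ∑ v ∈ S with Q v, #{u ∈ G.nbrIn S v | P u} := by
  classical
  have h : ∀ (P Q : V → Prop) [DecidablePred P] [DecidablePred Q] (u : V),
      {v ∈ G.nbrIn S u | Q v} = {v ∈ {v ∈ S | Q v} | G.Adj u v} := by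
    intro P Q _ _ u
    ext v
    simp only [mem_filter, SimpleGraph.mem_nbrIn]
    tauto
  simp only [h P Q, h Q P]
  have := sum_card_bipartiteAbove_eq_sum_card_bipartiteBelow (s := {u ∈ S | P u})
    (t := {v ∈ S | Q v}) (fun u v => G.Adj u v)
  simp only [bipartiteAbove, bipartiteBelow] at this
  rw [this]
  simp only [G.adj_comm]

section
variable {V : Type*} [DecidableEq V] {G : SimpleGraph V} {c : V → Fin 3}

/-- A properly `3`-coloured graph in which every induced subgraph on `n` vertices has at most `2n`
edges is colourable from lists of size `3` on the first colour class and `4` elsewhere. -/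
theorem listColOn_of_sparse [Finite V] (hc : ∀ u v, G.Adj u v → c u ≠ c v)
    (hsp : ∀ S, G.dartsIn S ≤ 4 * #S) {L : V → Finset ℕ}
    (hL3 : ∀ v, c v = 0 → #(L v) = 3) (hL4 : ∀ v, c v ≠ 0 → #(L v) = 4) (S : Finset V) :
    G.ListColOn L S := by
  induction S using Finset.strongInduction with
  | H S ih =>
    rcases S.eq_empty_or_nonempty with rfl | hS
    · exact ⟨fun _ => 0, by simp, by simp⟩
    by_cases hlow : ∃ a ∈ S, c a = 0 ∧ #(G.nbrIn S a) < 3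
    · obtain ⟨a, ha, ha0, hd⟩ := hlow
      obtain ⟨φ, hφL, hφ⟩ := ih (S.erase a) (erase_ssubset ha)
      obtain ⟨i, hi, hni⟩ : ∃ i ∈ L a, i ∉ (G.nbrIn S a).image φ := by
        apply exists_mem_notMem_of_card_lt_card
        rw [hL3 a ha0]
        exact card_image_le.trans_lt hd
      have hni' : ∀ v ∈ S, G.Adj a v → i ≠ φ v := fun v hv hav h =>
        hni (mem_image.2 ⟨v, SimpleGraph.mem_nbrIn.2 ⟨hv, hav⟩, h.symm⟩)
      refine ⟨fun v => if v = a then i else φ v, ?_, ?_⟩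
      · intro v hv
        by_cases hva : v = a
        · simp only [hva, if_true]; exact hi
        · simp only [hva, if_false]; exact hφL v (mem_erase.2 ⟨hva, hv⟩)
      · intro u hu v hv huv
        by_cases hua : u = a <;> by_cases hva : v = a <;> simp only [hua, hva, if_true, if_false]
        · exact absurd (hua.trans hva.symm) huv.ne
        · exact hni' v hv (hua ▸ huv)
        · exact (hni' u hu (hva ▸ huv.symm)).symm
        · exact hφ u (mem_erase.2 ⟨hua, hu⟩) v (mem_erase.2 ⟨hva, hv⟩) huv
    push Not at hlow
    by_cases hq : ∑ b ∈ S with c b ≠ 0, #(G.nbrIn S b) ≤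
      2 * #{v ∈ S | c v = 0} + 3 * #{v ∈ S | c v ≠ 0}
    · exact listColOn_of_few_darts hc hL3 hL4 hS ih hq
    have hdarts : ∑ a ∈ S with c a = 0, #(G.nbrIn S a) + ∑ b ∈ S with c b ≠ 0, #(G.nbrIn S b) =
        G.dartsIn S := sum_filter_add_sum_filter_not _ _ _
    have hcard : #{v ∈ S | c v = 0} + #{v ∈ S | c v ≠ 0} = #S :=
      card_filter_add_card_filter_not _
    have hspS := hsp S
    have hB : {v ∈ S | c v ≠ 0}.Nonempty := by
      by_contra h
      rw [not_nonempty_iff_eq_empty] at h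
      rw [h] at hq
      simp at hq
    have hsplit : ∑ b ∈ S with c b ≠ 0, #(G.nbrIn S b) =
        ∑ b ∈ S with c b ≠ 0, #{v ∈ G.nbrIn S b | c v = 0} +
        (∑ b ∈ S with c b = 1, #{v ∈ G.nbrIn S b | c v = 2} +
        ∑ b ∈ S with c b = 2, #{v ∈ G.nbrIn S b | c v = 1}) := by
      have h1 : ∑ b ∈ S with c b = 1, #{v ∈ G.nbrIn S b | c v = 2} =
          ∑ b ∈ S with c b = 1, #{v ∈ G.nbrIn S b | c v ≠ 0} := by
        refine sum_congr rfl fun b hb => ?_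
        congr 1
        refine filter_congr fun v hv => ?_
        have := hc b v (SimpleGraph.mem_nbrIn.1 hv).2
        have := (mem_filter.1 hb).2
        omega
      have h2 : ∑ b ∈ S with c b = 2, #{v ∈ G.nbrIn S b | c v = 1} =
          ∑ b ∈ S with c b = 2, #{v ∈ G.nbrIn S b | c v ≠ 0} := by
        refine sum_congr rfl fun b hb => ?_
        congr 1
        refine filter_congr fun v hv => ?_
        have := hc b v (SimpleGraph.mem_nbrIn.1 hv).2
        have := (mem_filter.1 hb).2
        omega
      have h3 : {b ∈ S | c b ≠ 0} = {b ∈ S | c b = 1} ∪ {b ∈ S | c b = 2} := by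
        ext b
        simp only [mem_filter, mem_union]
        have : c b ≠ 0 ↔ c b = 1 ∨ c b = 2 := by omega
        tauto
      have h4 : Disjoint {b ∈ S | c b = 1} {b ∈ S | c b = 2} := by
        rw [disjoint_filter]
        intro b _ h; rw [h]; decide
      rw [h1, h2, ← sum_union h4, ← h3, ← sum_add_distrib]
      refine sum_congr rfl fun b _ => ?_
      exact (card_filter_add_card_filter_not _).symm
    have hp : ∑ b ∈ S with c b ≠ 0, #{v ∈ G.nbrIn S b | c v = 0} =
        ∑ a ∈ S with c a = 0, #(G.nbrIn S a) := by
      rw [sum_card_nbrIn_filter_comm]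
      refine sum_congr rfl fun a ha => ?_
      congr 1
      refine filter_true_of_mem fun v hv h => ?_
      exact hc a v (SimpleGraph.mem_nbrIn.1 hv).2 ((mem_filter.1 ha).2.trans h.symm)
    have hyz := sum_card_nbrIn_filter_comm G S (fun v => c v = 1) (fun v => c v = 2)
    have hX : ∑ a ∈ S with c a = 0 ∧ #(G.nbrIn S a) ≠ 3, #(G.nbrIn S a) +
        2 * #{a ∈ S | c a = 0 ∧ #(G.nbrIn S a) = 3} + 4 * #{v ∈ S | c v = 0} ≤
        2 * ∑ a ∈ S with c a = 0, #(G.nbrIn S a) := by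
      simp only [card_filter, sum_filter, mul_sum, ← sum_add_distrib]
      refine sum_le_sum fun a ha => ?_
      have := hlow a ha
      by_cases h0 : c a = 0 <;> by_cases h3 : #(G.nbrIn S a) = 3
      · simp [h0, h3]
      · have := this h0
        simp only [h0, h3, ne_eq, not_false_eq_true, and_self, and_false, if_true, if_false]
        omega
      · simp [h0]
      · simp [h0]
    refine listColOn_of_few_edges hc hL3 hL4 hB ih ?_
    omega

end

section
variable {V : Type*} [DecidableEq V] (G : SimpleGraph V)

omit [DecidableEq V] in
lemma sum_card_nbrIn_comm (A B : Finset V) :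
    ∑ a ∈ A, #(G.nbrIn B a) = ∑ b ∈ B, #(G.nbrIn A b) := by
  classical
  have := sum_card_bipartiteAbove_eq_sum_card_bipartiteBelow (s := A) (t := B)
    (fun u v => G.Adj u v)
  simp only [bipartiteAbove, bipartiteBelow] at this
  have h : ∀ (B : Finset V) (a : V), G.nbrIn B a = {v ∈ B | G.Adj a v} := by
    intro B a; ext v; simp
  simp only [h, this, G.adj_comm]

lemma card_nbrIn_union {A B : Finset V} (h : Disjoint A B) (v : V) :
    #(G.nbrIn (A ∪ B) v) = #(G.nbrIn A v) + #(G.nbrIn B v) := by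
  rw [← card_union_of_disjoint]
  · congr 1; ext w; simp only [SimpleGraph.mem_nbrIn, mem_union]; tauto
  · rw [disjoint_left] at h ⊢
    intro w hA hB
    exact h (SimpleGraph.mem_nbrIn.1 hA).1 (SimpleGraph.mem_nbrIn.1 hB).1

lemma dartsIn_union {A B : Finset V} (h : Disjoint A B) :
    G.dartsIn (A ∪ B) = G.dartsIn A + G.dartsIn B + 2 * ∑ a ∈ A, #(G.nbrIn B a) := by
  unfold SimpleGraph.dartsIn
  rw [sum_union h]
  simp only [card_nbrIn_union G h, sum_add_distrib]
  rw [← sum_card_nbrIn_comm G A B]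
  ring

omit [DecidableEq V] in
lemma nbrIn_singleton_self (v : V) : G.nbrIn {v} v = ∅ := by
  ext w
  simp only [SimpleGraph.mem_nbrIn, mem_singleton, notMem_empty, iff_false, not_and]
  rintro rfl
  exact G.loopless.irrefl _

lemma dartsIn_insert {S : Finset V} {v : V} (h : v ∉ S) :
    G.dartsIn (insert v S) = G.dartsIn S + 2 * #(G.nbrIn S v) := by
  rw [insert_eq, dartsIn_union G (by simpa using h)]
  have : G.dartsIn {v} = 0 := by
    simp [SimpleGraph.dartsIn, nbrIn_singleton_self]
  rw [this]; simp

lemma even_dartsIn (S : Finset V) : Even (G.dartsIn S) := by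
  induction S using Finset.induction_on with
  | empty => simp [SimpleGraph.dartsIn]
  | insert a s ha ih =>
    rw [dartsIn_insert G ha]
    exact ih.add (even_two_mul _)

/-- The Kostochka–Yancey potential `5n - 3e` of the subgraph induced on `S`. -/
noncomputable def SimpleGraph.potential (S : Finset V) : ℤ :=
  5 * #S - 3 * (G.dartsIn S / 2 : ℕ)

lemma two_mul_potential (S : Finset V) :
    2 * G.potential S = 10 * #S - 3 * G.dartsIn S := by
  obtain ⟨k, hk⟩ := even_dartsIn G S
  unfold SimpleGraph.potential
  omega

lemma potential_union {A B : Finset V} (h : Disjoint A B) :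
    G.potential (A ∪ B) = G.potential A + G.potential B - 3 * (∑ a ∈ A, #(G.nbrIn B a) : ℕ) := by
  have h1 := two_mul_potential G (A ∪ B)
  have h2 := two_mul_potential G A
  have h3 := two_mul_potential G B
  rw [dartsIn_union G h, card_union_of_disjoint h] at h1
  generalize ∑ a ∈ A, #(G.nbrIn B a) = k at *
  push_cast at h1
  omega

lemma potential_insert {S : Finset V} {v : V} (h : v ∉ S) :
    G.potential (insert v S) = G.potential S + 5 - 3 * #(G.nbrIn S v) := by
  have h1 := two_mul_potential G (insert v S)
  have h2 := two_mul_potential G S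
  rw [dartsIn_insert G h, card_insert_of_notMem h] at h1
  push_cast at h1
  omega

omit [DecidableEq V] in
lemma card_nbrIn_lt {S : Finset V} {v : V} (h : v ∈ S) : #(G.nbrIn S v) < #S := by
  apply card_lt_card
  refine ⟨fun w hw => (SimpleGraph.mem_nbrIn.1 hw).1, fun hsub => ?_⟩
  exact G.loopless.irrefl _ (SimpleGraph.mem_nbrIn.1 (hsub h)).2

omit [DecidableEq V] in
lemma dartsIn_le (S : Finset V) : G.dartsIn S ≤ #S * (#S - 1) := by
  unfold SimpleGraph.dartsIn
  rw [← smul_eq_mul]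
  exact sum_le_card_nsmul _ _ _ fun v hv => Nat.le_sub_one_of_lt (card_nbrIn_lt G hv)

lemma SimpleGraph.ThreeColOn.mono {V : Type*} {G G' : SimpleGraph V} {S T : Finset V}
    (hG : ∀ u ∈ T, ∀ v ∈ T, G'.Adj u v → G.Adj u v) (h : T ⊆ S) (hS : G.ThreeColOn S) :
    G'.ThreeColOn T := by
  obtain ⟨f, hf⟩ := hS
  exact ⟨f, fun u hu v hv huv => hf u (h hu) v (h hv) (hG u hu v hv huv)⟩

/-- Given a `3`-colouring `φ`, add a triangle on the colours, the vertex `i` of which takes over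
the adjacencies of the vertices of `R` coloured `i`. -/
def SimpleGraph.addColourTriangle (R : Finset V) (φ : V → Fin 3) : SimpleGraph (V ⊕ Fin 3) where
  Adj
    | .inl u, .inl v => G.Adj u v
    | .inl w, .inr i => ∃ r ∈ R, φ r = i ∧ G.Adj r w
    | .inr i, .inl w => ∃ r ∈ R, φ r = i ∧ G.Adj r w
    | .inr i, .inr j => i ≠ j
  symm := ⟨by
    rintro (u | i) (v | j) h
    · exact SimpleGraph.Adj.symm h
    · exact h
    · exact h
    · exact Ne.symm h⟩
  loopless := ⟨by
    rintro (u | i) h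
    · exact G.loopless.irrefl _ h
    · exact h rfl⟩

/-- The colours of the neighbours of `w` inside `R`. -/
noncomputable def coloursSeen (R : Finset V) (φ : V → Fin 3) (w : V) : Finset (Fin 3) :=
  (G.nbrIn R w).image φ

omit [DecidableEq V] in
lemma addColourTriangle_nbrIn_inl (R : Finset V) (φ : V → Fin 3) (A : Finset V)
    (X : Finset (Fin 3)) (u : V) :
    #((G.addColourTriangle R φ).nbrIn (A.disjSum X) (.inl u)) =
      #(G.nbrIn A u) + #(X ∩ coloursSeen G R φ u) := by
  rw [← card_disjSum]
  congr 1
  ext (v | i)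
  · simp [SimpleGraph.addColourTriangle]
  · simp only [SimpleGraph.mem_nbrIn, inr_mem_disjSum, SimpleGraph.addColourTriangle, mem_inter,
      coloursSeen, mem_image]
    refine and_congr_right fun _ => exists_congr fun r => ?_
    rw [G.adj_comm]; tauto

omit [DecidableEq V] in
lemma addColourTriangle_nbrIn_inr (R : Finset V) (φ : V → Fin 3) (A : Finset V)
    (X : Finset (Fin 3)) (i : Fin 3) :
    #((G.addColourTriangle R φ).nbrIn (A.disjSum X) (.inr i)) =
      #{u ∈ A | i ∈ coloursSeen G R φ u} + #(X.erase i) := by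
  rw [← card_disjSum]
  congr 1
  ext (v | j)
  · simp only [SimpleGraph.mem_nbrIn, inl_mem_disjSum, SimpleGraph.addColourTriangle, mem_filter]
    simp only [coloursSeen, mem_image, SimpleGraph.mem_nbrIn]
    refine and_congr_right fun _ => exists_congr fun r => ?_
    rw [G.adj_comm]; tauto
  · simp only [SimpleGraph.mem_nbrIn, inr_mem_disjSum, SimpleGraph.addColourTriangle, mem_erase]
    tauto

omit [DecidableEq V] in
lemma addColourTriangle_dartsIn (R : Finset V) (φ : V → Fin 3) (A : Finset V)
    (X : Finset (Fin 3)) :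
    (G.addColourTriangle R φ).dartsIn (A.disjSum X) =
      G.dartsIn A + 2 * ∑ w ∈ A, #(X ∩ coloursSeen G R φ w) + #X * (#X - 1) := by
  have h : ∑ i ∈ X, #{u ∈ A | i ∈ coloursSeen G R φ u} =
      ∑ w ∈ A, #(X ∩ coloursSeen G R φ w) := by
    have := sum_card_bipartiteAbove_eq_sum_card_bipartiteBelow (s := X) (t := A)
      (fun i u => i ∈ coloursSeen G R φ u)
    simp only [bipartiteAbove, bipartiteBelow] at this
    rw [this]
    simp only [filter_mem_eq_inter]
  have h2 : ∑ i ∈ X, #(X.erase i) = #X * (#X - 1) := by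
    rw [← smul_eq_mul, ← sum_const]
    exact sum_congr rfl fun i hi => card_erase_of_mem hi
  unfold SimpleGraph.dartsIn
  rw [sum_disjSum]
  simp only [addColourTriangle_nbrIn_inl, addColourTriangle_nbrIn_inr, sum_add_distrib, h, h2]
  ring

lemma threeColOn_of_addColourTriangle {R S : Finset V} {φ : V → Fin 3}
    (hφ : ∀ u ∈ R, ∀ v ∈ R, G.Adj u v → φ u ≠ φ v)
    (h : (G.addColourTriangle R φ).ThreeColOn ((S \ R).disjSum univ)) : G.ThreeColOn S := by
  obtain ⟨g, hg⟩ := h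
  have hmix : ∀ u ∈ R, ∀ v ∈ S, v ∉ R → G.Adj u v → g (.inr (φ u)) ≠ g (.inl v) := by
    intro u hu v hv hvR huv
    refine hg (.inr (φ u)) (by simp) (.inl v) (by simp [hv, hvR]) ?_
    exact ⟨u, hu, rfl, huv⟩
  refine ⟨fun v => if v ∈ R then g (.inr (φ v)) else g (.inl v), ?_⟩
  intro u hu v hv huv
  by_cases huR : u ∈ R <;> by_cases hvR : v ∈ R <;> simp only [huR, hvR, if_true, if_false]
  · refine hg (.inr (φ u)) (by simp) (.inr (φ v)) (by simp) ?_
    exact hφ u huR v hvR huv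
  · exact hmix u huR v hv hvR huv
  · exact (hmix v hvR u hu huR huv.symm).symm
  · refine hg (.inl u) (by simp [hu, huR]) (.inl v) (by simp [hv, hvR]) ?_
    exact huv

end

/-- A minimal counterexample to the Kostochka–Yancey bound for `4`-critical graphs. -/
structure IsMinCounterexample {V : Type} (G : SimpleGraph V) (S : Finset V) : Prop where
  not_col : ¬ G.ThreeColOn S
  col_of_ssubset : ∀ T ⊂ S, G.ThreeColOn T
  smaller : ∀ (V' : Type) (G' : SimpleGraph V') (S' : Finset V'), #S' < #S → ¬ G'.ThreeColOn S' →
    ∃ W ⊆ S', ¬ G'.ThreeColOn W ∧ G'.potential W ≤ 2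
  potential_ge : 3 ≤ G.potential S

namespace IsMinCounterexample
variable {V : Type} [DecidableEq V] {G : SimpleGraph V} {S : Finset V}

lemma three_le_card_nbrIn (hS : IsMinCounterexample G S) {v : V} (hv : v ∈ S) :
    3 ≤ #(G.nbrIn S v) := by
  by_contra! hlt
  obtain ⟨f, hf⟩ := hS.col_of_ssubset (S.erase v) (erase_ssubset hv)
  obtain ⟨i, -, hi⟩ : ∃ i ∈ (univ : Finset (Fin 3)), i ∉ (G.nbrIn S v).image f := by
    apply exists_mem_notMem_of_card_lt_card
    exact card_image_le.trans_lt (by simpa using hlt)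
  have hi' : ∀ w ∈ S, G.Adj v w → i ≠ f w := fun w hw hvw h =>
    hi (mem_image.2 ⟨w, SimpleGraph.mem_nbrIn.2 ⟨hw, hvw⟩, h.symm⟩)
  apply hS.not_col
  refine ⟨fun w => if w = v then i else f w, ?_⟩
  intro a ha b hb hab
  by_cases hav : a = v <;> by_cases hbv : b = v <;> simp only [hav, hbv, if_true, if_false]
  · exact absurd (hav.trans hbv.symm) hab.ne
  · exact hi' b hb (hav ▸ hab)
  · exact (hi' a ha (hbv ▸ hab.symm)).symm
  · exact hf a (mem_erase.2 ⟨hav, ha⟩) b (mem_erase.2 ⟨hbv, hb⟩) hab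

/-- Replacing a coloured proper subset `R` by a triangle yields a non-colourable subgraph of low
potential. -/
lemma exists_replacement (hS : IsMinCounterexample G S) {R : Finset V} (hR : R ⊂ S)
    (h4 : 4 ≤ #R) {φ : V → Fin 3} (hφ : ∀ u ∈ R, ∀ v ∈ R, G.Adj u v → φ u ≠ φ v) :
    ∃ A ⊆ S \ R, ∃ X : Finset (Fin 3), 5 ≤ 5 * #X - 3 * (#X * (#X - 1) / 2) ∧
      (5 * #X - 3 * (#X * (#X - 1) / 2) ≤ 5 → #X = 1) ∧
      G.potential A + (5 * #X - 3 * (#X * (#X - 1) / 2) : ℕ) -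
        3 * (∑ w ∈ A, #(X ∩ coloursSeen G R φ w) : ℕ) ≤ 2 := by
  obtain ⟨W, hWT, hW, hWp⟩ := hS.smaller (V ⊕ Fin 3) (G.addColourTriangle R φ)
    ((S \ R).disjSum univ) (by
      rw [card_disjSum, card_sdiff_of_subset hR.1]
      have := card_le_card hR.1
      simp only [card_univ, Fintype.card_fin]
      omega) (fun h => hS.not_col (threeColOn_of_addColourTriangle G hφ h))
  rw [← toLeft_disjSum_toRight (u := W)] at hW hWp hWT
  set A := W.toLeft
  set X := W.toRight
  have hA : A ⊆ S \ R := by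
    intro v hv
    have := hWT (inl_mem_disjSum.2 hv)
    exact inl_mem_disjSum.1 this
  have hRne : R.Nonempty := card_pos.1 (by omega)
  have hX : X.Nonempty := by
    by_contra h
    rw [not_nonempty_iff_eq_empty] at h
    rw [h] at hW
    apply hW
    obtain ⟨f, hf⟩ := hS.col_of_ssubset A (hA.trans_ssubset (sdiff_ssubset hR.1 hRne))
    refine ⟨Sum.elim f fun _ => 0, ?_⟩
    rintro (u | i) hu (v | j) hv huv
    · exact hf u (inl_mem_disjSum.1 hu) v (inl_mem_disjSum.1 hv) huv
    · simp at hv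
    · simp at hu
    · simp at hu
  have hX1 := card_pos.2 hX
  have hX3 : #X ≤ 3 := by simpa using card_le_univ X
  have hp := two_mul_potential (G.addColourTriangle R φ) (A.disjSum X)
  have hp' := two_mul_potential G A
  rw [addColourTriangle_dartsIn, card_disjSum] at hp
  refine ⟨A, hA, X, ?_, ?_, ?_⟩ <;> generalize ∑ w ∈ A, #(X ∩ coloursSeen G R φ w) = k at * <;>
    generalize #X = x at * <;> interval_cases x <;> norm_num at hp ⊢ <;> omega

lemma six_le_potential_of_card_le {R : Finset V} (h2 : 2 ≤ #R) (h3 : #R ≤ 3) :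
    6 ≤ G.potential R := by
  have h := dartsIn_le G R
  have hp := two_mul_potential G R
  generalize #R = r at *
  interval_cases r <;> norm_num at h hp <;> omega

omit [DecidableEq V] in
lemma card_inter_coloursSeen_le (X : Finset (Fin 3)) (R : Finset V) (φ : V → Fin 3) (w : V) :
    #(X ∩ coloursSeen G R φ w) ≤ #(G.nbrIn R w) :=
  (card_le_card inter_subset_right).trans card_image_le

lemma six_le_potential (hS : IsMinCounterexample G S) {R : Finset V} (hR : R ⊂ S) (h2 : 2 ≤ #R) :
    6 ≤ G.potential R := by
  by_contra! hlt
  have h4 : 4 ≤ #R := by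
    by_contra! h
    have := six_le_potential_of_card_le (G := G) h2 (by omega)
    omega
  obtain ⟨Q, hQ, hmin⟩ := exists_min_image {Q ∈ S.ssubsets | 4 ≤ #Q} G.potential
    ⟨R, mem_filter.2 ⟨mem_ssubsets.2 hR, h4⟩⟩
  obtain ⟨hQS, hQ4⟩ := mem_filter.1 hQ
  rw [mem_ssubsets] at hQS
  have hQR := hmin R (mem_filter.2 ⟨mem_ssubsets.2 hR, h4⟩)
  obtain ⟨φ, hφ⟩ := hS.col_of_ssubset Q hQS
  obtain ⟨A, hA, X, hX, -, hp⟩ := hS.exists_replacement hQS hQ4 hφ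
  have hdis : Disjoint A Q := disjoint_of_subset_left hA sdiff_disjoint
  have hu := potential_union G hdis
  have hle : ∑ w ∈ A, #(X ∩ coloursSeen G Q φ w) ≤ ∑ w ∈ A, #(G.nbrIn Q w) :=
    sum_le_sum fun w _ => card_inter_coloursSeen_le X Q φ w
  have hsub : A ∪ Q ⊆ S := union_subset (hA.trans sdiff_subset) hQS.1
  have hlow : G.potential (A ∪ Q) ≤ G.potential Q - 3 := by omega
  rcases hsub.eq_or_ssubset with h | h
  · have := hS.potential_ge
    rw [h] at hlow
    omega
  · have := hmin (A ∪ Q) (mem_filter.2 ⟨mem_ssubsets.2 h,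
      hQ4.trans (card_le_card subset_union_right)⟩)
    omega

lemma exists_colouring_ne (hS : IsMinCounterexample G S) {R : Finset V} (hR : R ⊂ S) {x y : V}
    (hx : x ∈ R) (hy : y ∈ R) (hxy : x ≠ y) :
    ∃ φ : V → Fin 3, (∀ u ∈ R, ∀ v ∈ R, G.Adj u v → φ u ≠ φ v) ∧ φ x ≠ φ y := by
  have hadj : (G ⊔ SimpleGraph.edge x y).Adj x y := by
    rw [SimpleGraph.sup_adj, SimpleGraph.edge_adj]; exact Or.inr ⟨Or.inl ⟨rfl, rfl⟩, hxy⟩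
  by_cases hcol : (G ⊔ SimpleGraph.edge x y).ThreeColOn R
  · obtain ⟨φ, hφ⟩ := hcol
    exact ⟨φ, fun u hu v hv huv => hφ u hu v hv (Or.inl huv), hφ x hx y hy hadj⟩
  exfalso
  obtain ⟨W, hWR, hW, hWp⟩ := hS.smaller V _ R (card_lt_card hR) hcol
  have hWS : W ⊂ S := hWR.trans_ssubset hR
  have hxW : x ∈ W ∧ y ∈ W := by
    by_contra hcon
    apply hW
    refine (hS.col_of_ssubset W hWS).mono ?_ Subset.rfl
    intro u hu v hv huv
    rcases huv with huv | huv
    · exact huv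
    · rw [SimpleGraph.edge_adj] at huv
      rcases huv.1 with ⟨h1, h2⟩ | ⟨h1, h2⟩
      · exact absurd ⟨h1 ▸ hu, h2 ▸ hv⟩ hcon
      · exact absurd ⟨h2 ▸ hv, h1 ▸ hu⟩ hcon
  have h2 : 2 ≤ #W := by
    rw [← card_pair hxy]
    exact card_le_card (insert_subset hxW.1 (singleton_subset_iff.2 hxW.2))
  have h6 := hS.six_le_potential hWS h2
  have hd : (G ⊔ SimpleGraph.edge x y).dartsIn W ≤ G.dartsIn W + 2 := by
    have : ∀ u ∈ W, #((G ⊔ SimpleGraph.edge x y).nbrIn W u) ≤ #(G.nbrIn W u) +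
        ((if u = x then 1 else 0) + (if u = y then 1 else 0)) := by
      intro u _
      have hsub : (G ⊔ SimpleGraph.edge x y).nbrIn W u ⊆ G.nbrIn W u ∪
          ((if u = x then {y} else ∅) ∪ (if u = y then {x} else ∅)) := by
        intro v hv
        obtain ⟨hvW, hv⟩ := SimpleGraph.mem_nbrIn.1 hv
        rcases hv with hv | hv
        · exact mem_union_left _ (SimpleGraph.mem_nbrIn.2 ⟨hvW, hv⟩)
        · rw [SimpleGraph.edge_adj] at hv
          rcases hv.1 with ⟨rfl, rfl⟩ | ⟨rfl, rfl⟩ <;> simp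
      refine (card_le_card hsub).trans ((card_union_le _ _).trans ?_)
      refine add_le_add le_rfl ((card_union_le _ _).trans ?_)
      gcongr <;> split_ifs <;> simp
    refine (sum_le_sum this).trans ?_
    rw [sum_add_distrib, sum_add_distrib, sum_ite_eq', sum_ite_eq']
    simp only [hxW.1, hxW.2, if_true]
    rfl
  have e1 := two_mul_potential G W
  have e2 := two_mul_potential (G ⊔ SimpleGraph.edge x y) W
  omega

lemma seven_le_potential (hS : IsMinCounterexample G S) {R : Finset V} (hR : R ⊂ S)
    (h4 : 4 ≤ #R) : 7 ≤ G.potential R := by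
  by_contra! hlt
  have h6 := hS.six_le_potential hR (by omega)
  by_cases hb : ∃ x ∈ R, ∃ y ∈ R, x ≠ y ∧ (∃ w ∈ S \ R, G.Adj w x) ∧ ∃ w ∈ S \ R, G.Adj w y
  · obtain ⟨x, hx, y, hy, hxy, ⟨w, hw, hwx⟩, ⟨w', hw', hwy⟩⟩ := hb
    obtain ⟨φ, hφ, hφxy⟩ := hS.exists_colouring_ne hR hx hy hxy
    obtain ⟨A, hA, X, hX, hX1, hp⟩ := hS.exists_replacement hR h4 hφ
    have hdis : Disjoint A R := disjoint_of_subset_left hA sdiff_disjoint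
    have hu := potential_union G hdis
    have hle1 := fun w (_ : w ∈ A) => card_inter_coloursSeen_le (G := G) X R φ w
    have hle := sum_le_sum hle1
    have hsub : A ∪ R ⊆ S := union_subset (hA.trans sdiff_subset) hR.1
    rcases hsub.eq_or_ssubset with h | h
    · have := hS.potential_ge
      rw [h] at hu
      have hXc : #X = 1 := hX1 (by omega)
      have heq : ∑ w ∈ A, #(X ∩ coloursSeen G R φ w) = ∑ w ∈ A, #(G.nbrIn R w) := by omega
      have hall := (sum_eq_sum_iff_of_le hle1).1 heq
      have hAS : S \ R = A := by
        rw [← h, union_sdiff_right, sdiff_eq_self_of_disjoint hdis]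
      obtain ⟨i, hi⟩ := card_eq_one.1 hXc
      have hone : ∀ x ∈ R, ∀ w ∈ S \ R, G.Adj w x → φ x = i := by
        intro x hx w hw hwx
        rw [hAS] at hw
        have h1 := hall w hw
        have hxn : x ∈ G.nbrIn R w := SimpleGraph.mem_nbrIn.2 ⟨hx, hwx⟩
        have h2 : #(X ∩ coloursSeen G R φ w) ≤ 1 := by
          rw [← hXc]; exact card_le_card inter_subset_left
        have h3 : 0 < #(X ∩ coloursSeen G R φ w) := by
          rw [h1]; exact card_pos.2 ⟨x, hxn⟩
        obtain ⟨j, hj⟩ := card_pos.1 h3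
        obtain ⟨hjX, hjc⟩ := mem_inter.1 hj
        rw [hi, mem_singleton] at hjX
        obtain ⟨r, hr, hrj⟩ := mem_image.1 hjc
        have : r = x := card_le_one.1 (h1 ▸ h2) r hr x hxn
        rw [← this, hrj, hjX]
      exact hφxy ((hone x hx w hw hwx).trans (hone y hy w' hw' hwy).symm)
    · have := hS.six_le_potential h (by
        have := card_le_card (subset_union_right (s₁ := A) (s₂ := R)); omega)
      omega
  · obtain ⟨x, hx, hbx⟩ : ∃ x ∈ R, ∀ y ∈ R, ∀ w ∈ S \ R, G.Adj w y → y = x := by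
      push Not at hb
      by_cases he : ∃ x ∈ R, ∃ w ∈ S \ R, G.Adj w x
      · obtain ⟨x, hx, w, hw, hwx⟩ := he
        refine ⟨x, hx, fun y hy w' hw' hwy => ?_⟩
        by_contra hyx
        exact hb x hx y hy (Ne.symm hyx) ⟨w, hw, hwx⟩ w' hw' hwy
      · obtain ⟨x, hx⟩ : R.Nonempty := card_pos.1 (by omega)
        exact ⟨x, hx, fun y hy w hw hwy => absurd ⟨y, hy, w, hw, hwy⟩ he⟩
    obtain ⟨f, hf⟩ := hS.col_of_ssubset R hR
    obtain ⟨y, hy, hyx⟩ : ∃ y ∈ R, y ≠ x := exists_mem_ne (by omega) x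
    obtain ⟨g, hg⟩ := hS.col_of_ssubset (insert x (S \ R)) (by
      refine ⟨insert_subset (hR.1 hx) sdiff_subset, fun h => ?_⟩
      have := h (hR.1 hy)
      simp [hyx, hy] at this)
    let σ := Equiv.swap (g x) (f x)
    have hmix : ∀ u ∈ R, ∀ v ∈ S \ R, G.Adj u v → f u ≠ σ (g v) := by
      intro u hu v hv huv
      have := hbx u hu v hv huv.symm
      subst this
      have h1 : f u = σ (g u) := (Equiv.swap_apply_left _ _).symm
      rw [h1]
      exact fun h => hg u (by simp) v (mem_insert_of_mem hv) huv (σ.injective h)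
    apply hS.not_col
    refine ⟨fun v => if v ∈ R then f v else σ (g v), ?_⟩
    intro u hu v hv huv
    by_cases huR : u ∈ R <;> by_cases hvR : v ∈ R <;> simp only [huR, hvR, if_true, if_false]
    · exact hf u huR v hvR huv
    · exact hmix u huR v (mem_sdiff.2 ⟨hv, hvR⟩) huv
    · exact (hmix v hvR u (mem_sdiff.2 ⟨hu, huR⟩) huv.symm).symm
    · exact fun h => hg u (mem_insert_of_mem (mem_sdiff.2 ⟨hu, huR⟩)) v
        (mem_insert_of_mem (mem_sdiff.2 ⟨hv, hvR⟩)) huv (σ.injective h)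

end IsMinCounterexample

section
variable {V : Type} [DecidableEq V] {G : SimpleGraph V} {S : Finset V}

/-- `G` with the adjacencies of `v` added to those of `u`. -/
def SimpleGraph.mergeInto (G : SimpleGraph V) (u v : V) : SimpleGraph V :=
  SimpleGraph.fromRel fun a b => G.Adj a b ∨ (a = u ∧ G.Adj v b)

omit [DecidableEq V] in
lemma mergeInto_adj_of_ne {u v a b : V} (ha : a ≠ u) (hb : b ≠ u) :
    (G.mergeInto u v).Adj a b ↔ G.Adj a b := by
  simp only [SimpleGraph.mergeInto, SimpleGraph.fromRel_adj, ha, hb, false_and, or_false]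
  rw [G.adj_comm b a, or_self]
  exact ⟨fun h => h.2, fun h => ⟨h.ne, h⟩⟩

lemma potential_insert_le_mergeInto {W : Finset V} {u v : V} (hu : u ∈ W) (hv : v ∉ W) :
    G.potential (insert v W) ≤ (G.mergeInto u v).potential W + 5 := by
  have hW : W = insert u (W.erase u) := (insert_erase hu).symm
  set W0 := W.erase u with hW0
  have hu0 : u ∉ W0 := notMem_erase u W
  have h1 : (G.mergeInto u v).potential W0 = G.potential W0 := by
    have : (G.mergeInto u v).dartsIn W0 = G.dartsIn W0 := by
      refine sum_congr rfl fun a ha => ?_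
      congr 1
      ext b
      simp only [SimpleGraph.mem_nbrIn]
      refine and_congr_right fun hb => mergeInto_adj_of_ne ?_ ?_
      · rintro rfl; exact hu0 ha
      · rintro rfl; exact hu0 hb
    unfold SimpleGraph.potential
    rw [this]
  have h2 : #((G.mergeInto u v).nbrIn W0 u) ≤ #(G.nbrIn W0 u) + #(G.nbrIn W0 v) := by
    refine (card_le_card ?_).trans (card_union_le _ _)
    intro b hb
    obtain ⟨hbW, hb⟩ := SimpleGraph.mem_nbrIn.1 hb
    simp only [SimpleGraph.mergeInto, SimpleGraph.fromRel_adj] at hb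
    simp only [mem_union, SimpleGraph.mem_nbrIn, hbW, true_and]
    have hbu : b ≠ u := by rintro rfl; exact hu0 hbW
    rcases hb.2 with (h | h) | (h | h)
    · exact Or.inl h
    · exact Or.inr h.2
    · exact Or.inl h.symm
    · exact absurd h.1 hbu
  have h3 : #(G.nbrIn W0 v) ≤ #(G.nbrIn W v) := by
    refine card_le_card fun b hb => ?_
    obtain ⟨hbW, hb⟩ := SimpleGraph.mem_nbrIn.1 hb
    exact SimpleGraph.mem_nbrIn.2 ⟨mem_of_mem_erase hbW, hb⟩
  have p1 := potential_insert G hv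
  have p2 := potential_insert G hu0
  have p3 := potential_insert (G.mergeInto u v) hu0
  rw [← hW] at p2 p3
  omega

namespace IsMinCounterexample

lemma adj_of_card_nbrIn_eq_three (hS : IsMinCounterexample G S) {x y u v : V} (hx : x ∈ S)
    (hy : y ∈ S) (hdy : #(G.nbrIn S y) = 3) (hN : G.nbrIn S x = {y, u, v}) (hyu : y ≠ u)
    (hyv : y ≠ v) (huv : u ≠ v) : G.Adj u v := by
  by_contra hnuv
  have hmem : ∀ w, w ∈ G.nbrIn S x ↔ w = y ∨ w = u ∨ w = v := by
    intro w; rw [hN]; simp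
  simp only [SimpleGraph.mem_nbrIn] at hmem
  obtain ⟨-, hxy⟩ := (hmem y).2 (by simp)
  obtain ⟨huS, hxu⟩ := (hmem u).2 (by simp)
  obtain ⟨hvS, hxv⟩ := (hmem v).2 (by simp)
  by_cases hcol : (G.mergeInto u v).ThreeColOn (S \ {x, y, v})
  · obtain ⟨f, hf⟩ := hcol
    have hin : ∀ w ∈ S, w ≠ x → w ≠ y → w ≠ v → w ∈ S \ {x, y, v} := by
      intro w hw h1 h2 h3; simp [hw, h1, h2, h3]
    let f1 : V → Fin 3 := fun w => if w = v then f u else f w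
    have hf1 : ∀ a ∈ S, ∀ b ∈ S, a ≠ x → a ≠ y → b ≠ x → b ≠ y → G.Adj a b → f1 a ≠ f1 b := by
      have key : ∀ b ∈ S, b ≠ x → b ≠ y → G.Adj v b → f u ≠ f b := by
        intro b hb hbx hby hvb
        have hbu : b ≠ u := by rintro rfl; exact hnuv hvb.symm
        refine hf u (hin u huS hxu.ne' hyu.symm huv) b (hin b hb hbx hby hvb.ne') ?_
        rw [SimpleGraph.mergeInto, SimpleGraph.fromRel_adj]
        exact ⟨hbu.symm, Or.inl (Or.inr ⟨rfl, hvb⟩)⟩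
      intro a ha b hb hax hay hbx hby hab
      by_cases hav : a = v <;> by_cases hbv : b = v <;> simp only [f1, hav, hbv, if_true, if_false]
      · exact absurd (hav.trans hbv.symm) hab.ne
      · exact key b hb hbx hby (hav ▸ hab)
      · exact (key a ha hax hay (hbv ▸ hab.symm)).symm
      · refine hf a (hin a ha hax hay hav) b (hin b hb hbx hby hbv) ?_
        rw [SimpleGraph.mergeInto, SimpleGraph.fromRel_adj]
        exact ⟨hab.ne, Or.inl (Or.inl hab)⟩
    obtain ⟨i, -, hi⟩ : ∃ i ∈ (univ : Finset (Fin 3)), i ∉ ((G.nbrIn S y).erase x).image f1 := by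
      apply exists_mem_notMem_of_card_lt_card
      refine card_image_le.trans_lt ?_
      rw [card_erase_of_mem (SimpleGraph.mem_nbrIn.2 ⟨hx, hxy.symm⟩), hdy]
      simp
    have hi' : ∀ w ∈ S, w ≠ x → G.Adj y w → i ≠ f1 w := fun w hw hwx h h' =>
      hi (mem_image.2 ⟨w, mem_erase.2 ⟨hwx, SimpleGraph.mem_nbrIn.2 ⟨hw, h⟩⟩, h'.symm⟩)
    obtain ⟨j, -, hj⟩ : ∃ j ∈ (univ : Finset (Fin 3)), j ∉ ({i, f1 u} : Finset (Fin 3)) := by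
      apply exists_mem_notMem_of_card_lt_card
      exact card_le_two.trans_lt (by simp)
    simp only [mem_insert, mem_singleton, not_or] at hj
    have hfuv : f1 v = f1 u := by simp [f1]
    apply hS.not_col
    refine ⟨fun w => if w = x then j else if w = y then i else f1 w, ?_⟩
    have hxw : ∀ w ∈ S, G.Adj x w → j ≠ if w = y then i else f1 w := by
      intro w hw hxw
      rcases (hmem w).1 ⟨hw, hxw⟩ with rfl | rfl | rfl
      · simpa using hj.1
      · simpa [hyu.symm] using hj.2
      · simpa [hyv.symm, hfuv] using hj.2
    intro a ha b hb hab
    by_cases hax : a = x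
    · subst hax
      simp only [hab.ne', if_true, if_false]
      exact hxw b hb hab
    by_cases hbx : b = x
    · subst hbx
      simp only [hax, if_true, if_false]
      exact (hxw a ha hab.symm).symm
    by_cases hay : a = y
    · subst hay
      simp only [hax, hbx, hab.ne', if_true, if_false]
      exact hi' b hb hbx hab
    by_cases hby : b = y
    · subst hby
      simp only [hax, hbx, hay, if_true, if_false]
      exact (hi' a ha hax hab.symm).symm
    simp only [hax, hbx, hay, hby, if_false]
    exact hf1 a ha b hb hax hay hbx hby hab
  obtain ⟨W, hWS, hW, hWp⟩ := hS.smaller V _ (S \ {x, y, v}) (card_lt_card (by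
    refine ⟨sdiff_subset, fun h => ?_⟩
    have := h hx
    simp at this)) hcol
  have hWS' : W ⊆ S := hWS.trans sdiff_subset
  have hxW : x ∉ W := fun h => by have := hWS h; simp at this
  have hyW : y ∉ W := fun h => by have := hWS h; simp at this
  have hvW : v ∉ W := fun h => by have := hWS h; simp at this
  have huW : u ∈ W := by
    by_contra huW
    apply hW
    refine (hS.col_of_ssubset W ⟨hWS', fun h => hxW (h hx)⟩).mono ?_ Subset.rfl
    intro a ha b hb hab
    rwa [mergeInto_adj_of_ne] at hab
    · rintro rfl; exact huW ha
    · rintro rfl; exact huW hb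
  have hW2 : 2 ≤ #W := by
    by_contra! hlt
    apply hW
    refine ⟨fun _ => 0, fun a ha b hb hab => absurd ?_ hab.ne⟩
    exact card_le_one.1 (by omega) a ha b hb
  have p1 := potential_insert_le_mergeInto (G := G) huW hvW
  have hxR : x ∉ insert v W := by simp [hxW, hxv.ne]
  have p2 := potential_insert G hxR
  have h2 : 2 ≤ #(G.nbrIn (insert v W) x) := by
    rw [← card_pair huv]
    refine card_le_card (insert_subset ?_ (singleton_subset_iff.2 ?_))
    · exact SimpleGraph.mem_nbrIn.2 ⟨mem_insert_of_mem huW, hxu⟩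
    · exact SimpleGraph.mem_nbrIn.2 ⟨mem_insert_self _ _, hxv⟩
  have hR : insert x (insert v W) ⊂ S := by
    refine ⟨insert_subset hx (insert_subset hvS hWS'), fun h => ?_⟩
    have := h hy
    simp [hxy.ne', hyv, hyW] at this
  have := hS.seven_le_potential hR (by
    rw [card_insert_of_notMem hxR, card_insert_of_notMem hvW]; omega)
  omega

lemma five_lt_potential_of_card_eq_four (hS : IsMinCounterexample G S) {R : Finset V} (hR : R ⊆ S)
    (h4 : #R = 4) : 5 < G.potential R := by
  rcases hR.eq_or_ssubset with rfl | h
  · exfalso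
    have h1 : #R • 3 ≤ G.dartsIn R := card_nsmul_le_sum _ _ _ fun v hv =>
      hS.three_le_card_nbrIn hv
    have h2 := two_mul_potential G R
    have h3 := hS.potential_ge
    rw [h4] at h1 h2
    norm_num at h1 h2
    omega
  · have := hS.six_le_potential h (by omega)
    omega

lemma not_two_cubic_nbrs (hS : IsMinCounterexample G S) {x y y' v : V} (hx : x ∈ S)
    (hN : G.nbrIn S x = {y, y', v}) (hyy' : y ≠ y') (hyv : y ≠ v) (hyv' : y' ≠ v)
    (hdy : #(G.nbrIn S y) = 3) (hdy' : #(G.nbrIn S y') = 3) : False := by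
  have hmem : ∀ w, w ∈ G.nbrIn S x ↔ w = y ∨ w = y' ∨ w = v := by
    intro w; rw [hN]; simp
  simp only [SimpleGraph.mem_nbrIn] at hmem
  obtain ⟨hy, hxy⟩ := (hmem y).2 (by simp)
  obtain ⟨hy', hxy'⟩ := (hmem y').2 (by simp)
  obtain ⟨hv, hxv⟩ := (hmem v).2 (by simp)
  have h1 : G.Adj y' v := hS.adj_of_card_nbrIn_eq_three hx hy hdy hN hyy' hyv hyv'
  have h2 : G.Adj y v := hS.adj_of_card_nbrIn_eq_three hx hy' hdy'
    (by rw [hN]; ext; simp; tauto) hyy'.symm hyv' hyv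
  have h4 : #({x, y, y', v} : Finset V) = 4 := by
    rw [card_insert_of_notMem (by simp [hxy.ne, hxy'.ne, hxv.ne]),
      card_insert_of_notMem (by simp [hyy', hyv]), card_pair hyv']
  have h5 := hS.five_lt_potential_of_card_eq_four (R := {x, y, y', v}) (by
    intro w hw
    simp only [mem_insert, mem_singleton] at hw
    rcases hw with rfl | rfl | rfl | rfl <;> assumption) h4
  have p1 := potential_insert G (S := {y, y', v}) (v := x) (by simp [hxy.ne, hxy'.ne, hxv.ne])
  have p2 := potential_insert G (S := {y', v}) (v := y) (by simp [hyy', hyv])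
  have p3 := potential_insert G (S := {v}) (v := y') (by simp [hyv'])
  have p4 : G.potential {v} = 5 := by
    have := two_mul_potential G {v}
    simp [SimpleGraph.dartsIn, nbrIn_singleton_self] at this
    omega
  have n1 : #(G.nbrIn {y, y', v} x) = 3 := by
    rw [show G.nbrIn {y, y', v} x = {y, y', v} by
      ext w
      simp only [SimpleGraph.mem_nbrIn, mem_insert, mem_singleton, and_iff_left_iff_imp]
      rintro (rfl | rfl | rfl) <;> assumption]
    rw [card_insert_of_notMem (by simp [hyy', hyv]), card_pair hyv']
  have n2 : 1 ≤ #(G.nbrIn {y', v} y) := card_pos.2 ⟨v, by simp [h2]⟩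
  have n3 : 1 ≤ #(G.nbrIn {v} y') := card_pos.2 ⟨v, by simp [h1]⟩
  omega

lemma false (hS : IsMinCounterexample G S) : False := by
  have hlow : ∀ x ∈ {x ∈ S | #(G.nbrIn S x) = 3},
      2 ≤ #{w ∈ G.nbrIn S x | #(G.nbrIn S w) ≠ 3} := by
    intro x hx
    obtain ⟨hxS, hx3⟩ := mem_filter.1 hx
    by_contra! hlt
    have hsum := card_filter_add_card_filter_not (s := G.nbrIn S x) (fun w => #(G.nbrIn S w) = 3)
    have h2 : 1 < #{w ∈ G.nbrIn S x | #(G.nbrIn S w) = 3} := by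
      simp only [ne_eq] at hlt
      omega
    obtain ⟨y, hy, y', hy', hne⟩ := one_lt_card.1 h2
    obtain ⟨hy, hdy⟩ := mem_filter.1 hy
    obtain ⟨hy', hdy'⟩ := mem_filter.1 hy'
    obtain ⟨v, hv⟩ : ∃ v, (G.nbrIn S x \ {y, y'}) = {v} := by
      rw [← card_eq_one, card_sdiff_of_subset (insert_subset hy (singleton_subset_iff.2 hy')),
        card_pair hne, hx3]
    have hvm : v ∈ G.nbrIn S x \ {y, y'} := by rw [hv]; exact mem_singleton_self _
    obtain ⟨hvN, hvy⟩ := mem_sdiff.1 hvm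
    simp only [mem_insert, mem_singleton, not_or] at hvy
    refine hS.not_two_cubic_nbrs (v := v) hxS ?_ hne (Ne.symm hvy.1) (Ne.symm hvy.2) hdy hdy'
    have := union_sdiff_of_subset (insert_subset hy (singleton_subset_iff.2 hy'))
    rw [← this, hv]
    ext; simp
  have hcomm := sum_card_nbrIn_filter_comm G S (fun x => #(G.nbrIn S x) = 3)
    (fun x => #(G.nbrIn S x) ≠ 3)
  have h1 := card_nsmul_le_sum _ _ _ hlow
  rw [hcomm] at h1
  have h2 : ∑ v ∈ S with #(G.nbrIn S v) ≠ 3, #{u ∈ G.nbrIn S v | #(G.nbrIn S u) = 3} ≤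
      ∑ v ∈ S with #(G.nbrIn S v) ≠ 3, #(G.nbrIn S v) :=
    sum_le_sum fun v _ => card_filter_le _ _
  have h3 : #{v ∈ S | #(G.nbrIn S v) ≠ 3} • 4 ≤
      ∑ v ∈ S with #(G.nbrIn S v) ≠ 3, #(G.nbrIn S v) := by
    refine card_nsmul_le_sum _ _ _ fun v hv => ?_
    obtain ⟨hvS, hv3⟩ := mem_filter.1 hv
    have := hS.three_le_card_nbrIn hvS
    omega
  have h4 : ∑ v ∈ S with #(G.nbrIn S v) = 3, #(G.nbrIn S v) =
      #{v ∈ S | #(G.nbrIn S v) = 3} * 3 := by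
    rw [sum_congr rfl fun v hv => (mem_filter.1 hv).2, sum_const, smul_eq_mul]
  have h5 : ∑ v ∈ S with #(G.nbrIn S v) = 3, #(G.nbrIn S v) +
      ∑ v ∈ S with #(G.nbrIn S v) ≠ 3, #(G.nbrIn S v) = G.dartsIn S :=
    sum_filter_add_sum_filter_not _ _ _
  have h6 : #{v ∈ S | #(G.nbrIn S v) = 3} + #{v ∈ S | #(G.nbrIn S v) ≠ 3} = #S :=
    card_filter_add_card_filter_not _
  have h7 := two_mul_potential G S
  have h8 := hS.potential_ge
  simp only [smul_eq_mul] at h1 h3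
  omega

end IsMinCounterexample
end

/-- **Kostochka–Yancey** for `4`-critical graphs: a graph which is not `3`-colourable has a
non-colourable subgraph with `5n - 3e ≤ 2`. -/
theorem exists_potential_le_two {V : Type} (G : SimpleGraph V) (S : Finset V)
    (h : ¬ G.ThreeColOn S) : ∃ W ⊆ S, ¬ G.ThreeColOn W ∧ G.potential W ≤ 2 := by
  classical
  induction hn : #S using Nat.strong_induction_on generalizing V with
  | _ n ih =>
    by_contra hcon
    have hcol : ∀ T ⊂ S, G.ThreeColOn T := by
      intro T hT
      by_contra hTc
      obtain ⟨W, hWT, hW⟩ := ih _ (hn ▸ card_lt_card hT) G T hTc rfl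
      exact hcon ⟨W, hWT.trans hT.1, hW⟩
    refine IsMinCounterexample.false (G := G) (S := S) ⟨h, hcol, ?_, ?_⟩
    · intro V' G' S' hlt hS'
      exact ih _ (hn ▸ hlt) G' S' hS' rfl
    · by_contra hlt
      exact hcon ⟨S, Subset.rfl, h, by omega⟩

/-- The boundary over `ZMod 2` of the edge set `z` in the multigraph with end maps `s`, `t`. -/
noncomputable def edgeBoundary {E V : Type*} [Fintype E] (s t : E → V) (z : E → ZMod 2) :
    V →₀ ZMod 2 :=
  ∑ e, (Finsupp.single (s e) (z e) + Finsupp.single (t e) (z e))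

/-- A `2`-basis of the cycle space of the multigraph with edge set `A`: cycles `φ f` generating
all cycles, every edge being used by at most two of them. -/
structure IsTwoBasis {E F V : Type*} [Fintype E] [Fintype F] (s t : E → V) (A : Finset E)
    (φ : F → E → ZMod 2) : Prop where
  supp : ∀ f, ∀ e ∉ A, φ f e = 0
  cycle : ∀ f, edgeBoundary s t (φ f) = 0
  two : ∀ e, #{f | φ f e ≠ 0} ≤ 2
  span : ∀ z, edgeBoundary s t z = 0 → (∀ e ∉ A, z e = 0) → ∃ c : F → ZMod 2, z = ∑ f, c f • φ f

section

variable {E F V W : Type*} [Fintype E] [Fintype F] {s t : E → V} {A : Finset E}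
  {φ : F → E → ZMod 2}

lemma edgeBoundary_zero : edgeBoundary s t 0 = 0 := by simp [edgeBoundary]

lemma edgeBoundary_add (z w : E → ZMod 2) :
    edgeBoundary s t (z + w) = edgeBoundary s t z + edgeBoundary s t w := by
  simp only [edgeBoundary, Pi.add_apply, Finsupp.single_add, ← sum_add_distrib]
  exact sum_congr rfl fun _ _ => by abel

lemma edgeBoundary_smul (c : ZMod 2) (z : E → ZMod 2) :
    edgeBoundary s t (c • z) = c • edgeBoundary s t z := by
  simp [edgeBoundary, smul_sum]

lemma edgeBoundary_sum {ι : Type*} (I : Finset ι) (z : ι → E → ZMod 2) :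
    edgeBoundary s t (∑ i ∈ I, z i) = ∑ i ∈ I, edgeBoundary s t (z i) := by
  classical
  induction I using Finset.induction_on with
  | empty => simp [edgeBoundary_zero]
  | insert i I hi ih => rw [sum_insert hi, sum_insert hi, edgeBoundary_add, ih]

lemma edgeBoundary_comp (q : V → W) (z : E → ZMod 2) :
    edgeBoundary (q ∘ s) (q ∘ t) z = (edgeBoundary s t z).mapDomain q := by
  simp [edgeBoundary, Finsupp.mapDomain_finsetSum, Finsupp.mapDomain_add,
    Finsupp.mapDomain_single]

lemma edgeBoundary_single [DecidableEq E] (e : E) (c : ZMod 2) :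
    edgeBoundary s t (Pi.single e c) = Finsupp.single (s e) c + Finsupp.single (t e) c := by
  rw [edgeBoundary, sum_eq_single e]
  · simp
  · intro e' _ he
    simp [he]
  · simp

lemma add_self_of_zmod_two {M : Type*} [AddCommGroup M] [Module (ZMod 2) M] (x : M) :
    x + x = 0 := by
  rw [← two_smul (ZMod 2), show (2 : ZMod 2) = 0 from rfl, zero_smul]

lemma zmod_two_eq_one {x : ZMod 2} (h : x ≠ 0) : x = 1 := by
  revert x; decide

lemma edgeBoundary_apply [DecidableEq V] (z : E → ZMod 2) (v : V) : edgeBoundary s t z v =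
    ∑ e, ((if s e = v then z e else 0) + if t e = v then z e else 0) := by
  simp [edgeBoundary, Finsupp.finsetSum_apply, Finsupp.single_apply]

namespace IsTwoBasis

lemma erase [DecidableEq E] (h : IsTwoBasis s t A φ) (e₀ : E) : ∃ φ' : F → E → ZMod 2,
    IsTwoBasis s t (A.erase e₀) φ' ∧ ∀ f, φ f e₀ = 0 → φ' f = φ f := by
  classical
  by_cases h0 : ∃ f₁, φ f₁ e₀ ≠ 0
  · obtain ⟨f₁, hf₁⟩ := h0
    refine ⟨fun f => φ f + φ f e₀ • φ f₁, ⟨?_, ?_, ?_, ?_⟩, fun f hf => by simp [hf]⟩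
    · intro f e he
      by_cases hee : e = e₀
      · subst hee
        simp [zmod_two_eq_one hf₁, add_self_of_zmod_two]
      · have : e ∉ A := fun h => he (mem_erase.2 ⟨hee, h⟩)
        simp [h.supp _ e this]
    · intro f
      simp [edgeBoundary_add, edgeBoundary_smul, h.cycle]
    · intro e
      by_cases he : φ f₁ e = 0
      · simpa [he] using h.two e
      · have hsub : ({f | (φ f + φ f e₀ • φ f₁) e ≠ 0} : Finset F) ⊆
            ({f | φ f e ≠ 0} : Finset F).erase f₁ ∪ ({f | φ f e₀ ≠ 0} : Finset F).erase f₁ := by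
          intro f hf
          simp only [Pi.add_apply, Pi.smul_apply, smul_eq_mul, mem_filter, mem_univ,
            true_and] at hf
          have hne : f ≠ f₁ := by
            rintro rfl
            exact hf (by simp [zmod_two_eq_one hf₁, add_self_of_zmod_two])
          by_cases hf0 : φ f e₀ = 0
          · rw [hf0] at hf
            simp_all
          · simp [hne, hf0]
        refine (card_le_card hsub).trans ((card_union_le _ _).trans ?_)
        rw [card_erase_of_mem (by simpa using he), card_erase_of_mem (by simpa using hf₁)]
        have := h.two e
        have := h.two e₀
        omega
    · intro z hz hzA
      obtain ⟨c, rfl⟩ := h.span z hz fun e he => hzA e fun h' => he (mem_of_mem_erase h')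
      refine ⟨c, ?_⟩
      have h0 := hzA e₀ (notMem_erase _ _)
      simp only [Finset.sum_apply, Pi.smul_apply, smul_eq_mul] at h0
      simp only [smul_add, sum_add_distrib, smul_smul, ← sum_smul, h0, zero_smul, add_zero]
  · push Not at h0
    refine ⟨φ, ⟨?_, h.cycle, h.two, ?_⟩, fun _ _ => rfl⟩
    · intro f e he
      by_cases hee : e = e₀
      · subst hee; exact h0 f
      · exact h.supp f e fun h => he (mem_erase.2 ⟨hee, h⟩)
    · exact fun z hz hzA => h.span z hz fun e he => hzA e fun h' => he (mem_of_mem_erase h')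

lemma sdiff [DecidableEq E] (h : IsTwoBasis s t A φ) (D : Finset E) : ∃ φ' : F → E → ZMod 2,
    IsTwoBasis s t (A \ D) φ' ∧ ∀ f, (∀ e ∈ D, φ f e = 0) → φ' f = φ f := by
  induction D using Finset.induction_on with
  | empty => exact ⟨φ, by simpa using h, fun _ _ => rfl⟩
  | insert e D he ih =>
    obtain ⟨φ₁, h₁, hφ₁⟩ := ih
    obtain ⟨φ₂, h₂, hφ₂⟩ := h₁.erase e
    refine ⟨φ₂, by rwa [sdiff_insert], fun f hf => ?_⟩
    have := hφ₁ f fun e' he' => hf e' (mem_insert_of_mem he')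
    rw [hφ₂ f (by rw [this]; exact hf e (mem_insert_self _ _)), this]

lemma restrict (h : IsTwoBasis s t A φ) {B : Finset E} (hB : B ⊆ A) : ∃ φ' : F → E → ZMod 2,
    IsTwoBasis s t B φ' ∧ ∀ f, (∀ e ∉ B, φ f e = 0) → φ' f = φ f := by
  classical
  obtain ⟨φ', h', hφ'⟩ := h.sdiff (A \ B)
  refine ⟨φ', by rwa [Finset.sdiff_sdiff_eq_self hB] at h', fun f hf => hφ' f fun e he => ?_⟩
  exact hf e (mem_sdiff.1 he).2

/-- Contracting the edges `T`, where `q` is the quotient map on the vertices. -/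
lemma contract [DecidableEq E] [Nonempty V] (h : IsTwoBasis s t A φ) (q : V → W) {T : Finset E}
    (hTA : T ⊆ A) (hT : ∀ e ∈ T, q (s e) = q (t e)) {P : Set V} (hP : ∀ e ∈ A, s e ∈ P ∧ t e ∈ P)
    (hjoin : ∀ x ∈ P, ∀ y ∈ P, q x = q y → ∃ z : E → ZMod 2, (∀ e ∉ T, z e = 0) ∧
      edgeBoundary s t z = Finsupp.single x 1 + Finsupp.single y 1) :
    IsTwoBasis (q ∘ s) (q ∘ t) (A \ T) (fun f e => if e ∈ T then 0 else φ f e) := by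
  classical
  have hloop : ∀ z : E → ZMod 2, (∀ e ∉ T, z e = 0) → edgeBoundary (q ∘ s) (q ∘ t) z = 0 := by
    intro z hz
    refine sum_eq_zero fun e _ => ?_
    by_cases he : e ∈ T
    · simp only [Function.comp_apply, hT e he]
      exact add_self_of_zmod_two _
    · simp [hz e he]
  refine ⟨?_, ?_, ?_, ?_⟩
  · intro f e he
    by_cases heT : e ∈ T
    · simp [heT]
    · simp [heT, h.supp f e fun h' => he (mem_sdiff.2 ⟨h', heT⟩)]
  · intro f
    have h1 : edgeBoundary (q ∘ s) (q ∘ t) (φ f) = 0 := by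
      rw [edgeBoundary_comp, h.cycle, Finsupp.mapDomain_zero]
    have h2 : φ f = (fun e => if e ∈ T then 0 else φ f e) +
        fun e => if e ∈ T then φ f e else 0 := by
      ext e
      by_cases he : e ∈ T <;> simp [he]
    rw [h2, edgeBoundary_add, hloop (fun e => if e ∈ T then φ f e else 0) (by simp +contextual),
      add_zero] at h1
    exact h1
  · intro e
    by_cases he : e ∈ T
    · simp [he]
    · simpa [he] using h.two e
  · intro z hz hzA
    have hsupp : ∀ v ∉ P, edgeBoundary s t z v = 0 := by
      intro v hv
      rw [edgeBoundary_apply]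
      refine sum_eq_zero fun e _ => ?_
      by_cases he : e ∈ A
      · have := hP e he
        rw [if_neg (fun hs : s e = v => hv (hs ▸ this.1)),
          if_neg (fun ht : t e = v => hv (ht ▸ this.2)), add_zero]
      · simp [hzA e fun h => he (mem_sdiff.1 h).1]
    choose! J hJT hJ using hjoin
    set y := edgeBoundary s t z with hy
    set r := Function.invFunOn q P
    have hr : ∀ v ∈ P, r (q v) ∈ P ∧ q v = q (r (q v)) := fun v hv =>
      ⟨Function.invFunOn_mem ⟨v, hv, rfl⟩, (Function.invFunOn_eq ⟨v, hv, rfl⟩).symm⟩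
    set w : E → ZMod 2 := ∑ v ∈ y.support, y v • J v (r (q v)) with hw
    have hyP : ∀ v ∈ y.support, v ∈ P := fun v hv => by
      by_contra hvP
      exact (Finsupp.mem_support_iff.1 hv) (hsupp v hvP)
    have hwT : ∀ e ∉ T, w e = 0 := by
      intro e he
      rw [hw, Finset.sum_apply]
      refine sum_eq_zero fun v hv => ?_
      rw [Pi.smul_apply, hJT v (hyP v hv) _ (hr v (hyP v hv)).1 (hr v (hyP v hv)).2 e he, smul_zero]
    have hwb : edgeBoundary s t w = y := by
      have h1 : edgeBoundary s t w = y.sum Finsupp.single + y.mapDomain (r ∘ q) := by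
        rw [hw, edgeBoundary_sum, Finsupp.mapDomain, Finsupp.sum, Finsupp.sum, ← sum_add_distrib]
        refine sum_congr rfl fun v hv => ?_
        rw [edgeBoundary_smul, hJ v (hyP v hv) _ (hr v (hyP v hv)).1 (hr v (hyP v hv)).2]
        simp
      rw [h1, Finsupp.sum_single, Finsupp.mapDomain_comp, ← edgeBoundary_comp, hz,
        Finsupp.mapDomain_zero, add_zero]
    obtain ⟨c, hc⟩ := h.span (z + w)
      (by rw [edgeBoundary_add, hwb, ← hy, add_self_of_zmod_two]) (fun e he => by
        rw [Pi.add_apply, hzA e fun h => he (mem_sdiff.1 h).1, hwT e fun h => he (hTA h), add_zero])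
    refine ⟨c, ?_⟩
    ext e
    by_cases he : e ∈ T
    · simp [he, hzA e fun h => (mem_sdiff.1 h).2 he]
    · have := congrFun hc e
      rw [Pi.add_apply, hwT e he, add_zero] at this
      simp [this, he]

end IsTwoBasis

end

section

variable {E F V : Type*} [Fintype E] [Fintype F] {s t : E → V} {A : Finset E}
  {φ : F → E → ZMod 2}

lemma sum_edgeBoundary [DecidableEq V] {S : Finset V} {z : E → ZMod 2}
    (hS : ∀ e, z e ≠ 0 → s e ∈ S ∧ t e ∈ S) : ∑ v ∈ S, edgeBoundary s t z v = 0 := by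
  simp only [edgeBoundary_apply]
  rw [sum_comm]
  refine sum_eq_zero fun e _ => ?_
  by_cases he : z e = 0
  · simp [he]
  · rw [sum_add_distrib, sum_ite_eq, sum_ite_eq, if_pos (hS e he).1, if_pos (hS e he).2,
      add_self_of_zmod_two]

namespace IsTwoBasis

omit [Fintype F] in
/-- A lower bound for the size of a spanning family of cycles. -/
lemma card_add_one_le {B : Finset F} (hspan : ∀ z, edgeBoundary s t z = 0 → (∀ e ∉ A, z e = 0) →
    z ∈ Submodule.span (ZMod 2) (φ '' (B : Set F))) {S : Finset V} (hS : S.Nonempty)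
    (hAS : ∀ e ∈ A, s e ∈ S ∧ t e ∈ S) : #A + 1 ≤ #S + #B := by
  classical
  obtain ⟨v₀, hv₀⟩ := hS
  let Φ : (E → ZMod 2) →ₗ[ZMod 2] ((↥(Aᶜ : Finset E) → ZMod 2) × (↥(S.erase v₀) → ZMod 2)) :=
    { toFun := fun z => (fun e => z e, fun v => edgeBoundary s t z v)
      map_add' := fun z w => by ext <;> simp [edgeBoundary_add]
      map_smul' := fun c z => by ext <;> simp [edgeBoundary_smul] }
  have hker : LinearMap.ker Φ ≤ Submodule.span (ZMod 2) (φ '' (B : Set F)) := by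
    intro z hz
    have h1 : ∀ e ∉ A, z e = 0 := fun e he =>
      congrFun (congrArg Prod.fst (LinearMap.mem_ker.1 hz)) ⟨e, mem_compl.2 he⟩
    have h2 : ∀ v ∈ S.erase v₀, edgeBoundary s t z v = 0 := fun v hv =>
      congrFun (congrArg Prod.snd (LinearMap.mem_ker.1 hz)) ⟨v, hv⟩
    refine hspan z ?_ h1
    have hA : ∀ e, z e ≠ 0 → e ∈ A := fun e he => by_contra fun h => he (h1 e h)
    have h3 := sum_edgeBoundary fun e he => hAS e (hA e he)
    rw [← add_sum_erase _ _ hv₀, sum_eq_zero h2, add_zero] at h3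
    ext v
    by_cases hv : v ∈ S
    · by_cases hvv : v = v₀
      · simpa [hvv] using h3
      · exact h2 v (mem_erase.2 ⟨hvv, hv⟩)
    · rw [edgeBoundary_apply]
      refine sum_eq_zero fun e _ => ?_
      by_cases he : z e = 0
      · simp [he]
      · have := hAS e (hA e he)
        rw [if_neg (fun hs : s e = v => hv (hs ▸ this.1)),
          if_neg (fun ht : t e = v => hv (ht ▸ this.2)), add_zero]
  have h1 := LinearMap.finrank_range_add_finrank_ker Φ
  have h2 := Submodule.finrank_le (LinearMap.range Φ)
  have h3 := Submodule.finrank_mono hker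
  have h4 : Module.finrank (ZMod 2) (Submodule.span (ZMod 2) (φ '' (B : Set F))) ≤ #B := by
    rw [← coe_image]
    exact (finrank_span_finset_le_card _).trans card_image_le
  simp only [Module.finrank_prod, Module.finrank_fintype_fun_eq_card, Fintype.card_coe,
    card_compl, card_erase_of_mem hv₀] at h1 h2
  have := card_le_univ A
  have := card_pos.2 ⟨v₀, hv₀⟩
  omega

/-- The face count in a graph with a two-basis, with edge weights `w`. -/
lemma exists_faces (h : IsTwoBasis s t A φ) {S : Finset V} (hS : S.Nonempty)
    (hAS : ∀ e ∈ A, s e ∈ S ∧ t e ∈ S) {I : Set F} (hI : LinearIndepOn (ZMod 2) φ I)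
    (w : E → ℕ) : ∃ B : Finset F, I ⊆ B ∧ #A + 1 ≤ #S + #B ∧ (∀ f ∈ B, φ f ≠ 0) ∧
      (B.Nonempty → ∑ f ∈ B, φ f ≠ 0) ∧
      ∑ f ∈ B, ∑ e with φ f e ≠ 0, w e + ∑ e with (∑ f ∈ B, φ f) e ≠ 0, w e ≤
        2 * ∑ e ∈ A, w e := by
  classical
  obtain ⟨B, -, hIB, hB, hind⟩ := exists_linearIndepOn_extension hI (Set.subset_univ I)
  lift B to Finset F using B.toFinite
  refine ⟨B, hIB, card_add_one_le (φ := φ) (fun z hz hzA => ?_) hS hAS,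
    fun f hf => hind.ne_zero hf, ?_, ?_⟩
  · obtain ⟨c, rfl⟩ := h.span z hz hzA
    exact Submodule.sum_mem _ fun f _ => Submodule.smul_mem _ _ (hB ⟨f, trivial, rfl⟩)
  · rintro ⟨f, hf⟩ h0
    have := linearIndepOn_finset_iff.1 hind (fun _ => 1) (by simpa using h0) f hf
    exact one_ne_zero this
  · have hA0 : ∀ z : E → ZMod 2, (∀ e ∉ A, z e = 0) →
        ∑ e with z e ≠ 0, w e = ∑ e ∈ A, if z e ≠ 0 then w e else 0 := by
      intro z hz
      rw [sum_filter]
      refine (sum_subset (subset_univ _) fun e _ he => ?_).symm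
      simp [hz e he]
    rw [sum_congr rfl fun f _ => hA0 (φ f) (h.supp f), hA0 _ fun e he => by
      simp [h.supp _ e he], sum_comm, ← sum_add_distrib, mul_sum]
    refine sum_le_sum fun e _ => ?_
    have h2 : #{f ∈ B | φ f e ≠ 0} ≤ 2 :=
      (card_le_card (filter_subset_filter _ (subset_univ _))).trans (h.two e)
    have h3 : (∑ f ∈ B, φ f) e = (#{f ∈ B | φ f e ≠ 0} : ℕ) := by
      rw [Finset.sum_apply, ← sum_filter_ne_zero, sum_congr rfl fun f hf =>
        zmod_two_eq_one (mem_filter.1 hf).2, sum_const, nsmul_one]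
    rw [← sum_filter, sum_const, h3, smul_eq_mul]
    generalize #{f ∈ B | φ f e ≠ 0} = n at *
    interval_cases n
    · simp
    · simp; omega
    · simp [show (2 : ZMod 2) = 0 from rfl]

end IsTwoBasis
end

/-- A combinatorial form of planarity of the subgraph induced on `S`: it is contained in a
multigraph whose cycle space has a two-basis. -/
def SimpleGraph.IsMacLane {V : Type} (G : SimpleGraph V) (S : Finset V) : Prop :=
  ∃ (E F : Type) (_ : Fintype E) (_ : Fintype F) (s t : E → V) (A : Finset E) (φ : F → E → ZMod 2),
    IsTwoBasis s t A φ ∧ ∀ u ∈ S, ∀ v ∈ S, G.Adj u v → ∃ e ∈ A, s(s e, t e) = s(u, v)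

/-- The edges in `A` with end maps `s`, `t` are exactly the edges of the subgraph induced on `S`,
each listed once. -/
structure SimpleGraph.IsEdgeList {V E : Type} (G : SimpleGraph V) (S : Finset V) (s t : E → V)
    (A : Finset E) : Prop where
  adj : ∀ e ∈ A, G.Adj (s e) (t e)
  mem : ∀ e ∈ A, s e ∈ S ∧ t e ∈ S
  inj : ∀ e ∈ A, ∀ e' ∈ A, s(s e, t e) = s(s e', t e') → e = e'
  rep : ∀ u ∈ S, ∀ v ∈ S, G.Adj u v → ∃ e ∈ A, s(s e, t e) = s(u, v)

section

variable {V : Type} {G : SimpleGraph V} {S : Finset V}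

lemma SimpleGraph.IsMacLane.mono (h : G.IsMacLane S) {T : Finset V} (hT : T ⊆ S) :
    G.IsMacLane T := by
  obtain ⟨E, F, _, _, s, t, A, φ, h, hA⟩ := h
  exact ⟨E, F, _, _, s, t, A, φ, h, fun u hu v hv => hA u (hT hu) v (hT hv)⟩

lemma SimpleGraph.IsMacLane.exists_isEdgeList (h : G.IsMacLane S) :
    ∃ (E F : Type) (_ : Fintype E) (_ : Fintype F) (s t : E → V) (A : Finset E)
      (φ : F → E → ZMod 2), IsTwoBasis s t A φ ∧ G.IsEdgeList S s t A := by
  classical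
  obtain ⟨E, F, _, _, s, t, A, φ, h, hA⟩ := h
  rcases isEmpty_or_nonempty E with _ | _
  · refine ⟨E, F, _, _, s, t, A, φ, h, ⟨isEmptyElim, isEmptyElim, isEmptyElim, hA⟩⟩
  have hch : ∀ p : Sym2 V, (∃ e ∈ A, s(s e, t e) = p) → ∃ e ∈ A, s(s e, t e) = p := fun _ => id
  choose! r hr using hch
  set B := {e ∈ A | r s(s e, t e) = e ∧ G.Adj (s e) (t e) ∧ s e ∈ S ∧ t e ∈ S} with hB
  obtain ⟨φ', h', -⟩ := h.restrict (B := B) (filter_subset _ _)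
  refine ⟨E, F, _, _, s, t, B, φ', h', ⟨?_, ?_, ?_, ?_⟩⟩
  · exact fun e he => (mem_filter.1 he).2.2.1
  · exact fun e he => (mem_filter.1 he).2.2.2
  · intro e he e' he' hee
    rw [← (mem_filter.1 he).2.1, hee, (mem_filter.1 he').2.1]
  · intro u hu v hv huv
    obtain ⟨h1, h2⟩ := hr s(u, v) (hA u hu v hv huv)
    refine ⟨r s(u, v), mem_filter.2 ⟨h1, by rw [h2], ?_⟩, h2⟩
    rcases Sym2.eq_iff.1 h2 with ⟨h3, h4⟩ | ⟨h3, h4⟩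
    · rw [h3, h4]; exact ⟨huv, hu, hv⟩
    · rw [h3, h4]; exact ⟨huv.symm, hv, hu⟩

lemma exists_other_edge {E : Type} [Fintype E] {s t : E → V} {z : E → ZMod 2}
    (hz : edgeBoundary s t z = 0) {e : E} (hst : s e ≠ t e) (he : z e ≠ 0) {v : V}
    (hv : v ∈ s(s e, t e)) : ∃ e' ≠ e, z e' ≠ 0 ∧ v ∈ s(s e', t e') := by
  classical
  by_contra! h
  have h1 : edgeBoundary s t z v = 0 := by rw [hz]; rfl
  rw [edgeBoundary_apply, sum_eq_single e] at h1
  · rcases Sym2.mem_iff.1 hv with rfl | rfl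
    · simp [hst.symm, he] at h1
    · simp [hst, he] at h1
  · intro e' _ hne
    by_cases he' : z e' = 0
    · simp [he']
    · have := h e' hne he'
      simp only [Sym2.mem_iff, not_or] at this
      rw [if_neg (Ne.symm this.1), if_neg (Ne.symm this.2), add_zero]
  · simp

namespace SimpleGraph.IsEdgeList

variable {E : Type} {s t : E → V} {A : Finset E}

lemma dartsIn_le (h : G.IsEdgeList S s t A) : G.dartsIn S ≤ 2 * #A := by
  classical
  have h1 : ∀ u ∈ S, #(G.nbrIn S u) ≤ #{e ∈ A | s e = u} + #{e ∈ A | t e = u} := by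
    intro u hu
    have : G.nbrIn S u ⊆ ({e ∈ A | s e = u}).image t ∪ ({e ∈ A | t e = u}).image s := by
      intro v hv
      obtain ⟨hvS, huv⟩ := mem_nbrIn.1 hv
      obtain ⟨e, he, hee⟩ := h.rep u hu v hvS huv
      rcases Sym2.eq_iff.1 hee with ⟨h3, h4⟩ | ⟨h3, h4⟩
      · exact mem_union_left _ (mem_image.2 ⟨e, mem_filter.2 ⟨he, h3⟩, h4⟩)
      · exact mem_union_right _ (mem_image.2 ⟨e, mem_filter.2 ⟨he, h4⟩, h3⟩)
    exact (card_le_card this).trans ((card_union_le _ _).trans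
      (add_le_add card_image_le card_image_le))
  refine (sum_le_sum h1).trans ?_
  rw [sum_add_distrib, ← card_eq_sum_card_fiberwise fun e he => (h.mem e he).1,
    ← card_eq_sum_card_fiberwise fun e he => (h.mem e he).2, two_mul]

variable [Fintype E] {z : E → ZMod 2}

lemma exists_next (h : G.IsEdgeList S s t A) (hzA : ∀ e ∉ A, z e = 0)
    (hz : edgeBoundary s t z = 0) {e : E} (he : z e ≠ 0) {x y : V} (hxy : s(s e, t e) = s(x, y)) :
    ∃ e' ≠ e, z e' ≠ 0 ∧ ∃ w, s(s e', t e') = s(y, w) ∧ G.Adj y w ∧ w ≠ x := by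
  have hA : ∀ e, z e ≠ 0 → e ∈ A := fun e he => by_contra fun h => he (hzA e h)
  obtain ⟨e', hne, he', hy⟩ := exists_other_edge hz (h.adj e (hA e he)).ne he
    (v := y) (by rw [hxy]; exact Sym2.mem_mk_right _ _)
  obtain ⟨w, hw⟩ := hy
  refine ⟨e', hne, he', w, hw, ?_, ?_⟩
  · have := h.adj e' (hA e' he')
    rw [← G.mem_edgeSet, hw] at this
    exact this
  · rintro rfl
    exact hne (h.inj e' (hA e' he') e (hA e he) (by rw [hw, hxy, Sym2.eq_swap]))

lemma four_le_card (h : G.IsEdgeList S s t A) (hG : G.CliqueFree 3) (hzA : ∀ e ∉ A, z e = 0)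
    (hz : edgeBoundary s t z = 0) (h0 : z ≠ 0) : 4 ≤ #{e | z e ≠ 0} ∧ (#{e | z e ≠ 0} = 4 →
      ∃ x y w u : V, ∃ a b c d : E, x ≠ w ∧ y ≠ u ∧ s(s a, t a) = s(x, y) ∧ s(s b, t b) = s(y, w) ∧
        s(s c, t c) = s(w, u) ∧ s(s d, t d) = s(u, x) ∧ [a, b, c, d].Nodup ∧
        ∀ e, z e ≠ 0 ↔ e = a ∨ e = b ∨ e = c ∨ e = d) := by
  classical
  have hA : ∀ e, z e ≠ 0 → e ∈ A := fun e he => by_contra fun h => he (hzA e h)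
  have htri : ∀ a b c, G.Adj a b → G.Adj b c → G.Adj c a → False := fun a b c hab hbc hca =>
    (SimpleGraph.is3Clique_triple_iff.2 ⟨hab, hca.symm, hbc⟩).not_cliqueFree hG
  obtain ⟨a, ha⟩ := Function.ne_iff.1 h0
  have hxy := h.adj a (hA a ha)
  obtain ⟨b, hba, hb, w, hyw, hyw', hwx⟩ := h.exists_next hzA hz ha (rfl : s(s a, t a) = _)
  obtain ⟨c, hcb, hc, u, hwu, hwu', huy⟩ := h.exists_next hzA hz hb hyw
  obtain ⟨d, hda, hd, u', hxu, hxu', huy'⟩ := h.exists_next hzA hz ha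
    (Sym2.eq_swap : s(s a, t a) = s(t a, s a))
  set x := s a
  set y := t a
  have hux : u ≠ x := by rintro rfl; exact htri x y w hxy hyw' hwu'
  have huw : u' ≠ w := by rintro rfl; exact htri x y u' hxy hyw' hxu'.symm
  have hca : c ≠ a := by
    rintro rfl
    have : w ∈ s(x, y) := by rw [show s(x, y) = s(s c, t c) from rfl, hwu]; simp
    rcases Sym2.mem_iff.1 this with h | h
    · exact hwx h
    · exact hyw'.ne h.symm
  have hdb : d ≠ b := by
    rintro rfl
    have : x ∈ s(y, w) := by rw [← hyw, hxu]; simp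
    rcases Sym2.mem_iff.1 this with h | h
    · exact hxy.ne h
    · exact hwx h.symm
  have hdc : d ≠ c := by
    rintro rfl
    have : x ∈ s(w, u) := by rw [← hwu, hxu]; simp
    rcases Sym2.mem_iff.1 this with h | h
    · exact hwx h.symm
    · exact hux h.symm
  have h4 : #{a, b, c, d} = 4 := by
    rw [card_insert_of_notMem, card_insert_of_notMem, card_pair hdc.symm]
    · simp [hcb.symm, hdb.symm]
    · simp [hba.symm, hca.symm, hda.symm]
  have hsub : {a, b, c, d} ⊆ ({e | z e ≠ 0} : Finset E) := by
    intro e he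
    simp only [mem_insert, mem_singleton] at he
    rcases he with rfl | rfl | rfl | rfl <;> simpa
  refine ⟨h4 ▸ card_le_card hsub, fun hcard => ?_⟩
  have heq := eq_of_subset_of_card_le hsub (by omega)
  have hiff : ∀ e, z e ≠ 0 ↔ e = a ∨ e = b ∨ e = c ∨ e = d := by
    intro e
    have := congrArg (e ∈ ·) heq
    simpa using this.symm
  refine ⟨x, y, w, u, a, b, c, d, hwx.symm, huy.symm, rfl, hyw, hwu, ?_,
    by simp [hba.symm, hca.symm, hda.symm, hcb.symm, hdb.symm, hdc.symm], hiff⟩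
  obtain ⟨e, hec, he, hue⟩ := exists_other_edge hz (h.adj c (hA c hc)).ne hc
    (v := u) (by rw [hwu]; exact Sym2.mem_mk_right _ _)
  have : u = u' := by
    rcases (hiff e).1 he with rfl | rfl | rfl | rfl
    · rcases Sym2.mem_iff.1 hue with h | h
      · exact (hux h).elim
      · exact (huy h).elim
    · rw [hyw] at hue
      rcases Sym2.mem_iff.1 hue with h | h
      · exact (huy h).elim
      · exact (hwu'.ne h.symm).elim
    · exact (hec rfl).elim
    · rw [hxu] at hue
      rcases Sym2.mem_iff.1 hue with h | h
      · exact (hux h).elim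
      · exact h
  rw [this, hxu, Sym2.eq_swap]

end SimpleGraph.IsEdgeList

lemma SimpleGraph.IsMacLane.dartsIn_le_four_mul (h : G.IsMacLane S) (hG : G.CliqueFree 3) :
    G.dartsIn S ≤ 4 * #S := by
  obtain rfl | hS := S.eq_empty_or_nonempty
  · simp [SimpleGraph.dartsIn]
  obtain ⟨E, F, _, _, s, t, A, φ, h, hA⟩ := h.exists_isEdgeList
  obtain ⟨B, -, hB, hB0, -, hsum⟩ := h.exists_faces hS hA.mem (linearIndepOn_empty (ZMod 2) φ) 1
  have h1 := card_nsmul_le_sum B (fun f => ∑ e with φ f e ≠ 0, (1 : E → ℕ) e) 4 fun f hf => by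
    simpa using (hA.four_le_card hG (h.supp f) (h.cycle f) (hB0 f hf)).1
  have h2 := hA.dartsIn_le
  simp only [Pi.one_apply, smul_eq_mul, sum_const, mul_one] at h1 hsum
  omega

/-- A triangle-free graph with many edges has a face of length four. -/
lemma IsTwoBasis.exists_four_face {E F : Type} [Fintype E] [Fintype F] {s t : E → V} {A : Finset E}
    {φ : F → E → ZMod 2} (h : IsTwoBasis s t A φ) (hA : G.IsEdgeList S s t A)
    (hG : G.CliqueFree 3) (hS : S.Nonempty) (hd : 10 * #S ≤ 3 * G.dartsIn S + 4) :
    ∃ f, φ f ≠ 0 ∧ #{e | φ f e ≠ 0} = 4 := by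
  obtain ⟨B, -, hB, hB0, -, hsum⟩ := h.exists_faces hS hA.mem (linearIndepOn_empty (ZMod 2) φ) 1
  by_contra! hcon
  have h1 := card_nsmul_le_sum B (fun f => ∑ e with φ f e ≠ 0, (1 : E → ℕ) e) 5 fun f hf => by
    have := (hA.four_le_card hG (h.supp f) (h.cycle f) (hB0 f hf)).1
    have := hcon f (hB0 f hf)
    simp only [Pi.one_apply, sum_const, smul_eq_mul, mul_one]
    omega
  have h2 := hA.dartsIn_le
  simp only [Pi.one_apply, smul_eq_mul, sum_const, mul_one] at h1 hsum
  omega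

end

section

variable {E F V : Type} [Fintype E] [Fintype F] {s t : E → V} {A : Finset E} {φ : F → E → ZMod 2}

lemma edgeBoundary_single_of_ends [DecidableEq E] {e : E} {x y : V} (h : s(s e, t e) = s(x, y)) :
    edgeBoundary s t (Pi.single e 1) = Finsupp.single x 1 + Finsupp.single y 1 := by
  rw [edgeBoundary_single]
  rcases Sym2.eq_iff.1 h with ⟨h1, h2⟩ | ⟨h1, h2⟩
  · rw [h1, h2]
  · rw [h1, h2, add_comm]

namespace IsTwoBasis

/-- Identifying two opposite vertices `x`, `w` of a face of length four. -/
lemma glue [DecidableEq V] (h : IsTwoBasis s t A φ) {f₀ : F} {a b c d : E} {x y w u : V}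
    (hxw : x ≠ w) (ha : s(s a, t a) = s(x, y)) (hb : s(s b, t b) = s(y, w))
    (hc : s(s c, t c) = s(w, u)) (hd : s(s d, t d) = s(u, x)) (hnd : [a, b, c, d].Nodup)
    (hf₀ : ∀ e, φ f₀ e ≠ 0 ↔ e = a ∨ e = b ∨ e = c ∨ e = d) :
    ∃ φ' : Option F → E → ZMod 2, IsTwoBasis ((fun v => if v = w then x else v) ∘ s)
      ((fun v => if v = w then x else v) ∘ t) A φ' := by
  classical
  set q : V → V := fun v => if v = w then x else v with hq
  have hqw : q w = x := by simp [hq]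
  have hqx : q x = x := by simp [hq]
  simp only [List.nodup_cons, List.mem_cons, List.not_mem_nil, or_false, not_or] at hnd
  obtain ⟨⟨hab, hac, had⟩, ⟨hbc, hbd⟩, hcd, -⟩ := hnd
  set M : E → ZMod 2 := Pi.single a 1 + Pi.single b 1 with hM
  set N : E → ZMod 2 := Pi.single c 1 + Pi.single d 1 with hN
  have hMN : φ f₀ = M + N := by
    ext e
    by_cases he : φ f₀ e = 0
    · have := (hf₀ e).not.1 (not_not.2 he)
      simp only [not_or] at this
      simp [hM, hN, he, this]
    · rw [zmod_two_eq_one he]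
      rcases (hf₀ e).1 he with rfl | rfl | rfl | rfl <;>
        simp [*, Ne.symm hab, Ne.symm hac, Ne.symm had, Ne.symm hbc, Ne.symm hbd,
          Ne.symm hcd]
  have hMN' : φ f₀ + N = M := by rw [hMN, add_assoc, add_self_of_zmod_two, add_zero]
  have hMA : ∀ e, M e ≠ 0 → (e = a ∨ e = b) := by
    intro e he
    by_contra! hcon
    exact he (by simp [hM, hcon])
  have hNA : ∀ e, N e ≠ 0 → (e = c ∨ e = d) := by
    intro e he
    by_contra! hcon
    exact he (by simp [hN, hcon])
  have hbM : edgeBoundary s t M = Finsupp.single x 1 + Finsupp.single w 1 := by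
    rw [hM, edgeBoundary_add, edgeBoundary_single_of_ends ha, edgeBoundary_single_of_ends hb]
    rw [add_assoc, ← add_assoc (Finsupp.single y 1), add_self_of_zmod_two, zero_add]
  have hbN : edgeBoundary s t N = Finsupp.single w 1 + Finsupp.single x 1 := by
    rw [hN, edgeBoundary_add, edgeBoundary_single_of_ends hc, edgeBoundary_single_of_ends hd]
    rw [add_assoc, ← add_assoc (Finsupp.single u 1), add_self_of_zmod_two, zero_add]
  have hbN' : edgeBoundary (q ∘ s) (q ∘ t) N = 0 := by
    rw [edgeBoundary_comp, hbN, Finsupp.mapDomain_add, Finsupp.mapDomain_single,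
      Finsupp.mapDomain_single, hqw, hqx, add_self_of_zmod_two]
  set ψ : F → E → ZMod 2 := fun f => φ f + if f = f₀ then N else 0 with hψ
  have hψ₀ : ψ f₀ = M := by simp [hψ, hMN']
  have hψ₁ : ∀ f, f ≠ f₀ → ψ f = φ f := fun f hf => by simp [hψ, hf]
  refine ⟨fun o => o.elim N ψ, ?_, ?_, ?_, ?_⟩
  · have hN0 : ∀ e ∉ A, N e = 0 := by
      intro e he
      by_contra h0
      refine (hf₀ e).2 ?_ (h.supp f₀ e he)
      have := hNA e h0
      tauto
    rintro (_ | f) e he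
    · exact hN0 e he
    · by_cases hf : f = f₀ <;> simp [hψ, h.supp f e he, hf, hN0 e he, h.supp f₀ e he]
  · rintro (_ | f)
    · exact hbN'
    · have : edgeBoundary (q ∘ s) (q ∘ t) (φ f) = 0 := by
        rw [edgeBoundary_comp, h.cycle, Finsupp.mapDomain_zero]
      by_cases hf : f = f₀
      · subst hf
        simp [hψ, edgeBoundary_add, this, hbN']
      · simp [hψ₁ f hf, this]
  · intro e
    refine le_trans (card_le_card_of_injOn (fun o => o.getD f₀) ?_ ?_) (h.two e)
    · rintro (_ | f) ho
      · have := hNA e (by simpa using ho)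
        have : φ f₀ e ≠ 0 := (hf₀ e).2 (by tauto)
        simpa using this
      · by_cases hf : f = f₀
        · subst hf
          have := hMA e (by simpa [hψ₀] using ho)
          have : φ f e ≠ 0 := (hf₀ e).2 (by tauto)
          simpa using this
        · simpa [hψ₁ f hf] using ho
    · have key : ∀ f, ψ f e ≠ 0 → N e ≠ 0 → f ≠ f₀ := by
        rintro f hf hNe rfl
        rw [hψ₀] at hf
        rcases hMA e hf with rfl | rfl <;> rcases hNA _ hNe with h | h <;> contradiction
      rintro (_ | f) ho (_ | f') ho' hoo
      · rfl
      · exact (key f' (by simpa using ho') (by simpa using ho) hoo.symm).elim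
      · exact (key f (by simpa using ho) (by simpa using ho') hoo).elim
      · exact congrArg some hoo
  · intro z hz hzA
    set r := edgeBoundary s t z with hr
    have h0 : r.mapDomain q = 0 := by rw [hr, ← edgeBoundary_comp, hz]
    have hrx : r = r x • (Finsupp.single x 1 + Finsupp.single w 1) := by
      set r' : V →₀ ZMod 2 := r.erase x |>.erase w with hr'
      have h1 : r = r' + Finsupp.single x (r x) + Finsupp.single w (r w) := by
        ext v
        by_cases hvx : v = x
        · subst hvx; simp [hr', hxw]
        · by_cases hvw : v = w
          · subst hvw; simp [hr', hxw]
          · simp [hr', hvx, hvw]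
      have hr'q : r'.mapDomain q = r' := by
        rw [Finsupp.mapDomain_congr (g := id), Finsupp.mapDomain_id]
        intro v hv
        have : v ≠ w := by rintro rfl; simp [hr'] at hv
        simp [hq, this]
      rw [h1, Finsupp.mapDomain_add, Finsupp.mapDomain_add, hr'q, Finsupp.mapDomain_single,
        Finsupp.mapDomain_single, hqw, hqx, add_assoc, ← Finsupp.single_add] at h0
      have h2 : r' = 0 ∧ r x + r w = 0 := by
        have hx : r' x = 0 := by simp [hr', hxw]
        have h3 := DFunLike.congr_fun h0 x
        simp only [Finsupp.add_apply, hx, Finsupp.single_eq_same, zero_add,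
          Finsupp.coe_zero, Pi.zero_apply] at h3
        rw [h3, Finsupp.single_zero, add_zero] at h0
        exact ⟨h0, h3⟩
      have h3 : r w = r x := by
        have := add_self_of_zmod_two (r x)
        exact add_left_cancel (h2.2.trans this.symm)
      conv_lhs => rw [h1, h2.1, h3]
      simp
    obtain ⟨γ, hγ⟩ := h.span (z + r x • M)
      (by rw [edgeBoundary_add, edgeBoundary_smul, hbM, ← hrx, ← hr, add_self_of_zmod_two])
      (by
        intro e he
        have : M e = 0 := by
          by_contra h0
          refine (hf₀ e).2 ?_ (h.supp f₀ e he)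
          have := hMA e h0
          tauto
        simp [hzA e he, this])
    refine ⟨fun o => o.elim (γ f₀) (fun f => γ f + if f = f₀ then r x else 0), ?_⟩
    have h1 : ∑ f, γ f • ψ f = (z + r x • M) + γ f₀ • N := by
      rw [hγ]
      simp only [hψ, smul_add, sum_add_distrib]
      congr 1
      rw [sum_eq_single f₀] <;> simp +contextual
    have h2 : ∑ f, (if f = f₀ then r x else 0) • ψ f = r x • M := by
      rw [sum_eq_single f₀] <;> simp +contextual [hψ₀]
    rw [Fintype.sum_option]
    simp only [Option.elim_none, Option.elim_some, add_smul, sum_add_distrib, h1, h2]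
    have e1 := add_self_of_zmod_two (γ f₀ • N)
    have e2 := add_self_of_zmod_two (r x • M)
    calc z = z + (γ f₀ • N + γ f₀ • N) + (r x • M + r x • M) := by rw [e1, e2, add_zero, add_zero]
      _ = _ := by abel

end IsTwoBasis

end

/-- The edges of a four-cycle `0, 1, 2, 3` together with paths `0, 4, 5, 2` and `1, 6, 7, 3`. -/
def crossingEdge : Fin 10 → Fin 8 × Fin 8 :=
  ![(0, 1), (1, 2), (2, 3), (3, 0), (0, 4), (4, 5), (5, 2), (1, 6), (6, 7), (7, 3)]

lemma crossingEdge_injective (i j : Fin 10)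
    (h : s((crossingEdge i).1, (crossingEdge i).2) = s((crossingEdge j).1, (crossingEdge j).2)) :
    i = j := by
  revert i j; decide

lemma three_le_weight (a b c d p q : ZMod 2) (h0 : a + (d + p) = 0) (h1 : a + (b + q) = 0)
    (h2 : b + (c + p) = 0) (h3 : c + (d + q) = 0)
    (hne : ¬ (a = 0 ∧ b = 0 ∧ c = 0 ∧ d = 0 ∧ p = 0 ∧ q = 0)) :
    3 ≤ (if a = 0 then 0 else 1) + ((if b = 0 then 0 else 1) + ((if c = 0 then 0 else 1) +
      ((if d = 0 then 0 else 1) + ((if p = 0 then 0 else 1) + if q = 0 then 0 else 1)))) := by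
  revert a b c d p q; decide

section

variable {E F V : Type} [Fintype E] [Fintype F] {s t : E → V} {A : Finset E} {φ : F → E → ZMod 2}

/-- Opposite pairs of vertices of a face of length four are not joined by disjoint paths. -/
lemma IsTwoBasis.no_crossing (h : IsTwoBasis s t A φ) {P : Fin 8 → V}
    (hP : Function.Injective P) {Q : Fin 10 → E} (hQA : ∀ i, Q i ∈ A)
    (hQ : ∀ i, s(s (Q i), t (Q i)) = s(P (crossingEdge i).1, P (crossingEdge i).2)) {f₀ : F}
    (hf₀ : ∀ e, φ f₀ e ≠ 0 ↔ e = Q 0 ∨ e = Q 1 ∨ e = Q 2 ∨ e = Q 3) : False := by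
  classical
  have hQinj : Function.Injective Q := by
    intro i j hij
    apply crossingEdge_injective
    apply Sym2.map.injective hP
    rw [Sym2.map_mk, Sym2.map_mk]
    exact (hQ i).symm.trans ((congrArg (fun e => s(s e, t e)) hij).trans (hQ j))
  obtain ⟨φ', h', hφ'⟩ := h.restrict (B := univ.image Q) (image_subset_iff.2 fun i _ => hQA i)
  have hφ₀ : φ' f₀ = φ f₀ := by
    refine hφ' f₀ fun e he => ?_
    by_contra h0
    rcases (hf₀ e).1 h0 with rfl | rfl | rfl | rfl <;> simp at he
  obtain ⟨c, hc⟩ : ∃ c : Fin 10 → ℕ, c = ![1, 1, 1, 1, 1, 0, 0, 1, 0, 0] := ⟨_, rfl⟩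
  obtain ⟨w, hw⟩ : ∃ w : E → ℕ, ∀ T : Finset E,
      ∑ e ∈ T, w e = ∑ i, if Q i ∈ T then c i else 0 := by
    refine ⟨fun e => ∑ i, if Q i = e then c i else 0, fun T => ?_⟩
    rw [sum_comm]
    exact sum_congr rfl fun i _ => sum_ite_eq _ _ _
  have hI : LinearIndepOn (ZMod 2) φ' {f₀} := by
    refine LinearIndepOn.singleton ?_
    rw [hφ₀]
    intro h0
    exact (hf₀ (Q 0)).2 (Or.inl rfl) (congrFun h0 _)
  have hmem : ∀ e ∈ univ.image Q, s e ∈ univ.image P ∧ t e ∈ univ.image P := by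
    intro e he
    obtain ⟨i, -, rfl⟩ := mem_image.1 he
    rcases Sym2.eq_iff.1 (hQ i) with ⟨h1, h2⟩ | ⟨h1, h2⟩ <;> simp [h1, h2]
  obtain ⟨B, hB, hcard, hB0, hBs, hsum⟩ := h'.exists_faces (S := univ.image P) (by simp) hmem hI w
  have key : ∀ z : E → ZMod 2, (∀ e ∉ univ.image Q, z e = 0) → edgeBoundary s t z = 0 → z ≠ 0 →
      3 ≤ ∑ e with z e ≠ 0, w e := by
    intro z hzA hz h0
    have hz' : z = ∑ i, z (Q i) • Pi.single (Q i) 1 := by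
      ext e
      rw [Finset.sum_apply]
      by_cases he : e ∈ univ.image Q
      · obtain ⟨j, -, rfl⟩ := mem_image.1 he
        rw [sum_eq_single j]
        · simp
        · intro i _ hij
          simp [hQinj.ne hij.symm]
        · simp
      · rw [hzA e he]
        refine (sum_eq_zero fun i _ => ?_).symm
        have : e ≠ Q i := by rintro rfl; simp at he
        simp [this]
    have hb : Finsupp.mapDomain P (∑ i, z (Q i) • (Finsupp.single (crossingEdge i).1 1 +
        Finsupp.single (crossingEdge i).2 1 : Fin 8 →₀ ZMod 2)) = 0 := by
      rw [← hz]
      conv_rhs => rw [hz']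
      rw [edgeBoundary_sum, Finsupp.mapDomain_finsetSum]
      refine sum_congr rfl fun i _ => ?_
      rw [edgeBoundary_smul, edgeBoundary_single_of_ends (hQ i), Finsupp.mapDomain_smul,
        Finsupp.mapDomain_add, Finsupp.mapDomain_single, Finsupp.mapDomain_single]
    rw [← Finsupp.mapDomain_zero (f := P)] at hb
    have hb' := Finsupp.mapDomain_injective hP hb
    have hv : ∀ v, ∑ i, ((if (crossingEdge i).1 = v then z (Q i) else 0) +
        if (crossingEdge i).2 = v then z (Q i) else 0) = 0 := by
      intro v
      simpa [Finsupp.finsetSum_apply, Finsupp.single_apply] using DFunLike.congr_fun hb' v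
    have h_eq : ∀ {x y : ZMod 2}, x + y = 0 → x = y := by decide
    have v0 := hv 0
    have v1 := hv 1
    have v2 := hv 2
    have v3 := hv 3
    have v4 := hv 4
    have v5 := hv 5
    have v6 := hv 6
    have v7 := hv 7
    simp [Fin.sum_univ_succ, crossingEdge] at v0 v1 v2 v3 v4 v5 v6 v7
    rw [hw]
    simp [Fin.sum_univ_succ, hc]
    have e5 := h_eq v4
    have e6 := h_eq v5
    have e8 := h_eq v6
    have e9 := h_eq v7
    rw [← e6, ← e5] at v2
    rw [← e9, ← e8] at v3
    refine three_le_weight _ _ _ _ _ _ v0 v1 v2 v3 ?_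
    rintro ⟨g0, g1, g2, g3, g4, g7⟩
    apply h0
    rw [hz']
    refine sum_eq_zero fun i _ => ?_
    have : z (Q i) = 0 := by
      fin_cases i
      exacts [g0, g1, g2, g3, g4, e5 ▸ g4, e6 ▸ e5 ▸ g4, g7, e8 ▸ g7, e9 ▸ e8 ▸ g7]
    rw [this, zero_smul]
  have hw0 : ∑ e with φ' f₀ e ≠ 0, w e = 4 := by
    rw [hw, hφ₀]
    simp [hf₀, hQinj.eq_iff, Fin.sum_univ_succ, hc]
  have hwA : ∑ e ∈ univ.image Q, w e = 6 := by
    rw [hw]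
    simp [hc, Fin.sum_univ_succ]
  rw [card_image_of_injective _ hP, card_image_of_injective _ hQinj, card_fin, card_fin] at hcard
  have hf₀B : f₀ ∈ B := by simpa using hB
  have h1 := card_nsmul_le_sum (B.erase f₀) (fun f => ∑ e with φ' f e ≠ 0, w e) 3 fun f hf =>
    key _ (h'.supp f) (h'.cycle f) (hB0 f (mem_of_mem_erase hf))
  have h2 := key (∑ f ∈ B, φ' f)
    (fun e he => by simp [h'.supp _ e he])
    (by simp [edgeBoundary_sum, h'.cycle]) (hBs ⟨f₀, hf₀B⟩)
  rw [← add_sum_erase _ _ hf₀B, hwA, hw0] at hsum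
  rw [card_erase_of_mem hf₀B, smul_eq_mul] at h1
  omega

end

section

variable {V : Type} {G : SimpleGraph V} {S : Finset V}

/-- The subgraph of `G` induced on `S`, with `w` identified with `x`. -/
def SimpleGraph.identify [DecidableEq V] (G : SimpleGraph V) (S : Finset V) (x w : V) :
    SimpleGraph V where
  Adj a b := a ≠ b ∧ ∃ c ∈ S, ∃ d ∈ S, (if c = w then x else c) = a ∧
    (if d = w then x else d) = b ∧ G.Adj c d
  symm := ⟨fun _ _ ⟨hab, c, hc, d, hd, ha, hb, h⟩ => ⟨hab.symm, d, hd, c, hc, hb, ha, h.symm⟩⟩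
  loopless := ⟨fun _ h => h.1 rfl⟩

variable [DecidableEq V]

lemma adj_of_identify_adj {x w a b : V} (h : (G.identify S x w).Adj a b) (ha : a ≠ x) :
    a ∈ S ∧ a ≠ w ∧ (b ≠ x → G.Adj a b ∧ b ∈ S ∧ b ≠ w) ∧
      (b = x → G.Adj a x ∨ G.Adj a w) := by
  obtain ⟨-, c, hc, d, hd, rfl, rfl, h⟩ := h
  by_cases hcw : c = w
  · simp [hcw] at ha
  · rw [if_neg hcw]
    refine ⟨hc, hcw, fun hb => ?_, fun hb => ?_⟩
    · by_cases hdw : d = w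
      · simp [hdw] at hb
      · rw [if_neg hdw]
        exact ⟨h, hd, hdw⟩
    · by_cases hdw : d = w
      · exact Or.inr (hdw ▸ h)
      · rw [if_neg hdw] at hb
        exact Or.inl (hb ▸ h)

lemma SimpleGraph.CliqueFree.not_triangle (hG : G.CliqueFree 3) {a b c : V} (hab : G.Adj a b)
    (hbc : G.Adj b c) (hca : G.Adj c a) : False :=
  (SimpleGraph.is3Clique_triple_iff.2 ⟨hab, hca.symm, hbc⟩).not_cliqueFree hG

/-- A triangle created by identifying `x` and `w` comes from a path of length three. -/
lemma exists_path_of_not_cliqueFree_identify (hG : G.CliqueFree 3) {x w : V}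
    (h : ¬ (G.identify S x w).CliqueFree 3) :
    ∃ p ∈ S, ∃ r ∈ S, G.Adj x p ∧ G.Adj p r ∧ G.Adj r w := by
  have key : ∀ b c, (G.identify S x w).Adj x b → (G.identify S x w).Adj b c →
      (G.identify S x w).Adj c x → ∃ p ∈ S, ∃ r ∈ S, G.Adj x p ∧ G.Adj p r ∧ G.Adj r w := by
    intro b c hxb hbc hcx
    obtain ⟨hbS, -, h1, -⟩ := adj_of_identify_adj hbc hxb.ne.symm
    obtain ⟨hbc, hcS, -⟩ := h1 hcx.ne
    have hb := (adj_of_identify_adj hxb.symm hxb.ne.symm).2.2.2 rfl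
    have hc := (adj_of_identify_adj hcx hcx.ne).2.2.2 rfl
    rcases hb with hb | hb <;> rcases hc with hc | hc
    · exact (hG.not_triangle hb.symm hbc hc).elim
    · exact ⟨b, hbS, c, hcS, hb.symm, hbc, hc⟩
    · exact ⟨c, hcS, b, hbS, hc.symm, hbc.symm, hb⟩
    · exact (hG.not_triangle hb.symm hbc hc).elim
  simp only [SimpleGraph.CliqueFree, not_forall, not_not] at h
  obtain ⟨T, hT⟩ := h
  obtain ⟨a, b, c, hab, hac, hbc, rfl⟩ := SimpleGraph.is3Clique_iff.1 hT
  by_cases ha : a = x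
  · subst ha; exact key b c hab hbc hac.symm
  by_cases hb : b = x
  · subst hb; exact key c a hbc hac.symm hab
  by_cases hc : c = x
  · subst hc; exact key a b hac.symm hab hbc
  have h1 := ((adj_of_identify_adj hab ha).2.2.1 hb).1
  have h2 := ((adj_of_identify_adj hbc hb).2.2.1 hc).1
  have h3 := ((adj_of_identify_adj hac ha).2.2.1 hc).1
  exact (hG.not_triangle h1 h2 h3.symm).elim

lemma threeColOn_of_identify {x w : V} (hx : x ∈ S) (hxw : x ≠ w) (hadj : ¬ G.Adj x w)
    (h : (G.identify S x w).ThreeColOn (S.erase w)) : G.ThreeColOn S := by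
  obtain ⟨f, hf⟩ := h
  have hq : ∀ v ∈ S, (if v = w then x else v) ∈ S.erase w := by
    intro v hv
    split_ifs with h
    · exact mem_erase.2 ⟨hxw, hx⟩
    · exact mem_erase.2 ⟨h, hv⟩
  refine ⟨fun v => f (if v = w then x else v), fun u hu v hv huv => hf _ (hq u hu) _ (hq v hv)
    ⟨?_, u, hu, v, hv, rfl, rfl, huv⟩⟩
  split_ifs with h1 h2 h2
  · exact (huv.ne (h1.trans h2.symm)).elim
  · rintro rfl; exact hadj (h1 ▸ huv.symm)
  · rintro rfl; exact hadj (h2 ▸ huv)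
  · exact huv.ne

lemma IsTwoBasis.isMacLane_identify {E F : Type} [Fintype E] [Fintype F] {s t : E → V}
    {A : Finset E} {φ : F → E → ZMod 2} {x w : V}
    (h : IsTwoBasis ((fun v => if v = w then x else v) ∘ s)
      ((fun v => if v = w then x else v) ∘ t) A φ) (hA : G.IsEdgeList S s t A) :
    (G.identify S x w).IsMacLane (S.erase w) := by
  refine ⟨E, F, _, _, _, _, A, φ, h, ?_⟩
  rintro u - v - ⟨-, c, hc, d, hd, rfl, rfl, hcd⟩
  obtain ⟨e, he, hee⟩ := hA.rep c hc d hd hcd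
  exact ⟨e, he, congrArg (Sym2.map fun v => if v = w then x else v) hee⟩

lemma SimpleGraph.IsMacLane.exists_identify (h : G.IsMacLane S) (hG : G.CliqueFree 3)
    (hS : S.Nonempty) (hd : 10 * #S ≤ 3 * G.dartsIn S + 4) : ∃ x ∈ S, ∃ w ∈ S, x ≠ w ∧
      ¬ G.Adj x w ∧ (G.identify S x w).IsMacLane (S.erase w) ∧
      (G.identify S x w).CliqueFree 3 := by
  obtain ⟨E, F, _, _, s, t, A, φ, h, hA⟩ := h.exists_isEdgeList
  obtain ⟨f₀, hf, hf4⟩ := h.exists_four_face hA hG hS hd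
  obtain ⟨x, y, w, u, a, b, c, d, hxw, hyu, ha, hb, hc, hd, hnd, hiff⟩ :=
    (hA.four_le_card hG (h.supp f₀) (h.cycle f₀) hf).2 hf4
  have hmem : ∀ e, φ f₀ e ≠ 0 → e ∈ A := fun e he => by_contra fun h' => he (h.supp f₀ e h')
  have haA := hmem a ((hiff a).2 (by simp))
  have hbA := hmem b ((hiff b).2 (by simp))
  have hcA := hmem c ((hiff c).2 (by simp))
  have hdA := hmem d ((hiff d).2 (by simp))
  have hadj : ∀ e ∈ A, ∀ p r, s(s e, t e) = s(p, r) → G.Adj p r ∧ p ∈ S := by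
    intro e he p r hpr
    have h1 := hA.adj e he
    have h2 := hA.mem e he
    rcases Sym2.eq_iff.1 hpr with ⟨rfl, rfl⟩ | ⟨rfl, rfl⟩
    · exact ⟨h1, h2.1⟩
    · exact ⟨h1.symm, h2.2⟩
  obtain ⟨hxy, hxS⟩ := hadj a haA x y ha
  obtain ⟨hyw, hyS⟩ := hadj b hbA y w hb
  obtain ⟨hwu, hwS⟩ := hadj c hcA w u hc
  obtain ⟨hux, huS⟩ := hadj d hdA u x hd
  by_contra! hcon
  obtain ⟨φ₁, h₁⟩ := h.glue hxw ha hb hc hd hnd hiff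
  obtain ⟨φ₂, h₂⟩ := h.glue hyu hb hc hd ha (List.nodup_rotate (n := 1) |>.2 hnd)
    (fun e => (hiff e).trans (by tauto))
  obtain ⟨p, hpS, r, hrS, hxp, hpr, hrw⟩ := exists_path_of_not_cliqueFree_identify hG
    (hcon x hxS w hwS hxw (fun h => hG.not_triangle hxy hyw h.symm) (h₁.isMacLane_identify hA))
  obtain ⟨p', hpS', r', hrS', hyp, hpr', hru⟩ := exists_path_of_not_cliqueFree_identify hG
    (hcon y hyS u huS hyu (fun h => hG.not_triangle hyw hwu h.symm) (h₂.isMacLane_identify hA))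
  obtain ⟨e₁, he₁, hxp'⟩ := hA.rep x hxS p hpS hxp
  obtain ⟨e₂, he₂, hpr''⟩ := hA.rep p hpS r hrS hpr
  obtain ⟨e₃, he₃, hrw'⟩ := hA.rep r hrS w hwS hrw
  obtain ⟨e₄, he₄, hyp'⟩ := hA.rep y hyS p' hpS' hyp
  obtain ⟨e₅, he₅, hpr'''⟩ := hA.rep p' hpS' r' hrS' hpr'
  obtain ⟨e₆, he₆, hru'⟩ := hA.rep r' hrS' u huS hru
  refine h.no_crossing (P := ![x, y, w, u, p, r, p', r'])
    (Q := ![a, b, c, d, e₁, e₂, e₃, e₄, e₅, e₆]) (f₀ := f₀) ?_ ?_ ?_ hiff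
  · rw [← List.nodup_ofFn]
    have tri := fun {i j k} => hG.not_triangle (a := i) (b := j) (c := k)
    have d1 : p ≠ y := by rintro rfl; exact tri hyw hrw.symm hpr.symm
    have d2 : p ≠ w := by rintro rfl; exact tri hxy hyw hxp.symm
    have d3 : p ≠ u := by rintro rfl; exact tri hpr hrw hwu
    have d4 : r ≠ x := by rintro rfl; exact tri hxy hyw hrw.symm
    have d5 : r ≠ y := by rintro rfl; exact tri hxy hpr.symm hxp.symm
    have d6 : r ≠ u := by rintro rfl; exact tri hux hxp hpr
    have d7 : p' ≠ x := by rintro rfl; exact tri hux hpr' hru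
    have d8 : p' ≠ w := by rintro rfl; exact tri hpr' hru hwu.symm
    have d9 : p' ≠ u := by rintro rfl; exact tri hyw hwu hyp.symm
    have d10 : r' ≠ x := by rintro rfl; exact tri hxy hyp hpr'
    have d11 : r' ≠ y := by rintro rfl; exact tri hyw hwu hru.symm
    have d12 : r' ≠ w := by rintro rfl; exact tri hyw hpr'.symm hyp.symm
    have d13 : p ≠ p' := by rintro rfl; exact tri hxy hyp hxp.symm
    have d14 : p ≠ r' := by rintro rfl; exact tri hxp hru hux
    have d15 : r ≠ p' := by rintro rfl; exact tri hyp hrw hyw.symm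
    have d16 : r ≠ r' := by rintro rfl; exact tri hrw hwu hru.symm
    simp [hxy.ne, hxw, hux.ne.symm, hxp.ne, d4.symm, d7.symm, d10.symm, hyw.ne, hyu, d1.symm,
      d5.symm, hyp.ne, d11.symm, hwu.ne, d2.symm, hrw.ne.symm, d8.symm, d12.symm, d3.symm,
      d6.symm, d9.symm, hru.ne.symm, hpr.ne, d13, d14, d15, d16, hpr'.ne]
  · intro i
    fin_cases i <;> assumption
  · intro i
    fin_cases i <;> assumption

end

/-- Grötzsch's theorem. -/
theorem SimpleGraph.IsMacLane.threeColOn {V : Type} {G : SimpleGraph V} {S : Finset V}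
    (h : G.IsMacLane S) (hG : G.CliqueFree 3) : G.ThreeColOn S := by
  classical
  induction hn : #S using Nat.strong_induction_on generalizing G S with
  | _ n ih =>
    subst hn
    by_contra hcol
    obtain ⟨W, hWS, hW, hpot⟩ := exists_potential_le_two G S hcol
    obtain rfl : W = S := by
      by_contra hne
      exact hW (ih _ (card_lt_card (hWS.ssubset_of_ne hne)) (h.mono hWS) hG rfl)
    have h2 := two_mul_potential G W
    have hne : W.Nonempty := by
      rw [nonempty_iff_ne_empty]
      rintro rfl
      exact hW ⟨0, by simp⟩
    obtain ⟨x, hx, w, hw, hxw, hadj, hM, hC⟩ := h.exists_identify hG hne (by omega)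
    exact hcol (threeColOn_of_identify hx hxw hadj (ih _ (card_erase_lt_of_mem hw) hM hC rfl))

/-- The lower left end of an edge of the `N × N` grid. -/
def gridSource (N : ℕ) (e : Fin N × Fin N × Bool) : ℕ × ℕ := (e.1, e.2.1)

/-- The upper right end of an edge of the `N × N` grid. -/
def gridTarget (N : ℕ) (e : Fin N × Fin N × Bool) : ℕ × ℕ :=
  if e.2.2 then (e.1 + 1, e.2.1) else (e.1, e.2.1 + 1)

/-- The unit square at `f` as a cycle of the grid; zero if it leaves the grid. -/
def gridSquare (N : ℕ) (f : Fin N × Fin N) : Fin N × Fin N × Bool → ZMod 2 :=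
  if h : (f.1 : ℕ) + 1 < N ∧ (f.2 : ℕ) + 1 < N then
    Pi.single (f.1, f.2, true) 1 + Pi.single (f.1, f.2, false) 1 +
      Pi.single (⟨f.1 + 1, h.1⟩, f.2, false) 1 + Pi.single (f.1, ⟨f.2 + 1, h.2⟩, true) 1
  else 0

lemma sum_edgeBoundary_eq {E V : Type*} [Fintype E] [DecidableEq V] (s t : E → V) (z : E → ZMod 2)
    (X : Finset V) : ∑ v ∈ X, edgeBoundary s t z v =
      ∑ e, ((if s e ∈ X then z e else 0) + if t e ∈ X then z e else 0) := by
  simp only [edgeBoundary_apply]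
  rw [sum_comm]
  refine sum_congr rfl fun e _ => ?_
  rw [sum_add_distrib, sum_ite_eq, sum_ite_eq]

lemma gridSquare_apply_true {N : ℕ} (f : Fin N × Fin N) (a b : Fin N) :
    gridSquare N f (a, b, true) =
      if (f.1 : ℕ) + 1 < N ∧ (f.2 : ℕ) + 1 < N ∧ a = f.1 ∧ (b = f.2 ∨ (b : ℕ) = f.2 + 1) then 1
      else 0 := by
  obtain ⟨i, j⟩ := f
  by_cases h : (i : ℕ) + 1 < N ∧ (j : ℕ) + 1 < N
  · simp only [gridSquare, h, and_self, dif_pos, Pi.add_apply, Pi.single_apply, Prod.mk.injEq,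
      Fin.ext_iff, true_and, and_true, and_false, if_false, reduceCtorEq, add_zero]
    split_ifs <;> first | omega | simp
  · have : ¬ ((i : ℕ) + 1 < N ∧ (j : ℕ) + 1 < N ∧ a = i ∧ (b = j ∨ (b : ℕ) = j + 1)) := by tauto
    simp [gridSquare, h, this]

lemma gridSquare_apply_false {N : ℕ} (f : Fin N × Fin N) (a b : Fin N) :
    gridSquare N f (a, b, false) =
      if (f.1 : ℕ) + 1 < N ∧ (f.2 : ℕ) + 1 < N ∧ b = f.2 ∧ (a = f.1 ∨ (a : ℕ) = f.1 + 1) then 1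
      else 0 := by
  obtain ⟨i, j⟩ := f
  by_cases h : (i : ℕ) + 1 < N ∧ (j : ℕ) + 1 < N
  · simp only [gridSquare, h, and_self, dif_pos, Pi.add_apply, Pi.single_apply, Prod.mk.injEq,
      Fin.ext_iff, true_and, and_true, and_false, if_false, reduceCtorEq, add_zero, zero_add]
    split_ifs <;> first | omega | simp
  · have : ¬ ((i : ℕ) + 1 < N ∧ (j : ℕ) + 1 < N ∧ b = j ∧ (a = i ∨ (a : ℕ) = i + 1)) := by tauto
    simp [gridSquare, h, this]

lemma edgeBoundary_gridSquare {N : ℕ} (f : Fin N × Fin N) :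
    edgeBoundary (gridSource N) (gridTarget N) (gridSquare N f) = 0 := by
  unfold gridSquare
  split_ifs with h
  · simp only [edgeBoundary_add, edgeBoundary_single, gridSource, gridTarget, if_true]
    simp only [Bool.false_eq_true, if_false]
    generalize (Finsupp.single ((f.1 : ℕ), (f.2 : ℕ)) (1 : ZMod 2)) = p
    generalize (Finsupp.single ((f.1 : ℕ) + 1, (f.2 : ℕ)) (1 : ZMod 2)) = q
    generalize (Finsupp.single ((f.1 : ℕ), (f.2 : ℕ) + 1) (1 : ZMod 2)) = r
    generalize (Finsupp.single ((f.1 : ℕ) + 1, (f.2 : ℕ) + 1) (1 : ZMod 2)) = o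
    have h1 := add_self_of_zmod_two p
    have h2 := add_self_of_zmod_two q
    have h3 := add_self_of_zmod_two r
    have h4 := add_self_of_zmod_two o
    calc _ = (p + p) + (q + q) + (r + r) + (o + o) := by abel
      _ = 0 := by rw [h1, h2, h3, h4]; simp
  · exact edgeBoundary_zero

lemma card_gridSquare_ne_zero_le {N : ℕ} (e : Fin N × Fin N × Bool) :
    #{f | gridSquare N f e ≠ 0} ≤ 2 := by
  obtain ⟨a, b, k⟩ := e
  have hb : (b : ℕ) - 1 < N := by omega
  have ha : (a : ℕ) - 1 < N := by omega
  cases k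
  · refine (card_le_card (t := {(a, b), (⟨a - 1, ha⟩, b)}) ?_).trans card_le_two
    rintro ⟨i, j⟩ h
    simp only [gridSquare_apply_false, ne_eq, ite_eq_right_iff, one_ne_zero, imp_false,
      not_not, mem_filter, mem_univ, true_and] at h
    simp only [mem_insert, mem_singleton, Prod.mk.injEq, Fin.ext_iff] at h ⊢
    omega
  · refine (card_le_card (t := {(a, b), (a, ⟨b - 1, hb⟩)}) ?_).trans card_le_two
    rintro ⟨i, j⟩ h
    simp only [gridSquare_apply_true, ne_eq, ite_eq_right_iff, one_ne_zero, imp_false,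
      not_not, mem_filter, mem_univ, true_and] at h
    simp only [mem_insert, mem_singleton, Prod.mk.injEq, Fin.ext_iff] at h ⊢
    omega

section

variable {N : ℕ} {z : Fin N × Fin N × Bool → ZMod 2}

/-- The sum of a chain over the vertical edges at height `b` up to column `a`. -/
def verticalSum (z : Fin N × Fin N × Bool → ZMod 2) (a b : ℕ) : ZMod 2 :=
  ∑ e, if e.2.2 = false ∧ (e.1 : ℕ) ≤ a ∧ (e.2.1 : ℕ) = b then z e else 0

lemma cut_eq_zero (hz : edgeBoundary (gridSource N) (gridTarget N) z = 0) (X : Finset (ℕ × ℕ)) :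
    ∑ e, ((if gridSource N e ∈ X then z e else 0) + if gridTarget N e ∈ X then z e else 0) = 0 := by
  rw [← sum_edgeBoundary_eq, hz]
  simp

lemma add_eq_zero_of_zmod_two {x y : ZMod 2} (h : x + y = 0) : x = y := by
  revert x y; decide

lemma horizontal_eq (hz : edgeBoundary (gridSource N) (gridTarget N) z = 0) (a b : Fin N) :
    z (a, b, true) = verticalSum z a b + if 1 ≤ (b : ℕ) then verticalSum z a (b - 1) else 0 := by
  refine add_eq_zero_of_zmod_two (.trans ?_ (cut_eq_zero hz (range (a + 1) ×ˢ {(b : ℕ)})))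
  have h1 : z (a, b, true) = ∑ e, if e = (a, b, true) then z e else 0 := by simp
  have h2 : (if 1 ≤ (b : ℕ) then verticalSum z a (b - 1) else 0) = ∑ e : Fin N × Fin N × Bool,
      if e.2.2 = false ∧ (e.1 : ℕ) ≤ a ∧ (e.2.1 : ℕ) + 1 = b then z e else 0 := by
    split_ifs with hb
    · exact sum_congr rfl fun e _ => if_congr (and_congr_right' (by omega)) rfl rfl
    · exact (sum_eq_zero fun e _ => if_neg (by omega)).symm
  rw [h1, h2, verticalSum, ← sum_add_distrib, ← sum_add_distrib]
  refine sum_congr rfl ?_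
  rintro ⟨i, j, k⟩ -
  have hzz := add_self_of_zmod_two (z (i, j, k))
  cases k <;> simp only [gridSource, gridTarget, mem_product, mem_range, mem_singleton,
    Prod.mk.injEq, Fin.ext_iff, reduceCtorEq, and_false, false_and, if_false, if_true,
    true_and, and_true, zero_add, Bool.false_eq_true, add_zero]
  · congr 1 <;> exact if_congr (by omega) rfl rfl
  · split_ifs <;> first | omega | simp [hzz]

lemma horizontal_eq_zero (hz : edgeBoundary (gridSource N) (gridTarget N) z = 0) (a b : Fin N)
    (ha : ¬ (a : ℕ) + 1 < N) : z (a, b, true) = 0 := by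
  refine .trans ?_ (cut_eq_zero hz {((a : ℕ) + 1, (b : ℕ))})
  have h1 : z (a, b, true) = ∑ e, if e = (a, b, true) then z e else 0 := by simp
  rw [h1]
  refine sum_congr rfl ?_
  rintro ⟨i, j, k⟩ -
  cases k <;> simp only [gridSource, gridTarget, mem_singleton, Prod.mk.injEq, Fin.ext_iff,
    and_false, if_false, if_true, and_true, Bool.false_eq_true] <;>
    split_ifs <;> first | omega | simp

lemma vertical_eq_zero (hz : edgeBoundary (gridSource N) (gridTarget N) z = 0) (a b : Fin N)
    (hb : ¬ (b : ℕ) + 1 < N) : z (a, b, false) = 0 := by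
  refine .trans ?_ (cut_eq_zero hz {((a : ℕ), (b : ℕ) + 1)})
  have h1 : z (a, b, false) = ∑ e, if e = (a, b, false) then z e else 0 := by simp
  rw [h1]
  refine sum_congr rfl ?_
  rintro ⟨i, j, k⟩ -
  cases k <;> simp only [gridSource, gridTarget, mem_singleton, Prod.mk.injEq, Fin.ext_iff,
    reduceCtorEq, and_false, if_false, if_true, and_true, Bool.false_eq_true] <;>
    split_ifs <;> first | omega | simp

lemma verticalSum_eq_zero (hz : edgeBoundary (gridSource N) (gridTarget N) z = 0) (a : Fin N)
    (b : ℕ) (ha : ¬ (a : ℕ) + 1 < N) : verticalSum z a b = 0 := by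
  refine .trans ?_ (cut_eq_zero hz (range (N + 1) ×ˢ range (b + 1)))
  refine sum_congr rfl ?_
  rintro ⟨i, j, k⟩ -
  have hzz := add_self_of_zmod_two (z (i, j, k))
  cases k <;> simp only [gridSource, gridTarget, mem_product, mem_range,
    reduceCtorEq, false_and, if_false, if_true,
    true_and, Bool.false_eq_true] <;>
    split_ifs <;> first | omega | simp [hzz]

lemma vertical_eq (a b : Fin N) :
    z (a, b, false) = verticalSum z a b + if 1 ≤ (a : ℕ) then verticalSum z (a - 1) b else 0 := by
  refine add_eq_zero_of_zmod_two ?_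
  have h1 : z (a, b, false) = ∑ e, if e = (a, b, false) then z e else 0 := by simp
  have h2 : (if 1 ≤ (a : ℕ) then verticalSum z (a - 1) b else 0) = ∑ e : Fin N × Fin N × Bool,
      if e.2.2 = false ∧ (e.1 : ℕ) < a ∧ (e.2.1 : ℕ) = b then z e else 0 := by
    split_ifs with hb
    · exact sum_congr rfl fun e _ => if_congr (and_congr_right' (by omega)) rfl rfl
    · exact (sum_eq_zero fun e _ => if_neg (by omega)).symm
  rw [h1, h2, verticalSum, ← sum_add_distrib, ← sum_add_distrib]
  refine sum_eq_zero ?_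
  rintro ⟨i, j, k⟩ -
  have hzz := add_self_of_zmod_two (z (i, j, k))
  cases k
  · simp only [Prod.mk.injEq, Fin.ext_iff, true_and, and_true]
    split_ifs <;> first | omega | simp [hzz]
  · simp

lemma grid_span (hz : edgeBoundary (gridSource N) (gridTarget N) z = 0) :
    z = ∑ f : Fin N × Fin N, verticalSum z f.1 f.2 • gridSquare N f := by
  funext ⟨a, b, k⟩
  have hb : (b : ℕ) - 1 < N := by omega
  have ha : (a : ℕ) - 1 < N := by omega
  rw [Finset.sum_apply]
  cases k
  · have hpt : ∀ f : Fin N × Fin N, (verticalSum z f.1 f.2 • gridSquare N f) (a, b, false) =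
        (if f = (a, b) then (if (a : ℕ) + 1 < N ∧ (b : ℕ) + 1 < N then verticalSum z a b else 0)
          else 0) + if f = (⟨a - 1, ha⟩, b) then (if 1 ≤ (a : ℕ) ∧ (b : ℕ) + 1 < N then
            verticalSum z (a - 1) b else 0) else 0 := by
      rintro ⟨i, j⟩
      simp only [Pi.smul_apply, gridSquare_apply_false, smul_eq_mul, mul_ite, mul_one, mul_zero,
        Prod.mk.injEq]
      by_cases h1 : i = a ∧ j = b
      · obtain ⟨rfl, rfl⟩ := h1
        simp only [Fin.ext_iff, true_or, and_true, and_self, if_true]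
        split_ifs <;> first | omega | simp
      · rw [if_neg h1, zero_add]
        by_cases h2 : i = ⟨a - 1, ha⟩ ∧ j = b
        · obtain ⟨rfl, rfl⟩ := h2
          simp only [Fin.ext_iff, and_true, true_and, if_true] at h1 ⊢
          exact if_congr (by omega) rfl rfl
        · rw [if_neg h2, if_neg]
          simp only [Fin.ext_iff] at *
          omega
    simp only [hpt, sum_add_distrib, sum_ite_eq', mem_univ, if_true]
    by_cases h1 : (b : ℕ) + 1 < N
    · rw [vertical_eq (z := z)]
      by_cases h2 : (a : ℕ) + 1 < N
      · simp [h1, h2]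
      · simp [h1, h2, verticalSum_eq_zero hz a b h2]
    · simp [h1, vertical_eq_zero hz a b h1]
  · have hpt : ∀ f : Fin N × Fin N, (verticalSum z f.1 f.2 • gridSquare N f) (a, b, true) =
        (if f = (a, b) then (if (a : ℕ) + 1 < N ∧ (b : ℕ) + 1 < N then verticalSum z a b else 0)
          else 0) + if f = (a, ⟨b - 1, hb⟩) then (if 1 ≤ (b : ℕ) ∧ (a : ℕ) + 1 < N then
            verticalSum z a (b - 1) else 0) else 0 := by
      rintro ⟨i, j⟩
      simp only [Pi.smul_apply, gridSquare_apply_true, smul_eq_mul, mul_ite, mul_one, mul_zero,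
        Prod.mk.injEq]
      by_cases h1 : i = a ∧ j = b
      · obtain ⟨rfl, rfl⟩ := h1
        simp only [Fin.ext_iff, true_or, and_true, and_self, if_true]
        split_ifs <;> first | omega | simp
      · rw [if_neg h1, zero_add]
        by_cases h2 : i = a ∧ j = ⟨b - 1, hb⟩
        · obtain ⟨rfl, rfl⟩ := h2
          simp only [Fin.ext_iff, and_true, true_and, if_true] at h1 ⊢
          exact if_congr (by omega) rfl rfl
        · rw [if_neg h2, if_neg]
          simp only [Fin.ext_iff] at *
          omega
    simp only [hpt, sum_add_distrib, sum_ite_eq', mem_univ, if_true]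
    by_cases h1 : (a : ℕ) + 1 < N
    · rw [horizontal_eq hz]
      by_cases h2 : (b : ℕ) + 1 < N
      · simp [h1, h2]
      · have h3 := horizontal_eq hz a b
        have h4 : verticalSum z a b = 0 := by
          refine sum_eq_zero ?_
          rintro ⟨i, j, k⟩ -
          split_ifs with h
          · obtain ⟨rfl, -, h⟩ := h
            exact vertical_eq_zero hz i j (by simp only at h; omega)
          · rfl
        simp [h1, h2, h4]
    · simp [h1, horizontal_eq_zero hz a b h1]

end

lemma isTwoBasis_gridSquare (N : ℕ) :
    IsTwoBasis (gridSource N) (gridTarget N) univ (gridSquare N) where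
  supp _ e he := (he (mem_univ e)).elim
  cycle := edgeBoundary_gridSquare
  two := card_gridSquare_ne_zero_le
  span _ hz _ := ⟨_, grid_span hz⟩

/-- Adjacency of cells of the infinite grid. -/
def GridAdj (x y : ℕ × ℕ) : Prop :=
  (y = (x.1 + 1, x.2) ∨ y = (x.1, x.2 + 1)) ∨ (x = (y.1 + 1, y.2) ∨ x = (y.1, y.2 + 1))

lemma GridAdj.symm {x y : ℕ × ℕ} (h : GridAdj x y) : GridAdj y x := Or.symm h

/-- Two cells are joined by a path of the grid inside `X`. -/
def GridJoined (X : Set (ℕ × ℕ)) : ℕ × ℕ → ℕ × ℕ → Prop :=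
  Relation.ReflTransGen fun x y => x ∈ X ∧ y ∈ X ∧ GridAdj x y

lemma GridAdj.exists_edge {N : ℕ} {x y : ℕ × ℕ} (h : GridAdj x y) (hx : x.1 < N ∧ x.2 < N)
    (hy : y.1 < N ∧ y.2 < N) : ∃ e, s(gridSource N e, gridTarget N e) = s(x, y) := by
  rcases h with (h | h) | (h | h)
  · exact ⟨(⟨x.1, hx.1⟩, ⟨x.2, hx.2⟩, true), by simp [gridSource, gridTarget, h]⟩
  · exact ⟨(⟨x.1, hx.1⟩, ⟨x.2, hx.2⟩, false), by simp [gridSource, gridTarget, h]⟩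
  · exact ⟨(⟨y.1, hy.1⟩, ⟨y.2, hy.2⟩, true), by simp [gridSource, gridTarget, h]⟩
  · exact ⟨(⟨y.1, hy.1⟩, ⟨y.2, hy.2⟩, false), by simp [gridSource, gridTarget, h]⟩

/-- A graph obtained by contracting connected branch sets of a grid has a `2`-basis. -/
theorem SimpleGraph.isMacLane_of_branchSets {V : Type} [Nonempty V] {G : SimpleGraph V}
    (S : Finset V) (N : ℕ) (B : V → Set (ℕ × ℕ)) (hN : ∀ v, ∀ x ∈ B v, x.1 < N ∧ x.2 < N)
    (hdisj : ∀ v w x, x ∈ B v → x ∈ B w → v = w)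
    (hconn : ∀ v, ∀ x ∈ B v, ∀ y ∈ B v, GridJoined (B v) x y)
    (hadj : ∀ u v, G.Adj u v → ∃ x ∈ B u, ∃ y ∈ B v, GridAdj x y) : G.IsMacLane S := by
  classical
  have hq : ∃ q : ℕ × ℕ → V, ∀ v, ∀ x ∈ B v, q x = v := by
    refine ⟨fun x => if h : ∃ v, x ∈ B v then h.choose else Classical.arbitrary V, ?_⟩
    intro v x hx
    have h : ∃ v, x ∈ B v := ⟨v, hx⟩
    simp only [h, dif_pos]
    exact hdisj _ _ x h.choose_spec hx
  obtain ⟨q, hq⟩ := hq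
  let A : Finset (Fin N × Fin N × Bool) :=
    {e | (∃ v, gridSource N e ∈ B v) ∧ ∃ v, gridTarget N e ∈ B v}
  let T : Finset (Fin N × Fin N × Bool) := {e ∈ A | q (gridSource N e) = q (gridTarget N e)}
  obtain ⟨φ, hφ, -⟩ := (isTwoBasis_gridSquare N).restrict (subset_univ A)
  have hedge : ∀ u v x y, x ∈ B u → y ∈ B v → GridAdj x y →
      ∃ e ∈ A, s(gridSource N e, gridTarget N e) = s(x, y) := by
    intro u v x y hx hy hxy
    obtain ⟨e, he⟩ := hxy.exists_edge (hN u x hx) (hN v y hy)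
    refine ⟨e, ?_, he⟩
    simp only [A, mem_filter, mem_univ, true_and]
    rcases Sym2.eq_iff.1 he with ⟨h1, h2⟩ | ⟨h1, h2⟩
    · exact ⟨⟨u, h1 ▸ hx⟩, v, h2 ▸ hy⟩
    · exact ⟨⟨v, h1 ▸ hy⟩, u, h2 ▸ hx⟩
  refine ⟨_, _, inferInstance, inferInstance, _, _, _, _,
    hφ.contract q (T := T) (filter_subset _ _) (fun e he => (mem_filter.1 he).2)
      (P := {x | ∃ v, x ∈ B v}) (fun e he => (mem_filter.1 he).2) ?_, ?_⟩
  · rintro x ⟨v, hx⟩ y ⟨w, hy⟩ hxy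
    rw [hq v x hx, hq w y hy] at hxy
    subst hxy
    have := hconn v x hx y hy
    clear hy
    induction this with
    | refl => exact ⟨0, fun _ _ => rfl, by rw [edgeBoundary_zero, add_self_of_zmod_two]⟩
    | @tail b c _ hbc ih =>
      obtain ⟨z, hz0, hz⟩ := ih
      obtain ⟨e, heA, he⟩ := hedge v v b c hbc.1 hbc.2.1 hbc.2.2
      have heT : e ∈ T := by
        refine mem_filter.2 ⟨heA, ?_⟩
        rcases Sym2.eq_iff.1 he with ⟨h1, h2⟩ | ⟨h1, h2⟩ <;>
          rw [h1, h2, hq v b hbc.1, hq v c hbc.2.1]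
      refine ⟨z + Pi.single e 1, fun f hf => ?_, ?_⟩
      · have : f ≠ e := fun h => hf (h ▸ heT)
        simp [hz0 f hf, this]
      · rw [edgeBoundary_add, hz, edgeBoundary_single_of_ends he]
        have := add_self_of_zmod_two (Finsupp.single b (1 : ZMod 2))
        calc _ = Finsupp.single x 1 + Finsupp.single c 1 +
              (Finsupp.single b (1 : ZMod 2) + Finsupp.single b 1) := by abel
          _ = _ := by rw [this, add_zero]
  · intro u _ v _ huv
    obtain ⟨x, hx, y, hy, hxy⟩ := hadj u v huv
    obtain ⟨e, heA, he⟩ := hedge u v x y hx hy hxy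
    have hm : s(q (gridSource N e), q (gridTarget N e)) = s(u, v) := by
      rw [← Sym2.map_mk, he, Sym2.map_mk, hq u x hx, hq v y hy]
    refine ⟨e, mem_sdiff.2 ⟨heA, fun heT => huv.ne ?_⟩, hm⟩
    have := (mem_filter.1 heT).2
    rcases Sym2.eq_iff.1 hm with ⟨h1, h2⟩ | ⟨h1, h2⟩
    · rw [← h1, ← h2, this]
    · rw [← h1, ← h2, this]

/-- The closed square of side `h` with lower left corner `(c.1 * h - M, c.2 * h - M)`. -/
def gridCell (M h : ℝ) (c : ℕ × ℕ) : Set (ℝ × ℝ) :=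
  Set.Icc (c.1 * h - M) ((c.1 + 1) * h - M) ×ˢ Set.Icc (c.2 * h - M) ((c.2 + 1) * h - M)

/-- The cells of the grid that meet `S`. -/
def cellsMeeting (M h : ℝ) (S : Set (ℝ × ℝ)) : Set (ℕ × ℕ) :=
  {c | (gridCell M h c ∩ S).Nonempty}

section

variable {M h : ℝ}

lemma isClosed_gridCell (c : ℕ × ℕ) : IsClosed (gridCell M h c) := isClosed_Icc.prod isClosed_Icc

lemma dist_le_of_mem_gridCell {c : ℕ × ℕ} {p q : ℝ × ℝ} (hp : p ∈ gridCell M h c)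
    (hq : q ∈ gridCell M h c) : dist p q ≤ h := by
  obtain ⟨⟨h1, h2⟩, h3, h4⟩ := hp
  obtain ⟨⟨h5, h6⟩, h7, h8⟩ := hq
  rw [Prod.dist_eq, Real.dist_eq, Real.dist_eq]
  exact max_le (abs_le.2 ⟨by linarith, by linarith⟩) (abs_le.2 ⟨by linarith, by linarith⟩)

lemma exists_index (hh : 0 < h) {x : ℝ} (hx : -M ≤ x) :
    ∃ n : ℕ, x ∈ Set.Icc (n * h - M) ((n + 1) * h - M) := by
  refine ⟨⌊(x + M) / h⌋₊, ?_, ?_⟩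
  · have := Nat.floor_le (a := (x + M) / h) (div_nonneg (by linarith) hh.le)
    rw [le_div_iff₀ hh] at this
    linarith
  · have := Nat.lt_floor_add_one ((x + M) / h)
    rw [div_lt_iff₀ hh] at this
    linarith

lemma exists_mem_gridCell (hh : 0 < h) {p : ℝ × ℝ} (hp : -M ≤ p.1 ∧ -M ≤ p.2) :
    ∃ c, p ∈ gridCell M h c := by
  obtain ⟨m, hm⟩ := exists_index hh hp.1
  obtain ⟨n, hn⟩ := exists_index hh hp.2
  exact ⟨(m, n), hm, hn⟩

lemma index_lt (hh : 0 < h) {x : ℝ} (hx : x ≤ M) {n : ℕ} (hn : n * h - M ≤ x) :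
    n < ⌊2 * M / h⌋₊ + 1 := by
  refine Nat.lt_succ_of_le (Nat.le_floor ?_)
  rw [le_div_iff₀ hh]
  linarith

lemma index_le_succ (hh : 0 < h) {x : ℝ} {m n : ℕ} (hm : x ∈ Set.Icc (m * h - M) ((m + 1) * h - M))
    (hn : x ∈ Set.Icc (n * h - M) ((n + 1) * h - M)) : m ≤ n + 1 := by
  have h1 : (m : ℝ) * h ≤ (n + 1) * h := by linarith [hm.1, hn.2]
  exact_mod_cast le_of_mul_le_mul_right h1 hh

lemma lt_of_mem_cellsMeeting (hh : 0 < h) {S : Set (ℝ × ℝ)}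
    (hS : S ⊆ Set.Icc (-M) M ×ˢ Set.Icc (-M) M) {c : ℕ × ℕ} (hc : c ∈ cellsMeeting M h S) :
    c.1 < ⌊2 * M / h⌋₊ + 1 ∧ c.2 < ⌊2 * M / h⌋₊ + 1 := by
  obtain ⟨p, hpc, hpS⟩ := hc
  exact ⟨index_lt hh (hS hpS).1.2 hpc.1.1, index_lt hh (hS hpS).2.2 hpc.2.1⟩

lemma gridJoined_of_mem_inter (hh : 0 < h) {S : Set (ℝ × ℝ)} {p : ℝ × ℝ} (hp : p ∈ S)
    {c d : ℕ × ℕ} (hc : p ∈ gridCell M h c) (hd : p ∈ gridCell M h d) :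
    GridJoined (cellsMeeting M h S) c d := by
  have hm : p ∈ gridCell M h (c.1, d.2) := ⟨hc.1, hd.2⟩
  have h1 := index_le_succ hh hc.1 hd.1
  have h2 := index_le_succ hh hd.1 hc.1
  have h3 := index_le_succ hh hc.2 hd.2
  have h4 := index_le_succ hh hd.2 hc.2
  have hcm : GridJoined (cellsMeeting M h S) c (c.1, d.2) := by
    by_cases he : c.2 = d.2
    · rw [← he]
      exact .refl
    · refine .single ⟨⟨p, hc, hp⟩, ⟨p, hm, hp⟩, ?_⟩
      simp only [GridAdj, Prod.ext_iff, true_and]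
      omega
  refine hcm.trans ?_
  by_cases he : c.1 = d.1
  · rw [he]
  · refine .single ⟨⟨p, hm, hp⟩, ⟨p, hd, hp⟩, ?_⟩
    simp only [GridAdj, Prod.ext_iff, and_true]
    omega

lemma gridJoined_cellsMeeting (hh : 0 < h) {S : Set (ℝ × ℝ)} (hconn : IsPreconnected S)
    (hS : S ⊆ Set.Icc (-M) M ×ˢ Set.Icc (-M) M) {c d : ℕ × ℕ} (hc : c ∈ cellsMeeting M h S)
    (hd : d ∈ cellsMeeting M h S) : GridJoined (cellsMeeting M h S) c d := by
  by_contra hcd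
  have hfin : (cellsMeeting M h S).Finite :=
    ((Set.finite_Iio (⌊2 * M / h⌋₊ + 1)).prod (Set.finite_Iio (⌊2 * M / h⌋₊ + 1))).subset
      fun x hx => lt_of_mem_cellsMeeting hh hS hx
  have hclosed : ∀ P : ℕ × ℕ → Prop,
      IsClosed (⋃ x ∈ {x ∈ cellsMeeting M h S | P x}, gridCell M h x) := fun P =>
    (hfin.subset (Set.sep_subset _ _)).isClosed_biUnion fun x _ => isClosed_gridCell x
  have hcover : S ⊆ (⋃ x ∈ {x ∈ cellsMeeting M h S | GridJoined (cellsMeeting M h S) c x},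
      gridCell M h x) ∪ ⋃ x ∈ {x ∈ cellsMeeting M h S | ¬ GridJoined (cellsMeeting M h S) c x},
      gridCell M h x := by
    intro p hp
    obtain ⟨x, hx⟩ := exists_mem_gridCell hh ⟨(hS hp).1.1, (hS hp).2.1⟩
    by_cases hcx : GridJoined (cellsMeeting M h S) c x
    · exact .inl (Set.mem_biUnion ⟨⟨p, hx, hp⟩, hcx⟩ hx)
    · exact .inr (Set.mem_biUnion ⟨⟨p, hx, hp⟩, hcx⟩ hx)
  obtain ⟨p, hpc, hpS⟩ := id hc
  obtain ⟨q, hqd, hqS⟩ := id hd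
  obtain ⟨r, hrS, hr1, hr2⟩ := isPreconnected_closed_iff.1 hconn _ _ (hclosed _) (hclosed _) hcover
    ⟨p, hpS, Set.mem_biUnion ⟨hc, .refl⟩ hpc⟩ ⟨q, hqS, Set.mem_biUnion ⟨hd, hcd⟩ hqd⟩
  simp only [Set.mem_iUnion] at hr1 hr2
  obtain ⟨x, hx, hrx⟩ := hr1
  obtain ⟨y, hy, hry⟩ := hr2
  exact hy.2 (hx.2.trans (gridJoined_of_mem_inter hh hrS hrx hry))

end

lemma GridJoined.mono {X Y : Set (ℕ × ℕ)} (hXY : X ⊆ Y) {x y : ℕ × ℕ} (h : GridJoined X x y) :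
    GridJoined Y x y :=
  Relation.ReflTransGen.mono (fun _ _ h => ⟨hXY h.1, hXY h.2.1, h.2.2⟩) _ _ h

lemma GridJoined.symm {X : Set (ℕ × ℕ)} {x y : ℕ × ℕ} (h : GridJoined X x y) :
    GridJoined X y x := by
  induction h with
  | refl => exact .refl
  | tail _ hbc ih => exact .head ⟨hbc.2.1, hbc.1, hbc.2.2.symm⟩ ih

lemma exists_initial_segment {K L J : Set (ℕ × ℕ)} (hJ : ∀ x ∈ J, ∀ y ∈ J, GridJoined J x y)
    (hKL : Disjoint K L) (hKJ : (K ∩ J).Nonempty) (hLJ : (L ∩ J).Nonempty) :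
    ∃ R ⊆ J \ L, ∃ a ∈ K, (∀ x ∈ R, GridJoined R a x) ∧ ∃ x ∈ R, ∃ y ∈ L, GridAdj x y := by
  obtain ⟨a, haK, haJ⟩ := hKJ
  obtain ⟨b, hbL, hbJ⟩ := hLJ
  have haL : a ∉ L := fun h => Set.disjoint_left.1 hKL haK h
  have hsub : {x | GridJoined (J \ L) a x} ⊆ J \ L := by
    intro x hx
    rcases Relation.ReflTransGen.cases_tail hx with rfl | ⟨y, -, hy⟩
    · exact ⟨haJ, haL⟩
    · exact hy.2.1
  refine ⟨{x | GridJoined (J \ L) a x}, hsub, a, haK, ?_, ?_⟩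
  · intro x hx
    have hx : GridJoined (J \ L) a x := hx
    induction hx with
    | refl => exact .refl
    | @tail y z hy hyz ih => exact (ih hy).tail ⟨hy, Relation.ReflTransGen.tail hy hyz, hyz.2.2⟩
  · by_contra hcon
    have : ∀ x, GridJoined J a x → GridJoined (J \ L) a x := by
      intro x hx
      induction hx with
      | refl => exact .refl
      | @tail y z _ hyz ih =>
        refine ih.tail ⟨hsub ih, ⟨hyz.2.1, fun hz => hcon ⟨y, ih, z, hz, hyz.2.2⟩⟩, hyz.2.2⟩
    exact (hsub (this b (hJ a haJ b hbJ))).2 hbL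

lemma exists_separation {ι X : Type*} [Finite ι] [MetricSpace X] {C : ι → Set X}
    (hC : ∀ i, IsCompact (C i)) :
    ∃ δ : ℝ, 0 < δ ∧ ∀ i j, Disjoint (C i) (C j) → ∀ x ∈ C i, ∀ y ∈ C j, δ < dist x y := by
  have key : ∀ i j, ∀ᶠ δ : ℝ in nhdsWithin 0 (Set.Ioi 0), Disjoint (C i) (C j) →
      ∀ x ∈ C i, ∀ y ∈ C j, δ < dist x y := by
    intro i j
    by_cases hd : Disjoint (C i) (C j)
    · obtain ⟨r, hr, hrd⟩ := Metric.exists_pos_forall_lt_edist (hC i) (hC j).isClosed hd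
      filter_upwards [Ioo_mem_nhdsGT (show (0 : ℝ) < r from hr)] with δ hδ _ x hx y hy
      refine hδ.2.trans ?_
      have := hrd x hx y hy
      rw [edist_nndist] at this
      exact_mod_cast this
    · exact .of_forall fun _ h => (hd h).elim
  obtain ⟨δ, h1, h2⟩ := ((Filter.eventually_all.2 fun i => Filter.eventually_all.2 (key i)).and
    self_mem_nhdsWithin).exists
  exact ⟨δ, h2, h1⟩

lemma SimpleGraph.isMacLane_of_cells {V : Type} [Nonempty V] {G : SimpleGraph V}
    (S : Finset V) (N : ℕ) {E : V → V → Prop} {K : V → Set (ℕ × ℕ)} {J : V → V → Set (ℕ × ℕ)}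
    (hG : ∀ u v, G.Adj u v → E u v ∨ E v u) (hasymm : ∀ u v, E u v → ¬ E v u)
    (hKN : ∀ v, ∀ x ∈ K v, x.1 < N ∧ x.2 < N)
    (hJN : ∀ u v, E u v → ∀ x ∈ J u v, x.1 < N ∧ x.2 < N)
    (hK : ∀ v, ∀ x ∈ K v, ∀ y ∈ K v, GridJoined (K v) x y)
    (hJ : ∀ u v, E u v → ∀ x ∈ J u v, ∀ y ∈ J u v, GridJoined (J u v) x y)
    (hKK : ∀ u v, u ≠ v → Disjoint (K u) (K v))
    (hJJ : ∀ u v x y, E u v → E x y → (u, v) ≠ (x, y) → Disjoint (J u v) (J x y))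
    (hJK : ∀ u v w, E u v → w ≠ u → w ≠ v → Disjoint (J u v) (K w))
    (hfst : ∀ u v, E u v → (K u ∩ J u v).Nonempty)
    (hsnd : ∀ u v, E u v → (K v ∩ J u v).Nonempty) : G.IsMacLane S := by
  have hseg : ∀ u v, ∃ R : Set (ℕ × ℕ), E u v → R ⊆ J u v \ K v ∧ ∃ a ∈ K u,
      (∀ x ∈ R, GridJoined R a x) ∧ ∃ x ∈ R, ∃ y ∈ K v, GridAdj x y := by
    intro u v
    by_cases h : E u v
    · have hne : u ≠ v := by
        rintro rfl
        exact hasymm u u h h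
      obtain ⟨R, hR⟩ := exists_initial_segment (hJ u v h) (hKK u v hne) (hfst u v h) (hsnd u v h)
      exact ⟨R, fun _ => hR⟩
    · exact ⟨∅, fun h' => (h h').elim⟩
  choose R hR using hseg
  let B : V → Set (ℕ × ℕ) := fun u => K u ∪ {x | ∃ v, E u v ∧ x ∈ R u v}
  have hRB : ∀ u v, E u v → R u v ⊆ B u := fun u v h x hx => .inr ⟨v, h, hx⟩
  have hKR : ∀ u v w x, u ≠ v → E v w → x ∈ K u → x ∉ R v w := by
    intro u v w x huv h hx hxR
    obtain ⟨hxJ, hxw⟩ := (hR v w h).1 hxR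
    by_cases huw : u = w
    · exact hxw (huw ▸ hx)
    · exact Set.disjoint_left.1 (hJK v w u h huv huw) hxJ hx
  have hadj : ∀ u v, E u v → ∃ x ∈ B u, ∃ y ∈ B v, GridAdj x y := by
    intro u v h
    obtain ⟨-, -, -, -, x, hx, y, hy, hxy⟩ := hR u v h
    exact ⟨x, hRB u v h hx, y, .inl hy, hxy⟩
  have hroot : ∀ v, ∀ x ∈ B v, ∃ a ∈ K v, GridJoined (B v) a x := by
    rintro v x (hx | ⟨w, h, hx⟩)
    · exact ⟨x, hx, .refl⟩
    · obtain ⟨-, a, ha, hj, -⟩ := hR v w h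
      exact ⟨a, ha, (hj x hx).mono (hRB v w h)⟩
  refine SimpleGraph.isMacLane_of_branchSets S N B ?_ ?_ ?_ ?_
  · rintro v x (hx | ⟨w, h, hx⟩)
    · exact hKN v x hx
    · exact hJN v w h x ((hR v w h).1 hx).1
  · rintro v w x hv hw
    by_contra hne
    rcases hv with hv | ⟨v', h, hv⟩ <;> rcases hw with hw | ⟨w', h', hw⟩
    · exact Set.disjoint_left.1 (hKK v w hne) hv hw
    · exact hKR v w w' x hne h' hv hw
    · exact hKR w v v' x (Ne.symm hne) h hw hv
    · refine Set.disjoint_left.1 (hJJ v v' w w' h h' fun he => hne (Prod.ext_iff.1 he).1)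
        ((hR v v' h).1 hv).1 ((hR w w' h').1 hw).1
  · intro v x hx y hy
    obtain ⟨a, ha, hax⟩ := hroot v x hx
    obtain ⟨b, hb, hby⟩ := hroot v y hy
    exact hax.symm.trans (((hK v a ha b hb).mono Set.subset_union_left).trans hby)
  · intro u v huv
    rcases hG u v huv with h | h
    · exact hadj u v h
    · obtain ⟨x, hx, y, hy, hxy⟩ := hadj v u h
      exact ⟨y, hy, x, hx, hxy.symm⟩

lemma SimpleGraph.isMacLane_of_regions {V : Type} [Finite V] [Nonempty V] {G : SimpleGraph V}
    (S : Finset V) {E : V → V → Prop} {K : V → Set (ℝ × ℝ)} {J : V → V → Set (ℝ × ℝ)}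
    (hG : ∀ u v, G.Adj u v → E u v ∨ E v u) (hasymm : ∀ u v, E u v → ¬ E v u)
    (hKc : ∀ v, IsCompact (K v)) (hJc : ∀ u v, E u v → IsCompact (J u v))
    (hK : ∀ v, IsPreconnected (K v)) (hJ : ∀ u v, E u v → IsPreconnected (J u v))
    (hKK : ∀ u v, u ≠ v → Disjoint (K u) (K v))
    (hJJ : ∀ u v x y, E u v → E x y → (u, v) ≠ (x, y) → Disjoint (J u v) (J x y))
    (hJK : ∀ u v w, E u v → w ≠ u → w ≠ v → Disjoint (J u v) (K w))
    (hfst : ∀ u v, E u v → (K u ∩ J u v).Nonempty)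
    (hsnd : ∀ u v, E u v → (K v ∩ J u v).Nonempty) : G.IsMacLane S := by
  let C : V ⊕ {e : V × V // E e.1 e.2} → Set (ℝ × ℝ) := Sum.elim K fun e => J e.1.1 e.1.2
  have hC : ∀ i, IsCompact (C i) := by
    rintro (v | ⟨e, he⟩)
    · exact hKc v
    · exact hJc _ _ he
  obtain ⟨h, hh, hsep⟩ := exists_separation hC
  obtain ⟨M, hM⟩ := ((isCompact_iUnion hC).isBounded.subset_closedBall 0)
  have hbox : ∀ i, C i ⊆ Set.Icc (-M) M ×ˢ Set.Icc (-M) M := by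
    intro i p hp
    have := hM (Set.mem_iUnion.2 ⟨i, hp⟩)
    rw [Metric.mem_closedBall, Prod.dist_eq, max_le_iff, Real.dist_eq, Real.dist_eq] at this
    simp only [Prod.fst_zero, Prod.snd_zero, sub_zero, abs_le] at this
    exact this
  have hdisj : ∀ i j, Disjoint (C i) (C j) →
      Disjoint (cellsMeeting M h (C i)) (cellsMeeting M h (C j)) := by
    refine fun i j hij => Set.disjoint_left.2 ?_
    rintro c ⟨p, hpc, hp⟩ ⟨q, hqc, hq⟩
    exact absurd (dist_le_of_mem_gridCell hpc hqc) (not_le.2 (hsep i j hij p hp q hq))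
  have hmeet : ∀ i j, (C i ∩ C j).Nonempty →
      (cellsMeeting M h (C i) ∩ cellsMeeting M h (C j)).Nonempty := by
    rintro i j ⟨p, hpi, hpj⟩
    obtain ⟨c, hc⟩ := exists_mem_gridCell (M := M) hh ⟨(hbox i hpi).1.1, (hbox i hpi).2.1⟩
    exact ⟨c, ⟨p, hc, hpi⟩, p, hc, hpj⟩
  let inj : ∀ u v, E u v → V ⊕ {e : V × V // E e.1 e.2} := fun u v h => .inr ⟨(u, v), h⟩
  exact SimpleGraph.isMacLane_of_cells S (⌊2 * M / h⌋₊ + 1) (E := E)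
    (K := fun v => cellsMeeting M h (K v)) (J := fun u v => cellsMeeting M h (J u v)) hG hasymm
    (fun v x hx => lt_of_mem_cellsMeeting hh (hbox (.inl v)) hx)
    (fun u v he x hx => lt_of_mem_cellsMeeting hh (hbox (inj u v he)) hx)
    (fun v x hx y hy => gridJoined_cellsMeeting hh (hK v) (hbox (.inl v)) hx hy)
    (fun u v he x hx y hy => gridJoined_cellsMeeting hh (hJ u v he) (hbox (inj u v he)) hx hy)
    (fun u v hne => hdisj (.inl u) (.inl v) (hKK u v hne))
    (fun u v x y he he' hne => hdisj (inj u v he) (inj x y he') (hJJ u v x y he he' hne))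
    (fun u v w he h1 h2 => hdisj (inj u v he) (.inl w) (hJK u v w he h1 h2))
    (fun u v he => hmeet (.inl u) (inj u v he) (hfst u v he))
    (fun u v he => hmeet (.inl v) (inj u v he) (hsnd u v he))

namespace PlaneEmbedding

variable {V : Type} {G : SimpleGraph V} (D : PlaneEmbedding G)

lemma eq_of_arc_eq_pos {u v w : V} (h : G.Adj u v) {t : Set.Icc (0 : ℝ) 1}
    (ht : D.arc u v t = D.pos w) : (w = u ∧ (t : ℝ) = 0) ∨ (w = v ∧ (t : ℝ) = 1) := by
  by_cases hu : w = u
  · subst hu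
    exact .inl ⟨rfl, congrArg Subtype.val (D.arc_inj w v h (ht.trans (D.arc_start w v h).symm))⟩
  · by_cases hv : w = v
    · subst hv
      exact .inr ⟨rfl, congrArg Subtype.val (D.arc_inj u w h (ht.trans (D.arc_end u w h).symm))⟩
    · exact (D.arc_avoid u v w h hu hv ⟨t, ht⟩).elim

lemma exists_eq_pos_of_arc_eq {u v x y : V} (h : G.Adj u v) (h' : G.Adj x y)
    (hne : ({u, v} : Set V) ≠ {x, y}) {t t' : Set.Icc (0 : ℝ) 1} (ht : D.arc u v t = D.arc x y t') :
    ∃ w, D.arc u v t = D.pos w := by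
  obtain ⟨w, -, hw⟩ := D.arcs_meet_only_at_endpoints u v x y h h' hne ⟨⟨t, rfl⟩, t', ht.symm⟩
  exact ⟨w, hw.symm⟩

/-- The parameters of the third of the edge `a b` next to its end `v`. -/
def nearParam (v a b : V) : Set (Set.Icc (0 : ℝ) 1) :=
  {t | (v = a ∧ (t : ℝ) ≤ 1 / 3) ∨ (v = b ∧ 2 / 3 ≤ (t : ℝ))}

/-- The parameters of the middle third of an edge. -/
def midParam : Set (Set.Icc (0 : ℝ) 1) := {t | 1 / 3 ≤ (t : ℝ) ∧ (t : ℝ) ≤ 2 / 3}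

/-- The vertex `v` together with the thirds next to `v` of the edges selected by `E`. -/
def star (E : V → V → Prop) (v : V) : Set (ℝ × ℝ) :=
  {D.pos v} ∪ ⋃ a, ⋃ b, ⋃ (_ : E a b), D.arc a b '' nearParam v a b

lemma mem_star {E : V → V → Prop} {v : V} {p : ℝ × ℝ} : p ∈ D.star E v ↔ p = D.pos v ∨
    ∃ a b, E a b ∧ ∃ t ∈ nearParam v a b, D.arc a b t = p := by
  simp [star]

lemma isCompact_nearParam (v a b : V) : IsCompact (nearParam v a b) := by
  have h1 : IsClosed {t : Set.Icc (0 : ℝ) 1 | (t : ℝ) ≤ 1 / 3} :=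
    isClosed_le continuous_subtype_val continuous_const
  have h2 : IsClosed {t : Set.Icc (0 : ℝ) 1 | 2 / 3 ≤ (t : ℝ)} :=
    isClosed_le continuous_const continuous_subtype_val
  exact (((isClosed_const (p := v = a)).inter h1).union
    ((isClosed_const (p := v = b)).inter h2)).isCompact

lemma isCompact_midParam : IsCompact midParam :=
  ((isClosed_le continuous_const continuous_subtype_val).inter
    (isClosed_le continuous_subtype_val continuous_const)).isCompact

lemma isPreconnected_preimage_val {s : Set ℝ} (hs : s.OrdConnected) :
    IsPreconnected ((↑) ⁻¹' s : Set (Set.Icc (0 : ℝ) 1)) := by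
  rw [← Topology.IsInducing.subtypeVal.isPreconnected_image, Subtype.image_preimage_coe]
  exact (Set.ordConnected_Icc.inter hs).isPreconnected

lemma isPreconnected_nearParam {v a b : V} (h : a ≠ b) : IsPreconnected (nearParam v a b) := by
  by_cases ha : v = a
  · have : nearParam v a b = (↑) ⁻¹' Set.Iic (1 / 3 : ℝ) := by
      ext t
      simp [nearParam, ha, h]
    rw [this]
    exact isPreconnected_preimage_val Set.ordConnected_Iic
  · by_cases hb : v = b
    · have : nearParam v a b = (↑) ⁻¹' Set.Ici (2 / 3 : ℝ) := by
        ext t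
        simp [nearParam, hb, Ne.symm h]
      rw [this]
      exact isPreconnected_preimage_val Set.ordConnected_Ici
    · have : nearParam v a b = ∅ := by
        ext t
        simp [nearParam, ha, hb]
      rw [this]
      exact isPreconnected_empty

variable {E : V → V → Prop} (hE : ∀ a b, E a b → G.Adj a b)
include D hE

lemma isCompact_star [Finite V] (v : V) : IsCompact (D.star E v) :=
  isCompact_singleton.union <| isCompact_iUnion fun a => isCompact_iUnion fun b =>
    isCompact_iUnion fun h => (isCompact_nearParam v a b).image (D.arc_cont a b (hE a b h))

lemma isPreconnected_star (v : V) : IsPreconnected (D.star E v) := by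
  refine isPreconnected_of_forall (D.pos v) fun p hp => ?_
  rcases D.mem_star.1 hp with rfl | ⟨a, b, h, t, ht, rfl⟩
  · exact ⟨{D.pos v}, by simpa using hp, rfl, rfl, isPreconnected_singleton⟩
  · refine ⟨D.arc a b '' nearParam v a b, ?_, ?_, ⟨t, ht, rfl⟩,
      (isPreconnected_nearParam (hE a b h).ne).image _ (D.arc_cont a b (hE a b h)).continuousOn⟩
    · rintro _ ⟨t', ht', rfl⟩
      exact D.mem_star.2 (.inr ⟨a, b, h, t', ht', rfl⟩)
    · rcases ht with ⟨rfl, -⟩ | ⟨rfl, -⟩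
      · exact ⟨_, .inl ⟨rfl, by norm_num⟩, D.arc_start v b (hE v b h)⟩
      · exact ⟨_, .inr ⟨rfl, by norm_num⟩, D.arc_end a v (hE a v h)⟩

lemma eq_of_pos_mem_star {v w : V} (h : D.pos w ∈ D.star E v) : w = v := by
  rcases D.mem_star.1 h with h | ⟨a, b, h, t, ht, hp⟩
  · exact D.pos_inj h
  · rcases D.eq_of_arc_eq_pos (hE a b h) hp with ⟨rfl, h0⟩ | ⟨rfl, h1⟩ <;>
      rcases ht with ⟨rfl, ht⟩ | ⟨rfl, ht⟩ <;> first | rfl | linarith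

lemma disjoint_star {v w : V} (hne : v ≠ w) (hasymm : ∀ a b, E a b → ¬ E b a) :
    Disjoint (D.star E v) (D.star E w) := by
  refine Set.disjoint_left.2 fun p hv hw => ?_
  have hpos : ∀ x, p ≠ D.pos x := by
    rintro x rfl
    exact hne ((D.eq_of_pos_mem_star hE hv).symm.trans (D.eq_of_pos_mem_star hE hw))
  rcases D.mem_star.1 hv with h | ⟨a, b, h, t, ht, rfl⟩
  · exact hpos v h
  rcases D.mem_star.1 hw with h' | ⟨a', b', h', t', ht', hp⟩
  · exact hpos w h'
  by_cases he : ({a, b} : Set V) = {a', b'}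
  · rcases Set.pair_eq_pair_iff.1 he with ⟨rfl, rfl⟩ | ⟨rfl, rfl⟩
    · obtain rfl := D.arc_inj a b (hE a b h) hp
      rcases ht with ⟨rfl, ht⟩ | ⟨rfl, ht⟩ <;> rcases ht' with ⟨rfl, ht'⟩ | ⟨rfl, ht'⟩ <;>
        first | exact hne rfl | linarith
    · exact hasymm a b h h'
  · obtain ⟨x, hx⟩ := D.exists_eq_pos_of_arc_eq (hE a b h) (hE a' b' h') he hp.symm
    exact hpos x hx

lemma arc_ne_pos {a b : V} (h : E a b) {t : Set.Icc (0 : ℝ) 1} (ht : t ∈ midParam) (x : V) :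
    D.arc a b t ≠ D.pos x := by
  intro hx
  rcases D.eq_of_arc_eq_pos (hE a b h) hx with ⟨-, h0⟩ | ⟨-, h1⟩ <;> linarith [ht.1, ht.2]

lemma isMacLane_of_asymm [Finite V] [Nonempty V] (S : Finset V)
    (hG : ∀ u v, G.Adj u v → E u v ∨ E v u) (hasymm : ∀ u v, E u v → ¬ E v u) :
    G.IsMacLane S := by
  have hpar : ∀ a b x y, E a b → E x y → (a, b) ≠ (x, y) → ∀ t ∈ midParam, ∀ t',
      D.arc a b t ≠ D.arc x y t' := by
    intro a b x y h h' hne t ht t' heq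
    by_cases he : ({a, b} : Set V) = {x, y}
    · rcases Set.pair_eq_pair_iff.1 he with ⟨rfl, rfl⟩ | ⟨rfl, rfl⟩
      · exact hne rfl
      · exact hasymm a b h h'
    · obtain ⟨w, hw⟩ := D.exists_eq_pos_of_arc_eq (hE a b h) (hE x y h') he heq
      exact D.arc_ne_pos hE h ht w hw
  refine SimpleGraph.isMacLane_of_regions S (E := E) (K := D.star E)
    (J := fun u v => D.arc u v '' midParam) hG hasymm (D.isCompact_star hE)
    (fun u v h => isCompact_midParam.image (D.arc_cont u v (hE u v h)))
    (D.isPreconnected_star hE)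
    (fun u v h => (isPreconnected_preimage_val Set.ordConnected_Icc).image _
      (D.arc_cont u v (hE u v h)).continuousOn)
    (fun u v hne => D.disjoint_star hE hne hasymm) ?_ ?_ ?_ ?_
  · rintro u v x y h h' hne
    refine Set.disjoint_left.2 ?_
    rintro _ ⟨t, ht, rfl⟩ ⟨t', -, heq⟩
    exact hpar u v x y h h' hne t ht t' heq.symm
  · rintro u v w h hu hv
    refine Set.disjoint_left.2 ?_
    rintro _ ⟨t, ht, rfl⟩ hw
    rcases D.mem_star.1 hw with hw | ⟨a, b, h', t', ht', heq⟩
    · exact D.arc_ne_pos hE h ht w hw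
    · refine hpar u v a b h h' ?_ t ht t' heq.symm
      rintro ⟨⟩
      rcases ht' with ⟨rfl, -⟩ | ⟨rfl, -⟩
      · exact hu rfl
      · exact hv rfl
  · intro u v h
    exact ⟨D.arc u v ⟨1 / 3, by norm_num⟩,
      D.mem_star.2 (.inr ⟨u, v, h, _, .inl ⟨rfl, le_rfl⟩, rfl⟩), _, by norm_num [midParam], rfl⟩
  · intro u v h
    exact ⟨D.arc u v ⟨2 / 3, by norm_num⟩,
      D.mem_star.2 (.inr ⟨u, v, h, _, .inr ⟨rfl, le_rfl⟩, rfl⟩), _, by norm_num [midParam], rfl⟩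

end PlaneEmbedding

lemma SimpleGraph.IsPlanar.isMacLane {V : Type} [Finite V] [Nonempty V] {G : SimpleGraph V}
    (h : G.IsPlanar) (S : Finset V) : G.IsMacLane S := by
  obtain ⟨D⟩ := h
  obtain ⟨_, -⟩ := exists_wellFoundedLT V
  refine D.isMacLane_of_asymm (E := fun u v => G.Adj u v ∧ u < v) (fun _ _ h => h.1) S ?_ ?_
  · intro u v huv
    rcases lt_or_gt_of_ne huv.ne with h | h
    · exact .inl ⟨huv, h⟩
    · exact .inr ⟨huv.symm, h⟩
  · exact fun u v h h' => lt_asymm h.2 h'.2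

/-- Every `3`-coloured finite vertex set can be recoloured with `0` as its largest class. -/
lemma exists_coloring_card_le {V : Type} [Fintype V] {G : SimpleGraph V} {c : V → Fin 3}
    (hc : ∀ u v, G.Adj u v → c u ≠ c v) : ∃ c' : V → Fin 3, (∀ u v, G.Adj u v → c' u ≠ c' v) ∧
      Fintype.card V ≤ 3 * #{v | c' v = 0} := by
  obtain ⟨i, -, hi⟩ := exists_max_image (univ : Finset (Fin 3)) (fun i => #{v | c v = i})
    univ_nonempty
  refine ⟨fun v => Equiv.swap i 0 (c v), fun u v huv h => hc u v huv ((Equiv.injective _) h), ?_⟩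
  have h0 : ∀ v, Equiv.swap i 0 (c v) = 0 ↔ c v = i := by
    intro v
    rw [Equiv.swap_apply_eq_iff, Equiv.swap_apply_right]
  simp only [h0]
  have hsum := card_eq_sum_card_fiberwise (f := c) (s := univ) (t := univ) fun _ _ => mem_univ _
  rw [← card_univ, hsum]
  simpa using sum_le_card_nsmul univ (fun i => #{v | c v = i}) _ hi

/-- every triangle-free planar graph has an independent set `X` with
`|X| ≥ |V(G)|/3` which is `3`-sufficient: `G` is `f`-choosable for `f = 3` on `X`, `4` off `X`. -/
theorem trianglefree_planar_three_sufficient_indep_set {V : Type} [Fintype V] [DecidableEq V]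
    (G : SimpleGraph V) (hplanar : G.IsPlanar) (htf : G.CliqueFree 3) :
    ∃ X : Finset V, (∀ u ∈ X, ∀ v ∈ X, ¬ G.Adj u v) ∧
      Fintype.card V ≤ 3 * X.card ∧
      ∀ L : V → Finset ℕ, (∀ v, v ∈ X → (L v).card = 3) → (∀ v, v ∉ X → (L v).card = 4) →
        ∃ φ : V → ℕ, ProperListColoring G L φ := by
  rcases isEmpty_or_nonempty V with hV | hV
  · exact ⟨∅, by simp, by simp, fun _ _ _ => ⟨fun _ => 0, fun v => hV.elim v, fun v => hV.elim v⟩⟩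
  have hmac : G.IsMacLane univ := hplanar.isMacLane univ
  obtain ⟨c₀, hc₀⟩ := hmac.threeColOn htf
  obtain ⟨c, hc, hcard⟩ := exists_coloring_card_le (G := G) (c := c₀) fun u v huv =>
    hc₀ u (mem_univ u) v (mem_univ v) huv
  refine ⟨univ.filter fun v => c v = 0, ?_, hcard, fun L h3 h4 => ?_⟩
  · intro u hu v hv huv
    exact hc u v huv ((mem_filter.1 hu).2.trans (mem_filter.1 hv).2.symm)
  · obtain ⟨φ, hφ⟩ := listColOn_of_sparse hc
      (fun S => (hmac.mono (subset_univ S)).dartsIn_le_four_mul htf) (L := L)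
      (fun v hv => h3 v (by simpa using hv)) (fun v hv => h4 v (by simpa using hv)) univ
    exact ⟨φ, fun v => hφ.1 v (mem_univ v), fun u v => hφ.2 u (mem_univ u) v (mem_univ v)⟩
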